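/- arXiv:1509.00420 — 3 statements merged into one kernel-verified Lean document; each statement's English description precedes it below -/
import Mathlib

section
/- For every field F there exists an associative F-algebra R without identity such that every element of R is nilpotent (so the operation a∘b = a·b + a + b makes R into a group R° with identity 0), yet the group R° is not an Engel group; that is, there exist x, y ∈ R such that for every n ≥ 1 the n-fold left-normed commutator [[…[[x,y],y],…],y] computed in R° is not equal to 0. -/
namespace Paper

section NonUnital

variable {R : Type*} [NonUnitalRing R]

/-- The circle (adjoint) operation `a ∘ b = a·b + a + b` of a ring. -/
def circ (a b : R) : R := a * b + a + b

/-- `npow' a n = a^{n+1}` (powers in a possibly nonunital ring). -/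
def npow' (a : R) : ℕ → R
  | 0 => a
  | n + 1 => npow' a n * a

/-- `circPow a n` is the `n`-fold circle power `a ∘ a ∘ ⋯ ∘ a` (`circPow a 0 = 0`,
the identity of the adjoint group). -/
def circPow (a : R) : ℕ → R
  | 0 => 0
  | n + 1 => circ (circPow a n) a

/-- The left-normed Engel sequence in the adjoint group:
`engelChain qinv x y 0 = x` and
`engelChain qinv x y (n+1) = [engelChain qinv x y n, y]`, where the commutator
`[u, v] = u ∘ v ∘ u⁻¹ ∘ v⁻¹` is computed in the adjoint group, `qinv` giving the
inverse (quasi-inverse) of each element. -/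
def engelChain (qinv : R → R) (x y : R) : ℕ → R
  | 0 => x
  | n + 1 =>
    circ (circ (circ (engelChain qinv x y n) y) (qinv (engelChain qinv x y n))) (qinv y)

end NonUnital

/-- A counterexample witness for Statement 10: a nil `F`-algebra `R` (associative,
without identity) whose adjoint group `R° = (R, ∘)` is not an Engel group, witnessed
by elements `x, y` such that every left-normed iterated commutator
`[[…[[x,y],y],…],y]` (with `n ≥ 1` occurrences of `y`) is nonzero.  The function
`qinv` assigns to each element its quasi-inverse, i.e. its inverse in `R°`. -/
structure NilNotEngelAlgebra (F : Type) [Field F] : Type 1 where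
  carrier : Type
  [ring : NonUnitalRing carrier]
  [mod : Module F carrier]
  [smulComm : SMulCommClass F carrier carrier]
  [tower : IsScalarTower F carrier carrier]
  nil : ∀ x : carrier, ∃ n : ℕ, npow' x n = 0
  qinv : carrier → carrier
  circ_qinv : ∀ a : carrier, circ a (qinv a) = 0
  qinv_circ : ∀ a : carrier, circ (qinv a) a = 0
  x : carrier
  y : carrier
  not_engel : ∀ n : ℕ, engelChain qinv x y (n + 1) ≠ 0

section Words

/-- The regular paperfolding sequence. -/
def paperfold (n : ℕ) : Bool :=
  if n = 0 then false else if n % 2 = 0 then paperfold (n / 2) else decide (n % 4 = 1)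
termination_by n
decreasing_by omega

theorem paperfold_two_mul (q : ℕ) : paperfold (2 * q) = paperfold q := by
  rcases Nat.eq_zero_or_pos q with rfl | hq
  · rfl
  · rw [paperfold, if_neg (by omega), if_pos (by omega)]
    congr 1; omega

theorem paperfold_odd (i : ℕ) : paperfold (2 * i + 1) = decide (i % 2 = 0) := by
  rw [paperfold, if_neg (by omega), if_neg (by omega)]
  congr 1
  apply propext; omega

theorem paperfold_add_mul (K : ℕ) :
    ∀ q j : ℕ, 0 < q → q < 2 ^ K → paperfold (q + j * 2 ^ (K + 1)) = paperfold q := by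
  induction K with
  | zero => intro q j h1 h2; simp at h2; omega
  | succ K ih =>
    intro q j h1 h2
    rcases Nat.even_or_odd' q with ⟨p, rfl | rfl⟩
    · have : 2 * p + j * 2 ^ (K + 1 + 1) = 2 * (p + j * 2 ^ (K + 1)) := by ring
      rw [this, paperfold_two_mul, paperfold_two_mul]
      exact ih _ _ (by omega) (by rw [pow_succ] at h2; omega)
    · have : 2 * p + 1 + j * 2 ^ (K + 1 + 1) = 2 * (p + 2 * (j * 2 ^ K)) + 1 := by ring
      rw [this, paperfold_odd, paperfold_odd]
      congr 1
      apply propext; omega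

theorem exists_paperfold_ne (r : ℕ) :
    ∀ o o' : ℕ, o % 2 = o' % 2 → o % 2 ^ (r + 1) ≠ o' % 2 ^ (r + 1) →
      ∃ q, 1 ≤ q ∧ q ≤ 2 ^ r ∧ paperfold (o + q) ≠ paperfold (o' + q) := by
  induction r with
  | zero => intro o o' h1 h2; simp at h2; omega
  | succ r ih =>
    intro o o' h1 h2
    have hr : 1 ≤ 2 ^ r := Nat.one_le_two_pow
    by_cases h4 : o % 4 = o' % 4
    · have hd : (o / 2) % 2 = (o' / 2) % 2 := by omega
      have hne : (o / 2) % 2 ^ (r + 1) ≠ (o' / 2) % 2 ^ (r + 1) := by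
        intro h
        apply h2
        have e1 : (2 : ℕ) ^ (r + 1 + 1) = 2 * 2 ^ (r + 1) := by ring
        rw [e1, Nat.mod_mul, Nat.mod_mul, h, h1]
      obtain ⟨q, hq1, hq2, hq⟩ := ih _ _ hd hne
      refine ⟨2 * q - o % 2, by omega, by rw [pow_succ]; omega, ?_⟩
      have a1 : o + (2 * q - o % 2) = 2 * (o / 2 + q) := by omega
      have a2 : o' + (2 * q - o % 2) = 2 * (o' / 2 + q) := by omega
      rwa [a1, a2, paperfold_two_mul, paperfold_two_mul]
    · refine ⟨1 + o % 2, by omega, by rw [pow_succ]; omega, ?_⟩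
      have a1 : o + (1 + o % 2) = 2 * ((o + o % 2) / 2) + 1 := by omega
      have a2 : o' + (1 + o % 2) = 2 * ((o' + o' % 2) / 2) + 1 := by omega
      rw [a1, a2, paperfold_odd, paperfold_odd]
      intro h
      rw [decide_eq_decide] at h
      omega

/-- The product `f i * f (i + 1) * ⋯ * f (i + n - 1)`. -/
def blockProd {M : Type*} [Monoid M] (f : ℕ → M) (i : ℕ) : ℕ → M
  | 0 => 1
  | n + 1 => blockProd f i n * f (i + n)

theorem blockProd_add {M : Type*} [Monoid M] (f : ℕ → M) (i a b : ℕ) :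
    blockProd f i (a + b) = blockProd f i a * blockProd f (i + a) b := by
  induction b with
  | zero => simp [blockProd]
  | succ b ih => rw [← add_assoc, blockProd, ih, blockProd, mul_assoc, add_assoc]

theorem blockProd_mul {M : Type*} [Monoid M] (f : ℕ → M) (i c u : ℕ) :
    blockProd f i (c * u) = (List.ofFn fun a : Fin c => blockProd f (i + a * u) u).prod := by
  induction c with
  | zero => simp [blockProd]
  | succ c ih =>
    rw [add_mul, one_mul, blockProd_add, ih, List.ofFn_succ', List.concat_eq_append,
      List.prod_append]
    simp

/-- Words in three letters. -/
abbrev Word : Type := FreeMonoid (Fin 3)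

instance : DecidableEq Word := inferInstanceAs (DecidableEq (List (Fin 3)))

theorem word_mul_inj {v v' w w' : Word} (h : v.length = v'.length) :
    v * w = v' * w' ↔ v = v' ∧ w = w' := by
  constructor
  · intro H
    exact List.append_inj (s₁ := v.toList) (s₂ := v'.toList) (t₁ := w.toList) (t₂ := w'.toList)
      H h
  · rintro ⟨rfl, rfl⟩; rfl

/-- The words `ab` and `ba`. -/
def pairWord (ε : Bool) : Word :=
  if ε then FreeMonoid.of 1 * FreeMonoid.of 2 else FreeMonoid.of 2 * FreeMonoid.of 1

theorem pairWord_injective : Function.Injective pairWord := by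
  intro ε δ h
  cases ε <;> cases δ
  · rfl
  · exact absurd (show ([2, 1] : List (Fin 3)) = [1, 2] from h) (by decide)
  · exact absurd (show ([1, 2] : List (Fin 3)) = [2, 1] from h) (by decide)
  · rfl

@[simp] theorem length_pairWord (ε : Bool) : (pairWord ε).length = 2 := by
  cases ε <;> rfl

/-- The leading words of the iterated conjugates of `(1 + a) * (1 + b)`. -/
def conjWord : ℕ → Bool → Word
  | 0, _ => FreeMonoid.of 0
  | k + 1, ε => conjWord k true * pairWord ε * conjWord k false

theorem length_conjWord (k : ℕ) (ε : Bool) : (conjWord k ε).length + 2 = 3 * 2 ^ k := by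
  induction k generalizing ε with
  | zero => rfl
  | succ k ih =>
    have h1 := ih true
    have h2 := ih false
    simp only [conjWord, FreeMonoid.length_mul, length_pairWord]
    rw [pow_succ]; omega

/-- The `i`-th block of level `k`. -/
def blockWord (k i : ℕ) : Word :=
  conjWord k (decide (i % 2 = 0)) * pairWord (paperfold (i + 1))

theorem length_blockWord (k i : ℕ) : (blockWord k i).length = 3 * 2 ^ k := by
  rw [blockWord, FreeMonoid.length_mul, length_pairWord, length_conjWord]

theorem blockWord_succ (k i : ℕ) :
    blockWord (k + 1) i = blockWord k (2 * i) * blockWord k (2 * i + 1) := by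
  have h1 : decide (2 * i % 2 = 0) = true := by simp
  have h2 : decide ((2 * i + 1) % 2 = 0) = false := by simp [Nat.add_mod]
  have h3 : 2 * i + 1 + 1 = 2 * (i + 1) := by ring
  simp only [blockWord, conjWord, h1, h2, h3, paperfold_odd, paperfold_two_mul, mul_assoc]

theorem blockWord_add (k r j : ℕ) :
    blockWord (k + r) j = blockProd (blockWord k) (j * 2 ^ r) (2 ^ r) := by
  induction r generalizing j with
  | zero => simp [blockProd]
  | succ r ih =>
    rw [← add_assoc, blockWord_succ, ih, ih, pow_succ, mul_two, blockProd_add]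
    congr 2 <;> ring

theorem blockWord_ne {k i j : ℕ} (h : paperfold (i + 1) ≠ paperfold (j + 1)) :
    blockWord k i ≠ blockWord k j := by
  intro H
  rw [blockWord, blockWord, word_mul_inj] at H
  · exact h (pairWord_injective H.2)
  · have h1 := length_conjWord k (decide (i % 2 = 0))
    have h2 := length_conjWord k (decide (j % 2 = 0))
    omega

theorem blockWord_eq {k i j : ℕ} (h : i % 2 = j % 2)
    (h' : paperfold (i + 1) = paperfold (j + 1)) : blockWord k i = blockWord k j := by
  rw [blockWord, blockWord, h, h']

theorem length_blockProd {f : ℕ → Word} {L : ℕ} (hL : ∀ i, (f i).length = L) (i n : ℕ) :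
    (blockProd f i n).length = n * L := by
  induction n with
  | zero => simp [blockProd]
  | succ n ih => rw [blockProd, FreeMonoid.length_mul, ih, hL, add_mul, one_mul]

theorem blockProd_eq_iff {f : ℕ → Word} {L : ℕ} (hL : ∀ i, (f i).length = L) (i j n : ℕ) :
    blockProd f i n = blockProd f j n ↔ ∀ q < n, f (i + q) = f (j + q) := by
  induction n with
  | zero => simp [blockProd]
  | succ n ih =>
    rw [blockProd, blockProd, word_mul_inj (by simp only [length_blockProd hL]), ih]
    constructor
    · rintro ⟨h1, h2⟩ q hq
      rcases Nat.lt_succ_iff_lt_or_eq.1 hq with h | rfl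
      · exact h1 q h
      · exact h2
    · exact fun h => ⟨fun q hq => h q (by omega), h n (by omega)⟩

theorem mul_add_two_le (r a : ℕ) (ha : a < 2 ^ r) :
    a * (2 ^ (r + 1) + 2) + (2 ^ (r + 1) + 2) ≤ 2 ^ (2 * r + 1) + 2 ^ (r + 1) := by
  have h : (a + 1) * (2 ^ (r + 1) + 2) ≤ 2 ^ r * (2 ^ (r + 1) + 2) :=
    Nat.mul_le_mul_right _ ha
  calc _ = (a + 1) * (2 ^ (r + 1) + 2) := by ring
    _ ≤ _ := h
    _ = _ := by ring

theorem head_le (r : ℕ) (hr : 1 ≤ r) : 2 ^ (2 * r + 1) + 2 ^ (r + 1) < 2 ^ (2 * r + 2) := by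
  have : (2 : ℕ) ^ (r + 1) < 2 ^ (2 * r + 1) := Nat.pow_lt_pow_right (by norm_num) (by omega)
  rw [show 2 * r + 2 = (2 * r + 1) + 1 by ring, pow_succ 2 (2 * r + 1)]
  omega

theorem blockWord_period {k r : ℕ} (q i j : ℕ) (hq : q + 1 < 2 ^ (2 * r + 2)) :
    blockWord k (i * 2 ^ (2 * r + 3) + q) = blockWord k (j * 2 ^ (2 * r + 3) + q) := by
  apply blockWord_eq
  · rw [pow_succ, ← mul_assoc, ← mul_assoc]; omega
  · have h := fun i => paperfold_add_mul (2 * r + 2) (q + 1) i (by omega) hq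
    rw [show i * 2 ^ (2 * r + 3) + q + 1 = q + 1 + i * 2 ^ (2 * r + 2 + 1) by ring, h,
      show j * 2 ^ (2 * r + 3) + q + 1 = q + 1 + j * 2 ^ (2 * r + 2 + 1) by ring, h]

theorem blockProd_blockWord_eq {k r : ℕ} (hr : 1 ≤ r) (s n i j : ℕ)
    (hq : s + n ≤ 2 ^ (2 * r + 1) + 2 ^ (r + 1)) :
    blockProd (blockWord k) (i * 2 ^ (2 * r + 3) + s) n =
      blockProd (blockWord k) (j * 2 ^ (2 * r + 3) + s) n := by
  rw [blockProd_eq_iff (length_blockWord k)]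
  intro q hqn
  have := head_le r hr
  rw [add_assoc, add_assoc]
  exact blockWord_period _ _ _ (by omega)

theorem blockProd_blockWord_ne {k r : ℕ} (i j a b : ℕ) (ha : a < 2 ^ r) (hb : b < 2 ^ r)
    (hab : a ≠ b) :
    blockProd (blockWord k) (i * 2 ^ (2 * r + 3) + a * (2 ^ (r + 1) + 2)) (2 ^ r) ≠
      blockProd (blockWord k) (j * 2 ^ (2 * r + 3) + b * (2 ^ (r + 1) + 2)) (2 ^ r) := by
  have key : ∀ i a : ℕ, i * 2 ^ (2 * r + 3) + a * (2 ^ (r + 1) + 2) =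
      2 * a + 2 ^ (r + 1) * (i * 2 ^ (r + 2) + a) := by intro i a; ring
  have e1 : ∀ i a : ℕ, a < 2 ^ r →
      (i * 2 ^ (2 * r + 3) + a * (2 ^ (r + 1) + 2)) % 2 ^ (r + 1) = 2 * a := by
    intro i a ha
    rw [key, Nat.add_mul_mod_self_left, Nat.mod_eq_of_lt]
    rw [pow_succ]; omega
  have e2 : ∀ i a : ℕ, (i * 2 ^ (2 * r + 3) + a * (2 ^ (r + 1) + 2)) % 2 = 0 := by
    intro i a
    rw [key, pow_succ, mul_comm (2 ^ r) 2, mul_assoc]; omega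
  obtain ⟨q, h1, h2, h3⟩ := exists_paperfold_ne r _ _ ((e2 i a).trans (e2 j b).symm)
    (by rw [e1 i a ha, e1 j b hb]; omega)
  rw [Ne, blockProd_eq_iff (length_blockWord k)]
  intro H
  refine blockWord_ne ?_ (H (q - 1) (by omega))
  rwa [add_assoc _ (q - 1), add_assoc _ (q - 1), Nat.sub_add_cancel h1]

end Words

section Pairing

open MonoidAlgebra (supported single)

variable {F : Type} [Field F]

variable (F) in
/-- The free algebra on three letters. -/
abbrev FreeAlg : Type := MonoidAlgebra F Word

variable (F) in
/-- A word as an element of the free algebra. -/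
noncomputable abbrev mono (w : Word) : FreeAlg F := single w 1

theorem mono_mul (v w : Word) : mono F (v * w) = mono F v * mono F w := by simp

theorem mono_mem_supported {S : Set Word} {w : Word} (h : w ∈ S) :
    mono F w ∈ supported F F S := by
  rw [MonoidAlgebra.supported_eq_span_single]
  exact Submodule.subset_span ⟨w, h, rfl⟩

theorem supported_induction {S : Set Word} {p : FreeAlg F → Prop}
    (mono : ∀ w ∈ S, p (mono F w)) (zero : p 0) (add : ∀ x y, p x → p y → p (x + y))
    (smul : ∀ (c : F) x, p x → p (c • x)) {f : FreeAlg F} (hf : f ∈ supported F F S) : p f := by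
  rw [MonoidAlgebra.supported_eq_span_single] at hf
  induction hf using Submodule.span_induction with
  | mem x hx => obtain ⟨w, hw, rfl⟩ := hx; exact mono w hw
  | zero => exact zero
  | add x y _ _ hx hy => exact add x y hx hy
  | smul c x _ hx => exact smul c x hx

theorem mem_supported_univ (f : FreeAlg F) : f ∈ supported F F (Set.univ : Set Word) := by
  simp [MonoidAlgebra.mem_supported]

theorem mul_mem_supported {S T U : Set Word} (h : ∀ v ∈ S, ∀ w ∈ T, v * w ∈ U) {f g : FreeAlg F}
    (hf : f ∈ supported F F S) (hg : g ∈ supported F F T) : f * g ∈ supported F F U := by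
  refine supported_induction (p := fun f => f * g ∈ supported F F U) (fun v hv => ?_) ?_ ?_ ?_ hf
  · refine supported_induction (p := fun g => mono F v * g ∈ supported F F U)
      (fun w hw => ?_) ?_ ?_ ?_ hg
    · rw [← mono_mul]; exact mono_mem_supported (h v hv w hw)
    · simp
    · intro x y hx hy; rw [mul_add]; exact add_mem hx hy
    · intro c x hx; rw [mul_smul_comm]; exact Submodule.smul_mem _ c hx
  · simp
  · intro x y hx hy; rw [add_mul]; exact add_mem hx hy
  · intro c x hx; rw [smul_mul_assoc]; exact Submodule.smul_mem _ c hx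

variable (F) in
/-- Elements all of whose words have length `L`. -/
noncomputable abbrev homog (L : ℕ) : Submodule F (FreeAlg F) :=
  supported F F {w : Word | w.length = L}

theorem mul_mem_homog {L L' : ℕ} {f g : FreeAlg F} (hf : f ∈ homog F L) (hg : g ∈ homog F L') :
    f * g ∈ homog F (L + L') := by
  refine mul_mem_supported ?_ hf hg
  rintro v rfl w rfl
  exact FreeMonoid.length_mul v w

theorem one_mem_homog : (1 : FreeAlg F) ∈ homog F 0 :=
  mono_mem_supported (w := 1) FreeMonoid.length_one

theorem coeff_mul_of_homog {L : ℕ} {f g : FreeAlg F} (hf : f ∈ homog F L) {v w : Word}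
    (hv : v.length = L) : (f * g).coeff (v * w) = f.coeff v * g.coeff w := by
  refine supported_induction (p := fun f => (f * g).coeff (v * w) = f.coeff v * g.coeff w)
    (fun u hu => ?_) ?_ ?_ ?_ hf
  · by_cases huv : u = v
    · subst huv; simp
    · rw [MonoidAlgebra.coeff_single_mul_of_forall_mul_ne]
      · simp [huv]
      · intro d hd
        exact huv ((word_mul_inj (hu.trans hv.symm)).1 hd).1
  · simp
  · intro x y hx hy
    simp only [add_mul, MonoidAlgebra.coeff_add, Finsupp.add_apply, hx, hy]
  · intro c x hx
    simp only [smul_mul_assoc, MonoidAlgebra.coeff_smul_apply, hx, smul_eq_mul, mul_assoc]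

/-- The bilinear form on the free algebra for which the words are orthonormal. -/
noncomputable def pair : FreeAlg F →ₗ[F] FreeAlg F →ₗ[F] F :=
  (MonoidAlgebra.basis Word F).constr F fun w =>
    Finsupp.lapply w ∘ₗ (MonoidAlgebra.coeffLinearEquiv F).toLinearMap

theorem pair_mono (w : Word) (z : FreeAlg F) : pair (mono F w) z = z.coeff w := by
  have : mono F w = MonoidAlgebra.basis Word F w := by simp
  rw [this, pair, Module.Basis.constr_basis]
  rfl

theorem pair_mono_right (f : FreeAlg F) (w : Word) : pair f (mono F w) = f.coeff w := by
  refine supported_induction (p := fun f => pair f (mono F w) = f.coeff w)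
    (fun v _ => ?_) ?_ ?_ ?_ (mem_supported_univ f)
  · classical
    rw [pair_mono]
    simp only [MonoidAlgebra.coeff_single, Finsupp.single_apply, eq_comm]
  · simp
  · intro x y hx hy; simp only [map_add, LinearMap.add_apply, hx, hy]; rfl
  · intro c x hx; simp only [map_smul, LinearMap.smul_apply, hx]; rfl

theorem pair_eq_zero {S T : Set Word} (h : Disjoint S T) {f g : FreeAlg F}
    (hf : f ∈ supported F F S) (hg : g ∈ supported F F T) : pair f g = 0 := by
  refine supported_induction (p := fun f => pair f g = 0) (fun v hv => ?_) ?_ ?_ ?_ hf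
  · rw [pair_mono]
    exact MonoidAlgebra.mem_supported'.1 hg v (Set.disjoint_left.1 h hv)
  · simp
  · intro x y hx hy; simp [hx, hy]
  · intro c x hx; simp [hx]

theorem pair_mono_mul_mono (u v : Word) (f g : FreeAlg F) :
    pair (mono F u * f * mono F v) (mono F u * g * mono F v) = pair f g := by
  refine supported_induction (p := fun f => pair (mono F u * f * mono F v)
    (mono F u * g * mono F v) = pair f g) (fun w _ => ?_) ?_ ?_ ?_ (mem_supported_univ f)
  · rw [← mono_mul, ← mono_mul, pair_mono, pair_mono]
    simp
  · simp
  · intro x y hx hy; simp only [mul_add, add_mul, map_add, LinearMap.add_apply, hx, hy]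
  · intro c x hx
    simp only [mul_smul_comm, smul_mul_assoc, map_smul, LinearMap.smul_apply, hx]

theorem word_split (l : Word) {n : ℕ} (h : n ≤ l.length) :
    ∃ p q : Word, l = p * q ∧ p.length = n :=
  ⟨FreeMonoid.ofList (l.toList.take n), FreeMonoid.ofList (l.toList.drop n),
    (List.take_append_drop n l.toList).symm, by
      have : (l.toList.take n).length = n := List.length_take_of_le h
      exact this⟩

theorem pair_mul_mul_eq_zero {c g : FreeAlg F} (h : ∀ l r : FreeAlg F, pair (l * c * r) g = 0)
    (u v : Word) {l r : FreeAlg F} (hl : l ∈ supported F F {w : Word | u.length ≤ w.length})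
    (hr : r ∈ supported F F {w : Word | v.length ≤ w.length}) :
    pair (l * c * r) (mono F u * g * mono F v) = 0 := by
  refine supported_induction (p := fun l => pair (l * c * r) (mono F u * g * mono F v) = 0)
    (fun l hl => ?_) ?_ ?_ ?_ hl
  · refine supported_induction
      (p := fun r => pair (mono F l * c * r) (mono F u * g * mono F v) = 0)
      (fun r hr => ?_) ?_ ?_ ?_ hr
    · obtain ⟨p, q, rfl, hp⟩ := word_split l hl
      obtain ⟨p', q', rfl, hp'⟩ := word_split r
        (n := r.length - v.length) (Nat.sub_le _ _)
      have hq' : q'.length = v.length := by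
        have hr' : v.length ≤ (p' * q').length := hr
        rw [FreeMonoid.length_mul] at hr' hp'
        omega
      by_cases hpu : p = u
      · by_cases hqv : q' = v
        · subst hpu hqv
          have e : mono F (p * q) * c * mono F (p' * q') =
              mono F p * (mono F q * c * mono F p') * mono F q' := by
            simp only [mono_mul, mul_assoc]
          rw [e, pair_mono_mul_mono]
          exact h _ _
        · refine supported_induction (p := fun x => pair (x * mono F (p' * q'))
            (mono F u * g * mono F v) = 0) (fun x _ => ?_) ?_ ?_ ?_
            (mem_supported_univ (mono F (p * q) * c))
          · rw [← mono_mul, pair_mono, ← mul_assoc]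
            apply MonoidAlgebra.coeff_mul_single_of_forall_mul_ne
            intro d hd
            have hlen := congrArg FreeMonoid.length hd
            simp only [FreeMonoid.length_mul] at hlen
            refine hqv ((word_mul_inj ?_).1 hd).2.symm
            simp only [FreeMonoid.length_mul]
            omega
          · simp
          · intro x y hx hy; simp only [add_mul, map_add, LinearMap.add_apply, hx, hy, add_zero]
          · intro a x hx
            simp only [smul_mul_assoc, map_smul, LinearMap.smul_apply, hx, smul_zero]
      · rw [mul_assoc (mono F (p * q))]
        refine supported_induction (p := fun x => pair (mono F (p * q) * x)
          (mono F u * g * mono F v) = 0) (fun x _ => ?_) ?_ ?_ ?_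
          (mem_supported_univ (c * mono F (p' * q')))
        · rw [← mono_mul, pair_mono, mul_assoc, mul_assoc]
          apply MonoidAlgebra.coeff_single_mul_of_forall_mul_ne
          intro d hd
          exact hpu ((word_mul_inj hp.symm).1 hd).1.symm
        · simp
        · intro x y hx hy; simp only [mul_add, map_add, LinearMap.add_apply, hx, hy, add_zero]
        · intro a x hx
          simp only [mul_smul_comm, map_smul, LinearMap.smul_apply, hx, smul_zero]
    · simp
    · intro x y hx hy; simp only [mul_add, map_add, LinearMap.add_apply, hx, hy, add_zero]
    · intro a x hx
      simp only [mul_smul_comm, map_smul, LinearMap.smul_apply, hx, smul_zero]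
  · simp
  · intro x y hx hy; simp only [add_mul, map_add, LinearMap.add_apply, hx, hy, add_zero]
  · intro a x hx
    simp only [smul_mul_assoc, map_smul, LinearMap.smul_apply, hx, smul_zero]

end Pairing

section Automaton

open MonoidAlgebra (supported single)

variable {F : Type} [Field F]

/-- Words of length less than `d`. -/
abbrev ShortWord (d : ℕ) : Type := {w : Word // w.length < d}

theorem finite_shortWord (d : ℕ) : Finite (ShortWord d) :=
  (List.finite_length_lt (Fin 3) d).to_subtype

noncomputable instance (d : ℕ) : Fintype (ShortWord d) :=
  @Fintype.ofFinite _ (finite_shortWord d)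

variable (F) in
/-- Elements whose words are nonempty of length at most `d`. -/
noncomputable abbrev augBounded (d : ℕ) : Submodule F (FreeAlg F) :=
  supported F F {w : Word | 1 ≤ w.length ∧ w.length ≤ d}

theorem coeff_of_mul_mul {d : ℕ} {f : FreeAlg F} (hf : f ∈ augBounded F d) (g : FreeAlg F)
    (a : Fin 3) (w : Word) :
    (f * g).coeff (FreeMonoid.of a * w) =
      ∑ r : ShortWord d, f.coeff (FreeMonoid.of a * r.1) * (mono F r.1 * g).coeff w := by
  refine supported_induction (p := fun f => (f * g).coeff (FreeMonoid.of a * w) =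
      ∑ r : ShortWord d, f.coeff (FreeMonoid.of a * r.1) * (mono F r.1 * g).coeff w)
    (fun p hp => ?_) ?_ ?_ ?_ hf
  · obtain ⟨hp1, hpd⟩ := hp
    obtain ⟨b, p', rfl⟩ : ∃ (b : Fin 3) (p' : Word), p = FreeMonoid.of b * p' := by
      cases p using FreeMonoid.casesOn with
      | one => simp at hp1
      | of_mul b p' => exact ⟨b, p', rfl⟩
    have hp' : p'.length < d := by
      rw [FreeMonoid.length_mul, FreeMonoid.length_of] at hpd; omega
    by_cases hab : b = a
    · subst hab
      rw [Finset.sum_eq_single ⟨p', hp'⟩]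
      · rw [mono_mul, mul_assoc, MonoidAlgebra.coeff_single_mul_mul]
        simp
      · intro r _ hr
        have : p' ≠ r.1 := fun h => hr (Subtype.ext h.symm)
        simp [this]
      · simp
    · have hne : ∀ x y : Word, FreeMonoid.of b * x ≠ FreeMonoid.of a * y := by
        intro x y h
        exact hab (FreeMonoid.of_injective ((word_mul_inj (by simp)).1 h).1)
      rw [mono_mul, mul_assoc, MonoidAlgebra.coeff_single_mul_of_forall_mul_ne _ _ (hne · w)]
      · symm
        apply Finset.sum_eq_zero
        intro r _
        rw [← mono_mul, MonoidAlgebra.coeff_single, Finsupp.single_eq_of_ne (hne _ _).symm,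
          zero_mul]
  · simp
  · intro x y hx hy
    simp only [add_mul, MonoidAlgebra.coeff_add, Finsupp.add_apply, hx, hy, Finset.sum_add_distrib]
  · intro c x hx
    simp only [smul_mul_assoc, MonoidAlgebra.coeff_smul_apply, hx, smul_eq_mul, Finset.mul_sum,
      mul_assoc]

/-- The transition matrices of an automaton recognising the powers of `f`. -/
noncomputable def letterMatrix (f : FreeAlg F) (d : ℕ) (a : Fin 3) :
    Matrix (ShortWord d) (ShortWord d) (Polynomial F) :=
  Matrix.of fun r r' => (if r.1 = FreeMonoid.of a * r'.1 then 1 else 0) +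
    (if r.1 = 1 then Polynomial.X * Polynomial.C (f.coeff (FreeMonoid.of a * r'.1)) else 0)

/-- The matrix representation of the free algebra defined by the automaton of `f`. -/
noncomputable def powerRep (f : FreeAlg F) (d : ℕ) :
    FreeAlg F →ₐ[F] Matrix (ShortWord d) (ShortWord d) (Polynomial F) :=
  MonoidAlgebra.lift F _ Word (FreeMonoid.lift (letterMatrix f d))

theorem powerRep_mono_of (f : FreeAlg F) (d : ℕ) (a : Fin 3) :
    powerRep f d (mono F (FreeMonoid.of a)) = letterMatrix f d a := by
  rw [powerRep, MonoidAlgebra.lift_single, one_smul, FreeMonoid.lift_eval_of]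

theorem coeff_powerRep_mono {d : ℕ} (hd : 0 < d) {f : FreeAlg F} (hf : f ∈ augBounded F d)
    (w : Word) : ∀ (N : ℕ) (r : ShortWord d),
      (powerRep f d (mono F w) r ⟨1, hd⟩).coeff N = (mono F r.1 * f ^ N).coeff w := by
  induction w using FreeMonoid.inductionOn' with
  | one =>
    intro N r
    have h1 : mono F (1 : Word) = 1 := rfl
    rw [h1, map_one, Matrix.one_apply]
    have hf1 : f.coeff 1 = 0 := MonoidAlgebra.mem_supported'.1 hf 1 (by simp)
    by_cases hr : r.1 = 1
    · have : r = ⟨1, hd⟩ := Subtype.ext hr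
      rw [if_pos this, hr, h1, one_mul]
      cases N with
      | zero => rw [pow_zero, MonoidAlgebra.coeff_one_one]; simp
      | succ N =>
        rw [pow_succ']
        have : (f * f ^ N).coeff 1 = 0 := by
          refine MonoidAlgebra.mem_supported'.1 (mul_mem_supported (U := {w : Word | 1 ≤ w.length})
            ?_ hf (mem_supported_univ _)) 1 (by simp)
          rintro v ⟨hv, _⟩ w _
          simp only [Set.mem_ofPred_eq, FreeMonoid.length_mul]; omega
        rw [this]; simp [Polynomial.coeff_one]
    · have : r ≠ ⟨1, hd⟩ := fun h => hr (congrArg Subtype.val h)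
      rw [if_neg this, MonoidAlgebra.coeff_single_mul_of_forall_mul_ne]
      · simp
      · intro x hx
        apply hr
        have := congrArg FreeMonoid.length hx
        simp only [FreeMonoid.length_mul, FreeMonoid.length_one] at this
        exact FreeMonoid.length_eq_zero.1 (by omega)
  | of_mul a w ih =>
    intro N r
    rw [mono_mul, map_mul, powerRep_mono_of, Matrix.mul_apply, Polynomial.finsetSum_coeff]
    by_cases hr : r.1 = 1
    · have hne : ∀ x : Word, (1 : Word) ≠ FreeMonoid.of a * x := by
        intro x h
        have := congrArg FreeMonoid.length h
        simp only [FreeMonoid.length_mul, FreeMonoid.length_one, FreeMonoid.length_of] at this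
        omega
      simp only [letterMatrix, Matrix.of_apply, hr, if_neg (hne _), zero_add, if_true]
      have h1 : mono F (1 : Word) = 1 := rfl
      rw [h1, one_mul]
      cases N with
      | zero =>
        rw [pow_zero, MonoidAlgebra.one_def, MonoidAlgebra.coeff_single,
          Finsupp.single_eq_of_ne (hne w).symm]
        apply Finset.sum_eq_zero
        intro x _
        rw [mul_assoc, Polynomial.coeff_X_mul_zero]
      | succ N =>
        rw [pow_succ', coeff_of_mul_mul hf]
        refine Finset.sum_congr rfl fun x _ => ?_
        rw [mul_assoc, Polynomial.coeff_X_mul, Polynomial.coeff_C_mul, ih]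
    · simp only [letterMatrix, Matrix.of_apply, if_neg hr, add_zero]
      by_cases hs : ∃ s : Word, r.1 = FreeMonoid.of a * s
      · obtain ⟨s, hs⟩ := hs
        have hsd : s.length < d := by
          have := r.2
          rw [hs, FreeMonoid.length_mul] at this
          omega
        rw [Finset.sum_eq_single ⟨s, hsd⟩]
        · rw [if_pos hs, one_mul, ih, hs, mono_mul, mul_assoc, MonoidAlgebra.coeff_single_mul_mul,
            one_mul]
        · intro x _ hx
          rw [if_neg, zero_mul, Polynomial.coeff_zero]
          intro h
          exact hx (Subtype.ext (mul_left_cancel (h.symm.trans hs)))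
        · simp
      · obtain ⟨b, s, hb⟩ : ∃ (b : Fin 3) (s : Word), r.1 = FreeMonoid.of b * s := by
          generalize r.1 = q at hr
          cases q using FreeMonoid.casesOn with
          | one => simp at hr
          | of_mul b p' => exact ⟨b, p', rfl⟩
        have hba : b ≠ a := fun h => hs ⟨s, h ▸ hb⟩
        rw [MonoidAlgebra.coeff_single_mul_of_forall_mul_ne]
        · apply Finset.sum_eq_zero
          intro x _
          rw [if_neg (fun h => hs ⟨x.1, h⟩), zero_mul, Polynomial.coeff_zero]
        · intro x hx
          rw [hb, mul_assoc] at hx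
          exact hba (FreeMonoid.of_injective ((word_mul_inj (by simp)).1 hx).1)

theorem pair_pow_eq_coeff {d : ℕ} (hd : 0 < d) {f : FreeAlg F} (hf : f ∈ augBounded F d)
    (N : ℕ) (z : FreeAlg F) :
    pair z (f ^ N) = (powerRep f d z ⟨1, hd⟩ ⟨1, hd⟩).coeff N := by
  refine supported_induction (p := fun z =>
    pair z (f ^ N) = (powerRep f d z ⟨1, hd⟩ ⟨1, hd⟩).coeff N) (fun w _ => ?_) ?_ ?_ ?_
    (mem_supported_univ z)
  · have h1 : mono F (1 : Word) = 1 := rfl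
    rw [pair_mono, coeff_powerRep_mono hd hf, h1, one_mul]
  · simp
  · intro x y hx hy; simp [hx, hy]
  · intro c x hx
    rw [map_smul, map_smul, LinearMap.smul_apply, hx, Matrix.smul_apply, Polynomial.coeff_smul]

theorem sum_sign_smul_prod_eq_zero {K : Type*} [CommRing K] [Nontrivial K] {ι : Type*} [Fintype ι]
    [DecidableEq ι] {c : ℕ} (hc : Fintype.card ι ^ 2 < c) (p q : Fin c → Matrix ι ι K) :
    ∑ σ : Equiv.Perm (Fin c),
      Equiv.Perm.sign σ • (List.ofFn fun a => p (σ a) * q a).prod = 0 := by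
  have key : MultilinearMap.alternatization ((MultilinearMap.mkPiAlgebraFin K c
      (Matrix ι ι K)).compLinearMap fun a => LinearMap.mulRight K (q a)) = 0 := by
    refine Module.Basis.ext_alternating (Matrix.stdBasis K ι ι) fun v hv => ?_
    have := Fintype.card_le_of_injective v hv
    rw [Fintype.card_fin, Fintype.card_prod, ← sq] at this
    omega
  have h := congrArg (fun g => g p) key
  simpa [MultilinearMap.alternatization_apply] using h

end Automaton

section Tower

open MonoidAlgebra (supported single)

variable {F : Type} [Field F]

theorem blockProd_mem_homog {Θ : ℕ → FreeAlg F} {L : ℕ} (hΘ : ∀ j, Θ j ∈ homog F L) (i n : ℕ) :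
    blockProd Θ i n ∈ homog F (n * L) := by
  induction n with
  | zero => rw [zero_mul]; exact one_mem_homog
  | succ n ih => rw [add_mul, one_mul]; exact mul_mem_homog ih (hΘ _)

theorem ofFn_prod_mem_homog {L c : ℕ} {f : Fin c → FreeAlg F} (hf : ∀ a, f a ∈ homog F L) :
    (List.ofFn f).prod ∈ homog F (c * L) := by
  induction c with
  | zero => rw [zero_mul]; exact one_mem_homog
  | succ c ih =>
    rw [add_mul, one_mul, add_comm, List.ofFn_succ, List.prod_cons]
    exact mul_mem_homog (hf _) (ih fun a => hf _)

theorem coeff_blockProd {Θ : ℕ → FreeAlg F} {G : ℕ → Word} {L : ℕ}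
    (hΘ : ∀ j, Θ j ∈ homog F L) (hG : ∀ i, (G i).length = L)
    (h : ∀ i j, (Θ j).coeff (G i) = if G i = G j then 1 else 0) (i j n : ℕ) :
    (blockProd Θ j n).coeff (blockProd G i n) =
      if blockProd G i n = blockProd G j n then 1 else 0 := by
  induction n with
  | zero =>
    rw [if_pos (show blockProd G i 0 = blockProd G j 0 from rfl)]
    exact MonoidAlgebra.coeff_one_one
  | succ n ih =>
    have hl : (blockProd G i n).length = (blockProd G j n).length := by
      simp only [length_blockProd hG]
    rw [blockProd, blockProd, blockProd, coeff_mul_of_homog (blockProd_mem_homog hΘ j n)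
      (length_blockProd hG i n), ih, h]
    simp only [word_mul_inj hl, ite_and]
    split_ifs <;> simp

theorem coeff_ofFn_prod {L c : ℕ} {f : Fin c → FreeAlg F} {v : Fin c → Word}
    (hf : ∀ a, f a ∈ homog F L) (hv : ∀ a, (v a).length = L) :
    (List.ofFn f).prod.coeff (List.ofFn v).prod = ∏ a, (f a).coeff (v a) := by
  induction c with
  | zero => exact MonoidAlgebra.coeff_one_one
  | succ c ih =>
    rw [List.ofFn_succ, List.prod_cons, List.ofFn_succ, List.prod_cons,
      coeff_mul_of_homog (hf 0) (hv 0), ih (fun a => hf _) (fun a => hv _), Fin.prod_univ_succ]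

/-- An alternating sum of products of `Θ` along a block, dual to the blocks `blockWord`. -/
noncomputable def capelli (Θ : ℕ → FreeAlg F) (r j : ℕ) : FreeAlg F :=
  (∑ σ : Equiv.Perm (Fin (2 ^ r)), Equiv.Perm.sign σ • (List.ofFn fun a : Fin (2 ^ r) =>
    blockProd Θ (j * 2 ^ (2 * r + 3) + (σ a : ℕ) * (2 ^ (r + 1) + 2)) (2 ^ r) *
    blockProd Θ (j * 2 ^ (2 * r + 3) + (a * (2 ^ (r + 1) + 2) + 2 ^ r)) (2 ^ r + 2)).prod) *
  blockProd Θ (j * 2 ^ (2 * r + 3) + 2 ^ r * (2 ^ (r + 1) + 2))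
    (2 ^ (2 * r + 3) - 2 ^ r * (2 ^ (r + 1) + 2))

theorem mul_le_block (r : ℕ) : 2 ^ r * (2 ^ (r + 1) + 2) ≤ 2 ^ (2 * r + 3) := by
  have h1 : (2 : ℕ) ^ (r + 1) ≤ 2 ^ (2 * r + 1) := Nat.pow_le_pow_right (by norm_num) (by omega)
  have h2 : 2 ^ r * (2 ^ (r + 1) + 2) = 2 ^ (2 * r + 1) + 2 ^ (r + 1) := by ring
  have h3 : (2 : ℕ) ^ (2 * r + 3) = 4 * 2 ^ (2 * r + 1) := by ring
  omega

theorem blockProd_split {M : Type*} [Monoid M] (f : ℕ → M) (r j : ℕ) :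
    blockProd f j (2 ^ (2 * r + 3)) =
      (List.ofFn fun a : Fin (2 ^ r) => blockProd f (j + a * (2 ^ (r + 1) + 2)) (2 ^ r) *
        blockProd f (j + (a * (2 ^ (r + 1) + 2) + 2 ^ r)) (2 ^ r + 2)).prod *
      blockProd f (j + 2 ^ r * (2 ^ (r + 1) + 2))
        (2 ^ (2 * r + 3) - 2 ^ r * (2 ^ (r + 1) + 2)) := by
  conv_lhs => rw [← Nat.add_sub_cancel' (mul_le_block r), blockProd_add, blockProd_mul]
  congr 3
  funext a
  conv_lhs => rw [show 2 ^ (r + 1) + 2 = 2 ^ r + (2 ^ r + 2) by ring]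
  rw [blockProd_add, show 2 ^ r + (2 ^ r + 2) = 2 ^ (r + 1) + 2 by ring, add_assoc]

theorem capelli_mem_homog {Θ : ℕ → FreeAlg F} {k : ℕ} (hΘ : ∀ j, Θ j ∈ homog F (3 * 2 ^ k))
    (r j : ℕ) : capelli Θ r j ∈ homog F (3 * 2 ^ (k + (2 * r + 3))) := by
  have e : 3 * 2 ^ (k + (2 * r + 3)) = 2 ^ r * (2 ^ r * (3 * 2 ^ k) + (2 ^ r + 2) * (3 * 2 ^ k)) +
      (2 ^ (2 * r + 3) - 2 ^ r * (2 ^ (r + 1) + 2)) * (3 * 2 ^ k) := by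
    obtain ⟨n, hn⟩ := Nat.exists_eq_add_of_le (mul_le_block r)
    rw [pow_add, hn, Nat.add_sub_cancel_left]
    ring
  rw [e, capelli]
  refine mul_mem_homog (Submodule.sum_mem _ fun σ _ => ?_) (blockProd_mem_homog hΘ _ _)
  rw [Units.smul_def]
  exact zsmul_mem (ofFn_prod_mem_homog fun a =>
    mul_mem_homog (blockProd_mem_homog hΘ _ _) (blockProd_mem_homog hΘ _ _)) _

theorem coeff_capelli {Θ : ℕ → FreeAlg F} {k r : ℕ} (hr : 1 ≤ r)
    (hΘ : ∀ j, Θ j ∈ homog F (3 * 2 ^ k))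
    (h : ∀ i j, (Θ j).coeff (blockWord k i) = if blockWord k i = blockWord k j then 1 else 0)
    (i j : ℕ) : (capelli Θ r j).coeff (blockWord (k + (2 * r + 3)) i) =
      if blockWord (k + (2 * r + 3)) i = blockWord (k + (2 * r + 3)) j then 1 else 0 := by
  have hG := length_blockWord k
  have hc := coeff_blockProd hΘ hG h
  have hB : ∀ i n, (blockProd (blockWord k) i n).length = n * (3 * 2 ^ k) := length_blockProd hG
  have hle : ∀ a : Fin (2 ^ r), (a : ℕ) * (2 ^ (r + 1) + 2) + 2 ^ r + (2 ^ r + 2) ≤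
      2 ^ (2 * r + 1) + 2 ^ (r + 1) := by
    intro a
    have h1 := mul_add_two_le r a a.2
    have h2 : (2 : ℕ) ^ (r + 1) = 2 ^ r + 2 ^ r := by ring
    omega
  have hw1 : ∀ a : Fin (2 ^ r),
      blockProd (blockWord k) (i * 2 ^ (2 * r + 3) + a * (2 ^ (r + 1) + 2)) (2 ^ r) =
      blockProd (blockWord k) (j * 2 ^ (2 * r + 3) + a * (2 ^ (r + 1) + 2)) (2 ^ r) := fun a =>
    blockProd_blockWord_eq hr _ _ _ _ ((Nat.le_add_right _ _).trans (hle a))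
  have hw2 : ∀ a : Fin (2 ^ r), blockProd (blockWord k)
        (i * 2 ^ (2 * r + 3) + (a * (2 ^ (r + 1) + 2) + 2 ^ r)) (2 ^ r + 2) =
      blockProd (blockWord k)
        (j * 2 ^ (2 * r + 3) + (a * (2 ^ (r + 1) + 2) + 2 ^ r)) (2 ^ r + 2) := fun a =>
    blockProd_blockWord_eq hr _ _ _ _ (hle a)
  rw [blockWord_add, blockWord_add, blockProd_split (blockWord k) r (i * _),
    blockProd_split (blockWord k) r (j * _)]
  simp only [hw1, hw2, mul_right_inj]
  rw [capelli, coeff_mul_of_homog (L := 2 ^ r * (2 ^ r * (3 * 2 ^ k) + (2 ^ r + 2) * (3 * 2 ^ k)))]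
  rotate_left
  · refine Submodule.sum_mem _ fun σ _ => ?_
    rw [Units.smul_def]
    exact zsmul_mem (ofFn_prod_mem_homog fun a =>
      mul_mem_homog (blockProd_mem_homog hΘ _ _) (blockProd_mem_homog hΘ _ _)) _
  · have hlen : ∀ {c L : ℕ} (v : Fin c → Word), (∀ a, (v a).length = L) →
        (List.ofFn v).prod.length = c * L := by
      intro c L v hv
      induction c with
      | zero => simp
      | succ c ih =>
        rw [List.ofFn_succ, List.prod_cons, FreeMonoid.length_mul, hv, ih _ fun a => hv _]
        ring
    exact hlen _ fun a => by rw [FreeMonoid.length_mul, hB, hB]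
  rw [hc, ← pair_mono, map_sum, Finset.sum_eq_single 1]
  · rw [Equiv.Perm.sign_one, one_smul, pair_mono, coeff_ofFn_prod
      (L := 2 ^ r * (3 * 2 ^ k) + (2 ^ r + 2) * (3 * 2 ^ k))]
    · rw [Finset.prod_eq_one, one_mul]
      intro a _
      rw [coeff_mul_of_homog (blockProd_mem_homog hΘ _ _) (hB _ _), hc, hc, Equiv.Perm.one_apply,
        if_pos rfl, if_pos rfl, one_mul]
    · exact fun a => mul_mem_homog (blockProd_mem_homog hΘ _ _) (blockProd_mem_homog hΘ _ _)
    · exact fun a => by rw [FreeMonoid.length_mul, hB, hB]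
  · intro σ _ hσ
    obtain ⟨a, ha⟩ : ∃ a, σ a ≠ a := by
      by_contra! H
      exact hσ (Equiv.ext H)
    rw [Units.smul_def, map_zsmul, pair_mono, coeff_ofFn_prod
      (L := 2 ^ r * (3 * 2 ^ k) + (2 ^ r + 2) * (3 * 2 ^ k)), Finset.prod_eq_zero
      (Finset.mem_univ a), smul_zero]
    · rw [coeff_mul_of_homog (blockProd_mem_homog hΘ _ _) (hB _ _), hc, if_neg, zero_mul]
      exact blockProd_blockWord_ne _ _ _ _ a.2 (σ a).2 fun h => ha (Fin.ext h.symm)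
    · exact fun a => mul_mem_homog (blockProd_mem_homog hΘ _ _) (blockProd_mem_homog hΘ _ _)
    · exact fun a => by rw [FreeMonoid.length_mul, hB, hB]
  · simp

theorem map_capelli_eq_zero {K : Type*} [CommRing K] [Nontrivial K] [Algebra F K] {ι : Type*}
    [Fintype ι] [DecidableEq ι] (ρ : FreeAlg F →ₐ[F] Matrix ι ι K) (Θ : ℕ → FreeAlg F) {r : ℕ}
    (hr : Fintype.card ι ^ 2 < 2 ^ r) (j : ℕ) : ρ (capelli Θ r j) = 0 := by
  have h := sum_sign_smul_prod_eq_zero hr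
    (fun a => ρ (blockProd Θ (j * 2 ^ (2 * r + 3) + (a : ℕ) * (2 ^ (r + 1) + 2)) (2 ^ r)))
    (fun a => ρ (blockProd Θ (j * 2 ^ (2 * r + 3) + ((a : ℕ) * (2 ^ (r + 1) + 2) + 2 ^ r))
      (2 ^ r + 2)))
  rw [capelli, map_mul, map_sum]
  convert zero_mul _
  rw [← h]
  refine Finset.sum_congr rfl fun σ _ => ?_
  rw [Units.smul_def, Units.smul_def, map_zsmul, map_list_prod, List.map_ofFn]
  simp only [Function.comp_def, map_mul]

theorem blockProd_mem_pow {Θ : ℕ → FreeAlg F} {P : Submodule F (FreeAlg F)} (hΘ : ∀ j, Θ j ∈ P)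
    (i n : ℕ) : blockProd Θ i n ∈ P ^ n := by
  induction n with
  | zero => rw [pow_zero]; exact Submodule.one_le.1 le_rfl
  | succ n ih => rw [pow_succ]; exact Submodule.mul_mem_mul ih (hΘ _)

theorem ofFn_prod_mem_pow {P : Submodule F (FreeAlg F)} {c : ℕ} {f : Fin c → FreeAlg F}
    (hf : ∀ a, f a ∈ P) : (List.ofFn f).prod ∈ P ^ c := by
  induction c with
  | zero => rw [pow_zero]; exact Submodule.one_le.1 le_rfl
  | succ c ih =>
    rw [pow_succ', List.ofFn_succ, List.prod_cons]
    exact Submodule.mul_mem_mul (hf _) (ih fun a => hf _)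

theorem capelli_mem_pow {Θ : ℕ → FreeAlg F} {P : Submodule F (FreeAlg F)} (hΘ : ∀ j, Θ j ∈ P)
    (r j : ℕ) : capelli Θ r j ∈ P ^ 2 ^ (2 * r + 3) := by
  have e : 2 ^ (2 * r + 3) = (2 ^ r + (2 ^ r + 2)) * 2 ^ r +
      (2 ^ (2 * r + 3) - 2 ^ r * (2 ^ (r + 1) + 2)) := by
    rw [show (2 ^ r + (2 ^ r + 2)) * 2 ^ r = 2 ^ r * (2 ^ (r + 1) + 2) by ring]
    exact (Nat.add_sub_cancel' (mul_le_block r)).symm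
  rw [e, pow_add, pow_mul, capelli]
  refine Submodule.mul_mem_mul (Submodule.sum_mem _ fun σ _ => ?_) (blockProd_mem_pow hΘ _ _)
  rw [Units.smul_def]
  refine zsmul_mem (ofFn_prod_mem_pow fun a => ?_) _
  rw [pow_add]
  exact Submodule.mul_mem_mul (blockProd_mem_pow hΘ _ _) (blockProd_mem_pow hΘ _ _)

/-- The size parameter of the `t`-th step of the construction. -/
noncomputable def stepSize (t : ℕ) : ℕ := Fintype.card (ShortWord t) ^ 2 + 1

/-- The level of the blocks after `t` steps. -/
noncomputable def level : ℕ → ℕ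
  | 0 => 0
  | t + 1 => level t + (2 * stepSize t + 3)

variable (F) in
/-- The dual elements after `t` steps. -/
noncomputable def tower : ℕ → ℕ → FreeAlg F
  | 0 => fun j => mono F (blockWord 0 j)
  | t + 1 => capelli (tower t) (stepSize t)

theorem le_level (t : ℕ) : t ≤ level t := by
  induction t with
  | zero => exact le_rfl
  | succ t ih => rw [level]; omega

theorem level_mono : Monotone level :=
  monotone_nat_of_le_succ fun t => by rw [level]; omega

theorem tower_mem_homog (t j : ℕ) : tower F t j ∈ homog F (3 * 2 ^ level t) := by
  induction t generalizing j with
  | zero => exact mono_mem_supported (length_blockWord 0 j)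
  | succ t ih => exact capelli_mem_homog ih _ _

theorem coeff_tower (t : ℕ) : ∀ i j : ℕ, (tower F t j).coeff (blockWord (level t) i) =
    if blockWord (level t) i = blockWord (level t) j then 1 else 0 := by
  induction t with
  | zero =>
    intro i j
    simp only [tower, level, MonoidAlgebra.coeff_single, Finsupp.single_apply, eq_comm]
    congr
  | succ t ih => exact coeff_capelli (by unfold stepSize; omega) (tower_mem_homog t) ih

variable (F) in
/-- The span of the dual elements after `t` steps. -/
noncomputable def towerSpan (t : ℕ) : Submodule F (FreeAlg F) :=
  Submodule.span F (Set.range (tower F t))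

theorem tower_mem_towerSpan (t j : ℕ) : tower F t j ∈ towerSpan F t :=
  Submodule.subset_span ⟨j, rfl⟩

theorem exists_towerSpan_le_pow (t e : ℕ) : ∃ n, towerSpan F (t + e) ≤ towerSpan F t ^ n := by
  induction e with
  | zero => exact ⟨1, by rw [pow_one, add_zero]⟩
  | succ e ih =>
    obtain ⟨n, hn⟩ := ih
    refine ⟨n * 2 ^ (2 * stepSize (t + e) + 3), ?_⟩
    rw [towerSpan, Submodule.span_le]
    rintro _ ⟨j, rfl⟩
    rw [pow_mul]
    exact pow_le_pow_left' hn _ (capelli_mem_pow (tower_mem_towerSpan _) _ j)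

theorem towerSpan_le_homog (t : ℕ) : towerSpan F t ≤ homog F (3 * 2 ^ level t) := by
  rw [towerSpan, Submodule.span_le]
  rintro _ ⟨j, rfl⟩
  exact tower_mem_homog t j

theorem pow_le_homog {P : Submodule F (FreeAlg F)} {L : ℕ} (hP : P ≤ homog F L) (n : ℕ) :
    P ^ n ≤ homog F (n * L) := by
  induction n with
  | zero =>
    rw [pow_zero, zero_mul]
    exact Submodule.one_le.2 one_mem_homog
  | succ n ih =>
    rw [pow_succ, add_mul, one_mul]
    exact Submodule.mul_le.2 fun x hx y hy => mul_mem_homog (ih hx) (hP hy)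

theorem powerRep_towerSpan (f : FreeAlg F) (d : ℕ) {z : FreeAlg F}
    (hz : z ∈ towerSpan F (d + 1)) : powerRep f d z = 0 := by
  have h : towerSpan F (d + 1) ≤ LinearMap.ker (powerRep f d).toLinearMap := by
    rw [towerSpan, Submodule.span_le]
    rintro _ ⟨j, rfl⟩
    refine map_capelli_eq_zero (powerRep f d) (tower F d) ?_ j
    exact Nat.lt_two_pow_self.trans (Nat.pow_lt_pow_right (by norm_num) (Nat.lt_succ_self _))
  exact h hz

theorem pow_mem_supported_length {d : ℕ} {f : FreeAlg F} (hf : f ∈ augBounded F d) (N : ℕ) :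
    f ^ N ∈ supported F F {w : Word | N ≤ w.length} := by
  induction N with
  | zero => exact mono_mem_supported (w := 1) (Nat.zero_le _)
  | succ N ih =>
    rw [pow_succ]
    refine mul_mem_supported ?_ ih hf
    rintro v hv w ⟨hw, _⟩
    rw [Set.mem_ofPred_eq] at hv ⊢
    rw [FreeMonoid.length_mul]
    omega

theorem pair_tower_pow_eq_zero {d : ℕ} (hd : 0 < d) {f : FreeAlg F} (hf : f ∈ augBounded F d)
    (T : ℕ) (u v : Word) : pair (tower F T 2)
      (mono F u * f ^ (2 * (3 * 2 ^ level (d + 1))) * mono F v) = 0 := by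
  set L := 3 * 2 ^ level (d + 1) with hL
  have hL0 : 0 < L := by positivity
  have hz : mono F u * f ^ (2 * L) * mono F v ∈
      supported F F {w : Word | u.length + 2 * L + v.length ≤ w.length} := by
    refine mul_mem_supported (S := {w : Word | u.length + 2 * L ≤ w.length})
      (T := {w : Word | v.length ≤ w.length}) ?_ (mul_mem_supported ?_
        (mono_mem_supported (S := {w : Word | u.length ≤ w.length}) (Nat.le_refl u.length))
        (pow_mem_supported_length hf _)) (mono_mem_supported (Nat.le_refl v.length))
    all_goals
      intro p hp q hq
      simp only [Set.mem_ofPred_eq, FreeMonoid.length_mul] at *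
      omega
  have hlong : ∀ {M : ℕ} {z : FreeAlg F}, z ∈ homog F M → M < u.length + 2 * L + v.length →
      pair z (mono F u * f ^ (2 * L) * mono F v) = 0 := by
    intro M z hzM hM
    refine pair_eq_zero (Set.disjoint_left.2 ?_) hzM hz
    intro w hw hw'
    simp only [Set.mem_ofPred_eq] at hw hw'
    omega
  rcases Nat.lt_or_ge T (d + 1) with hT | hT
  · refine hlong (tower_mem_homog T 2) ?_
    have : 2 ^ level T ≤ 2 ^ level (d + 1) :=
      Nat.pow_le_pow_right (by norm_num) (level_mono hT.le)
    omega
  · obtain ⟨e, rfl⟩ := Nat.exists_eq_add_of_le hT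
    obtain ⟨n, hn⟩ := exists_towerSpan_le_pow (F := F) (d + 1) e
    have hP := pow_le_homog (towerSpan_le_homog (F := F) (d + 1))
    have hmem := hn (tower_mem_towerSpan (d + 1 + e) 2)
    rcases Nat.lt_or_ge (n * L) (u.length + 2 * L + v.length) with hlt | hge
    · exact hlong (hP n hmem) hlt
    · set b := (u.length + L - 1) / L with hb
      have hb1 : u.length ≤ b * L := by
        have := Nat.lt_div_mul_add (a := u.length + L - 1) hL0
        rw [← hb] at this
        omega
      have hb2 : b * L ≤ u.length + L - 1 := Nat.div_mul_le_self _ _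
      have hbn : b + 1 ≤ n := by
        by_contra! h
        have : n * L ≤ b * L := Nat.mul_le_mul_right _ (by omega)
        omega
      obtain ⟨b', rfl⟩ := Nat.exists_eq_add_of_le hbn
      have hb' : v.length ≤ b' * L := by
        have : (b + 1 + b') * L = b * L + L + b' * L := by ring
        omega
      rw [pow_add, pow_succ] at hmem
      refine Submodule.mul_induction_on hmem (fun x hx r hr => ?_) (fun x y hx hy => ?_)
      · refine Submodule.mul_induction_on hx (fun l hl c hc => ?_) (fun x y hx hy => ?_)
        · refine pair_mul_mul_eq_zero (fun l' r' => ?_) u v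
            (MonoidAlgebra.supported_mono ?_ (hP b hl)) (MonoidAlgebra.supported_mono ?_ (hP b' hr))
          · rw [pair_pow_eq_coeff hd hf, map_mul, map_mul, powerRep_towerSpan f d hc]
            simp
          · exact fun w (hw : w.length = b * L) => hb1.trans hw.ge
          · exact fun w (hw : w.length = b' * L) => hb'.trans hw.ge
        · rw [add_mul, map_add, LinearMap.add_apply, hx, hy, add_zero]
      · rw [map_add, LinearMap.add_apply, hx, hy, add_zero]

end Tower

section Quotient

open MonoidAlgebra (supported single)

variable {F : Type} [Field F]

variable (F) in
/-- The two-sided ideal of elements all of whose multiples are orthogonal to the tower. -/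
noncomputable def towerIdeal : Ideal (FreeAlg F) where
  carrier := {a | ∀ (T : ℕ) (u v : FreeAlg F), pair (tower F T 2) (u * a * v) = 0}
  add_mem' := by
    intro a b ha hb T u v
    rw [mul_add, add_mul, map_add, ha, hb, add_zero]
  zero_mem' := by
    intro T u v
    rw [mul_zero, zero_mul, map_zero]
  smul_mem' := by
    intro c a ha T u v
    rw [smul_eq_mul, ← mul_assoc]
    exact ha T _ _

instance : (towerIdeal F).IsTwoSided where
  mul_mem_of_left := by
    intro a b ha T u v
    rw [← mul_assoc, mul_assoc _ b]
    exact ha T _ _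

theorem mem_towerIdeal_of_words {a : FreeAlg F}
    (h : ∀ (T : ℕ) (u v : Word), pair (tower F T 2) (mono F u * a * mono F v) = 0) :
    a ∈ towerIdeal F := by
  intro T u v
  refine supported_induction (p := fun u => pair (tower F T 2) (u * a * v) = 0)
    (fun u _ => ?_) ?_ ?_ ?_ (mem_supported_univ u)
  · refine supported_induction (p := fun v => pair (tower F T 2) (mono F u * a * v) = 0)
      (fun v _ => h T u v) ?_ ?_ ?_ (mem_supported_univ v)
    · simp
    · intro x y hx hy; rw [mul_add, map_add, hx, hy, add_zero]
    · intro c x hx; rw [mul_smul_comm, map_smul, hx, smul_zero]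
  · simp
  · intro x y hx hy; rw [add_mul, add_mul, map_add, hx, hy, add_zero]
  · intro c x hx; rw [smul_mul_assoc, smul_mul_assoc, map_smul, hx, smul_zero]

/-- Words without equal adjacent letters which may only begin with
the letter `0` and may not end with it. -/
def alternating : Set Word :=
  {w | w.toList.IsChain (· ≠ ·) ∧ (∀ a ∈ w.toList.head?, a = 0) ∧ ∀ a ∈ w.toList.getLast?, a ≠ 0}

theorem mul_mem_alternating {v w : Word} (hv : v ∈ alternating) (hw : w ∈ alternating) :
    v * w ∈ alternating := by
  obtain ⟨h1, h2, h3⟩ := hv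
  obtain ⟨h1', h2', h3'⟩ := hw
  refine ⟨?_, ?_, ?_⟩
  · rw [FreeMonoid.toList_mul, List.isChain_append]
    exact ⟨h1, h1', fun a ha b hb => by rw [h2' b hb]; exact h3 a ha⟩
  · intro a ha
    rw [FreeMonoid.toList_mul, List.head?_append] at ha
    rcases hh : v.toList.head? with _ | b
    · rw [hh] at ha; exact h2' a (by simpa using ha)
    · rw [hh] at ha; exact h2 a (by simpa [hh] using ha)
  · intro a ha
    rw [FreeMonoid.toList_mul, List.getLast?_append] at ha
    rcases hh : w.toList.getLast? with _ | b
    · rw [hh] at ha; exact h3 a (by simpa using ha)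
    · rw [hh] at ha; exact h3' a (by simpa [hh] using ha)

theorem blockWord_zero_mem_alternating (i : ℕ) : blockWord 0 i ∈ alternating := by
  have h : ∀ ε, FreeMonoid.of 0 * pairWord ε ∈ alternating := by
    intro ε
    cases ε
    · refine ⟨?_, ?_, ?_⟩ <;> simp [pairWord]
    · refine ⟨?_, ?_, ?_⟩ <;> simp [pairWord]
  exact h _

theorem tower_mem_alternating (T j : ℕ) : tower F T j ∈ supported F F alternating := by
  have h0 : towerSpan F 0 ≤ supported F F alternating := by
    rw [towerSpan, Submodule.span_le]
    rintro _ ⟨j, rfl⟩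
    exact mono_mem_supported (blockWord_zero_mem_alternating j)
  have hpow : ∀ n, towerSpan F 0 ^ n ≤ supported F F alternating := by
    intro n
    induction n with
    | zero =>
      rw [pow_zero]
      exact Submodule.one_le.2 (mono_mem_supported (w := 1) (by
        refine ⟨?_, ?_, ?_⟩ <;> simp))
    | succ n ih =>
      rw [pow_succ]
      exact Submodule.mul_le.2 fun x hx y hy =>
        mul_mem_supported (fun v hv w hw => mul_mem_alternating hv hw) (ih hx) (h0 hy)
  obtain ⟨n, hn⟩ := exists_towerSpan_le_pow (F := F) 0 T
  rw [zero_add] at hn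
  exact hpow n (hn (tower_mem_towerSpan T j))

theorem mono_mul_self_mem_towerIdeal (a : Fin 3) :
    mono F (FreeMonoid.of a) * mono F (FreeMonoid.of a) ∈ towerIdeal F := by
  refine mem_towerIdeal_of_words fun T u v => ?_
  rw [← mono_mul, ← mono_mul, ← mono_mul]
  refine pair_eq_zero (T := {u * (FreeMonoid.of a * FreeMonoid.of a) * v})
    (Set.disjoint_singleton_right.2 ?_) (tower_mem_alternating T 2)
    (mono_mem_supported (Set.mem_singleton _))
  rintro ⟨h, -⟩
  simp only [FreeMonoid.toList_mul, FreeMonoid.toList_of, List.isChain_append] at h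
  simp at h

variable (F) in
/-- The quotient of the free algebra by the ideal `towerIdeal`. -/
abbrev TowerQuot : Type := FreeAlg F ⧸ towerIdeal F

variable (F) in
/-- The quotient map. -/
noncomputable abbrev toQuot : FreeAlg F →ₐ[F] TowerQuot F := Ideal.Quotient.mkₐ F (towerIdeal F)

theorem toQuot_eq_zero {a : FreeAlg F} : toQuot F a = 0 ↔ a ∈ towerIdeal F :=
  Ideal.Quotient.eq_zero_iff_mem

variable (F) in
/-- The elements of the free algebra without constant term. -/
noncomputable def augmentation : NonUnitalSubalgebra F (FreeAlg F) where
  toSubmodule := supported F F {w : Word | 1 ≤ w.length}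
  mul_mem' := by
    intro f g hf hg
    refine mul_mem_supported ?_ hf hg
    intro v hv w _
    rw [Set.mem_ofPred_eq] at hv ⊢
    rw [FreeMonoid.length_mul]
    omega

variable (F) in
/-- The image of the augmentation ideal in the quotient. -/
noncomputable def nilAlgebra : NonUnitalSubalgebra F (TowerQuot F) :=
  (augmentation F).map (toQuot F)

theorem exists_augBounded {f : FreeAlg F} (hf : f ∈ augmentation F) :
    ∃ d, 0 < d ∧ f ∈ augBounded F d := by
  refine ⟨f.coeff.support.sup FreeMonoid.length + 1, Nat.succ_pos _, fun w hw => ⟨hf hw, ?_⟩⟩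
  exact (Finset.le_sup (f := FreeMonoid.length) hw).trans (Nat.le_succ _)

theorem isNilpotent_of_mem_nilAlgebra {q : TowerQuot F} (hq : q ∈ nilAlgebra F) :
    IsNilpotent q := by
  obtain ⟨f, hf, rfl⟩ := hq
  obtain ⟨d, hd, hfd⟩ := exists_augBounded hf
  refine ⟨2 * (3 * 2 ^ level (d + 1)), ?_⟩
  have h : f ^ (2 * (3 * 2 ^ level (d + 1))) ∈ towerIdeal F :=
    mem_towerIdeal_of_words fun T u v => pair_tower_pow_eq_zero hd hfd T u v
  have := toQuot_eq_zero.2 h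
  rwa [map_pow] at this

end Quotient

section Engel

open MonoidAlgebra (supported single)

variable {F : Type} [Field F]

/-- Iterated conjugates, following the pattern of `conjWord`. -/
def conjSeq {M : Type*} [Monoid M] (X X' Y Y' : M) : ℕ → Bool → M
  | 0, ε => if ε then X else X'
  | n + 1, ε => conjSeq X X' Y Y' n true * (if ε then Y else Y') * conjSeq X X' Y Y' n false

theorem map_conjSeq {M N : Type*} [Monoid M] [Monoid N] (φ : M →* N) (X X' Y Y' : M) (n : ℕ)
    (ε : Bool) :
    φ (conjSeq X X' Y Y' n ε) = conjSeq (φ X) (φ X') (φ Y) (φ Y') n ε := by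
  induction n generalizing ε with
  | zero => cases ε <;> rfl
  | succ n ih => cases ε <;> simp [conjSeq, ih]

theorem conjSeq_succ_eq {G : Type*} [Group G] {Y : G} {E : ℕ → G}
    (hE : ∀ n, E (n + 1) = E n * Y * (E n)⁻¹ * Y⁻¹) (n : ℕ) :
    conjSeq (E 0) (E 0)⁻¹ Y Y⁻¹ (n + 1) true = E n * Y * (E n)⁻¹ ∧
      conjSeq (E 0) (E 0)⁻¹ Y Y⁻¹ (n + 1) false = E n * Y⁻¹ * (E n)⁻¹ := by
  induction n with
  | zero => exact ⟨rfl, rfl⟩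
  | succ n ih =>
    change conjSeq _ _ _ _ (n + 1) true * Y * conjSeq _ _ _ _ (n + 1) false = _ ∧
      conjSeq _ _ _ _ (n + 1) true * Y⁻¹ * conjSeq _ _ _ _ (n + 1) false = _
    rw [ih.1, ih.2, hE n]
    constructor <;> simp [mul_assoc]

/-- `z` is a nonzero multiple of the word `w` plus shorter words. -/
def HasTop (z : FreeAlg F) (w : Word) : Prop :=
  ∃ c : F, c ≠ 0 ∧ z - c • mono F w ∈ supported F F {v : Word | v.length < w.length}

theorem HasTop.mul {z z' : FreeAlg F} {w w' : Word} (h : HasTop z w) (h' : HasTop z' w') :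
    HasTop (z * z') (w * w') := by
  obtain ⟨c, hc, hz⟩ := h
  obtain ⟨c', hc', hz'⟩ := h'
  refine ⟨c * c', mul_ne_zero hc hc', ?_⟩
  have e : z * z' - (c * c') • mono F (w * w') =
      (z - c • mono F w) * (c' • mono F w' + (z' - c' • mono F w')) +
        c • mono F w * (z' - c' • mono F w') := by
    have h1 : (c * c') • mono F (w * w') = (c • mono F w) * (c' • mono F w') := by
      rw [mono_mul, smul_mul_smul_comm]
    rw [h1]
    noncomm_ring
  rw [e]
  have hw : ∀ (c : F) (w : Word), c • mono F w ∈ supported F F {v : Word | v.length ≤ w.length} :=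
    fun c w => Submodule.smul_mem _ _ (mono_mem_supported (Nat.le_refl _))
  have hsub : {v : Word | v.length < w'.length} ⊆ {v : Word | v.length ≤ w'.length} := by
    intro v hv
    simp only [Set.mem_ofPred_eq] at *
    omega
  refine add_mem
    (mul_mem_supported (S := {v : Word | v.length < w.length})
      (T := {v : Word | v.length ≤ w'.length}) ?_ hz
      (add_mem (hw c' w') (MonoidAlgebra.supported_mono hsub hz')))
    (mul_mem_supported (S := {v : Word | v.length ≤ w.length})
      (T := {v : Word | v.length < w'.length}) ?_ (hw c w) hz')
  all_goals
    intro p hp q hq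
    simp only [Set.mem_ofPred_eq, FreeMonoid.length_mul] at *
    omega

theorem hasTop_one_add (a : Fin 3) : HasTop (1 + mono F (FreeMonoid.of a)) (FreeMonoid.of a) := by
  refine ⟨1, one_ne_zero, ?_⟩
  rw [one_smul, add_sub_cancel_right]
  exact mono_mem_supported (w := 1) (by simp)

theorem hasTop_one_sub (a : Fin 3) : HasTop (1 - mono F (FreeMonoid.of a)) (FreeMonoid.of a) := by
  refine ⟨-1, neg_ne_zero.2 one_ne_zero, ?_⟩
  rw [neg_one_smul, sub_neg_eq_add, sub_add_cancel]
  exact mono_mem_supported (w := 1) (by simp)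

theorem HasTop.conjSeq {X X' Y Y' : FreeAlg F} (hX : HasTop X (FreeMonoid.of 0))
    (hX' : HasTop X' (FreeMonoid.of 0)) (hY : HasTop Y (pairWord true))
    (hY' : HasTop Y' (pairWord false)) (n : ℕ) (ε : Bool) :
    HasTop (conjSeq X X' Y Y' n ε) (conjWord n ε) := by
  induction n generalizing ε with
  | zero => cases ε <;> assumption
  | succ n ih =>
    cases ε
    · exact ((ih true).mul hY').mul (ih false)
    · exact ((ih true).mul hY).mul (ih false)

theorem sub_one_notMem_towerIdeal {T : ℕ} {z : FreeAlg F}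
    (hz : HasTop z (blockWord (level T) 2)) : z - 1 ∉ towerIdeal F := by
  intro h
  obtain ⟨c, hc, hz⟩ := hz
  have h1 := h T 1 1
  rw [one_mul, mul_one] at h1
  have hL := length_blockWord (level T) 2
  have hlow : ∀ {y : FreeAlg F},
      y ∈ supported F F {v : Word | v.length < (blockWord (level T) 2).length} →
      pair (tower F T 2) y = 0 := by
    intro y hy
    refine pair_eq_zero (Set.disjoint_left.2 ?_) (tower_mem_homog T 2) hy
    intro w hw hw'
    simp only [Set.mem_ofPred_eq] at hw hw'
    omega
  have hone : pair (tower F T 2) (1 : FreeAlg F) = 0 := by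
    refine hlow (mono_mem_supported (w := 1) ?_)
    rw [Set.mem_ofPred_eq, hL, FreeMonoid.length_one]
    positivity
  have htop : pair (tower F T 2) (c • mono F (blockWord (level T) 2)) = c := by
    rw [map_smul, pair_mono_right, coeff_tower, if_pos rfl, smul_eq_mul, mul_one]
  have hzc := hlow hz
  rw [map_sub, htop] at hzc
  rw [map_sub, hone, sub_zero] at h1
  rw [h1, zero_sub, neg_eq_zero] at hzc
  exact hc hzc

theorem exists_quasiInverse {Q : Type*} [Ring Q] [Algebra F Q] (S : NonUnitalSubalgebra F Q)
    {a : Q} (ha : a ∈ S) (hnil : IsNilpotent a) :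
    ∃ b ∈ S, (1 + a) * (1 + b) = 1 ∧ (1 + b) * (1 + a) = 1 := by
  obtain ⟨n, hn⟩ := hnil
  have hpow : ∀ i, (-a) ^ (i + 1) ∈ S := by
    intro i
    induction i with
    | zero => rw [zero_add, pow_one]; exact neg_mem ha
    | succ i ih => rw [pow_succ]; exact mul_mem ih (neg_mem ha)
  have hz : (-a) ^ (n + 1) = 0 := by rw [neg_pow, pow_succ a n, hn, zero_mul, mul_zero]
  refine ⟨∑ i ∈ Finset.range n, (-a) ^ (i + 1), sum_mem fun i _ => hpow i, ?_⟩
  have e : 1 + ∑ i ∈ Finset.range n, (-a) ^ (i + 1) = ∑ i ∈ Finset.range (n + 1), (-a) ^ i := by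
    rw [Finset.sum_range_succ', pow_zero, add_comm]
  rw [e]
  have h1 := mul_neg_geom_sum (-a) (n + 1)
  have h2 := geom_sum_mul_neg (-a) (n + 1)
  rw [hz, sub_zero, sub_neg_eq_add] at h1 h2
  exact ⟨h1, h2⟩

theorem one_add_coe_circ {Q : Type*} [Ring Q] [Algebra F Q] (S : NonUnitalSubalgebra F Q)
    (a b : S) : (1 : Q) + (circ a b : S) = (1 + a) * (1 + b) := by
  simp only [circ, NonUnitalSubalgebra.coe_add, NonUnitalSubalgebra.coe_mul]
  noncomm_ring

theorem coe_npow' {Q : Type*} [Ring Q] [Algebra F Q] (S : NonUnitalSubalgebra F Q)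
    (a : S) (n : ℕ) : ((npow' a n : S) : Q) = (a : Q) ^ (n + 1) := by
  induction n with
  | zero => rw [zero_add, pow_one]; rfl
  | succ n ih => rw [pow_succ, ← ih]; rfl

/-- The unit `1 + a` attached to an element `a` with a quasi-inverse. -/
def oneAddUnit {Q : Type*} [Ring Q] [Algebra F Q] (S : NonUnitalSubalgebra F Q) (qinv : S → S)
    (h : ∀ a : S, circ a (qinv a) = 0) (h' : ∀ a : S, circ (qinv a) a = 0) (a : S) : Qˣ where
  val := 1 + a
  inv := 1 + qinv a
  val_inv := by rw [← one_add_coe_circ, h]; simp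
  inv_val := by rw [← one_add_coe_circ, h']; simp

theorem oneAddUnit_engelChain {Q : Type*} [Ring Q] [Algebra F Q] (S : NonUnitalSubalgebra F Q)
    (qinv : S → S) (h : ∀ a : S, circ a (qinv a) = 0) (h' : ∀ a : S, circ (qinv a) a = 0)
    (x y : S) (n : ℕ) :
    oneAddUnit S qinv h h' (engelChain qinv x y (n + 1)) =
      oneAddUnit S qinv h h' (engelChain qinv x y n) * oneAddUnit S qinv h h' y *
        (oneAddUnit S qinv h h' (engelChain qinv x y n))⁻¹ * (oneAddUnit S qinv h h' y)⁻¹ := by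
  apply Units.ext
  simp only [Units.val_mul]
  change (1 : Q) + (engelChain qinv x y (n + 1) : S) = (1 + (engelChain qinv x y n : S)) *
    (1 + y) * (1 + qinv (engelChain qinv x y n)) * (1 + qinv y)
  rw [engelChain, one_add_coe_circ, one_add_coe_circ, one_add_coe_circ]

theorem engelChain_ne_zero (qinv : nilAlgebra F → nilAlgebra F)
    (h : ∀ a, circ a (qinv a) = 0) (h' : ∀ a, circ (qinv a) a = 0) (x y : nilAlgebra F)
    (hx : (x : TowerQuot F) = toQuot F (mono F (FreeMonoid.of 0)))
    (hy : (1 : TowerQuot F) + y =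
      toQuot F ((1 + mono F (FreeMonoid.of 1)) * (1 + mono F (FreeMonoid.of 2)))) (n : ℕ) :
    engelChain qinv x y (n + 1) ≠ 0 := by
  set X : FreeAlg F := 1 + mono F (FreeMonoid.of 0)
  set X' : FreeAlg F := 1 - mono F (FreeMonoid.of 0)
  set Y : FreeAlg F := (1 + mono F (FreeMonoid.of 1)) * (1 + mono F (FreeMonoid.of 2))
  set Y' : FreeAlg F := (1 - mono F (FreeMonoid.of 2)) * (1 - mono F (FreeMonoid.of 1))
  set U := oneAddUnit (nilAlgebra F) qinv h h'
  have hsq : ∀ a, toQuot F (mono F (FreeMonoid.of a)) * toQuot F (mono F (FreeMonoid.of a)) = 0 :=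
    fun a => by rw [← map_mul]; exact toQuot_eq_zero.2 (mono_mul_self_mem_towerIdeal a)
  have hinv : ∀ a, toQuot F (1 + mono F (FreeMonoid.of a)) *
      toQuot F (1 - mono F (FreeMonoid.of a)) = 1 := by
    intro a
    rw [map_add, map_sub, map_one, add_mul, mul_sub, mul_sub, hsq]
    noncomm_ring
  have hUX : (↑(U x) : TowerQuot F) = toQuot F X := by
    change (1 : TowerQuot F) + x = _
    rw [hx, map_add, map_one]
  have hUY : (↑(U y) : TowerQuot F) = toQuot F Y := hy
  have hUX' : (↑(U x)⁻¹ : TowerQuot F) = toQuot F X' :=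
    Units.inv_eq_of_mul_eq_one_right (by rw [hUX]; exact hinv 0)
  have hUY' : (↑(U y)⁻¹ : TowerQuot F) = toQuot F Y' := by
    refine Units.inv_eq_of_mul_eq_one_right ?_
    rw [hUY, map_mul, map_mul, mul_assoc, ← mul_assoc (toQuot F (1 + mono F (FreeMonoid.of 2))),
      hinv, one_mul, hinv]
  have hE := oneAddUnit_engelChain (nilAlgebra F) qinv h h' x y
  have hzero : ∀ m, engelChain qinv x y m = 0 ↔ U (engelChain qinv x y m) = 1 := by
    intro m
    rw [Units.ext_iff]
    change _ ↔ (1 : TowerQuot F) + _ = 1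
    rw [add_eq_left, ZeroMemClass.coe_eq_zero]
  intro hn
  have hall : ∀ e, engelChain qinv x y (n + 1 + e) = 0 := by
    intro e
    induction e with
    | zero => exact hn
    | succ e ih =>
      rw [hzero] at ih ⊢
      rw [← add_assoc]
      refine (hE _).trans ?_
      change U _ * U _ * (U _)⁻¹ * (U _)⁻¹ = 1
      rw [ih]
      group
  obtain ⟨e, he⟩ := Nat.exists_eq_add_of_le (le_level (n + 1))
  obtain ⟨m, hm⟩ : ∃ m, level (n + 1) = m + 1 := ⟨n + e, by omega⟩
  have h1 := (hzero _).1 (hall e)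
  rw [← he, hm] at h1
  have h2 := (conjSeq_succ_eq (E := fun m => U (engelChain qinv x y m)) hE m).1
  have h3 : conjSeq (U x) (U x)⁻¹ (U y) (U y)⁻¹ (m + 1) true * (U y)⁻¹ = 1 := by
    rw [← h1]
    refine Eq.trans ?_ (hE m).symm
    exact congrArg (· * (U y)⁻¹) h2
  have h4 := congrArg (Units.coeHom (TowerQuot F)) h3
  rw [map_mul, map_conjSeq, map_one] at h4
  simp only [Units.coeHom_apply, hUX, hUY, hUX', hUY'] at h4
  have h5 := map_conjSeq (toQuot F : FreeAlg F →* TowerQuot F) X X' Y Y' (m + 1) true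
  have h6 : conjSeq X X' Y Y' (level (n + 1)) true * Y' - 1 ∈ towerIdeal F := by
    rw [← toQuot_eq_zero, map_sub, map_mul, map_one, hm, sub_eq_zero]
    exact (congrArg (· * toQuot F Y') h5).trans h4
  have hY : HasTop Y (pairWord true) := (hasTop_one_add 1).mul (hasTop_one_add 2)
  have hY' : HasTop Y' (pairWord false) := (hasTop_one_sub 2).mul (hasTop_one_sub 1)
  have htop := (HasTop.conjSeq (hasTop_one_add 0) (hasTop_one_sub 0) hY hY'
    (level (n + 1)) true).mul hY'
  have hb : blockWord (level (n + 1)) 2 = conjWord (level (n + 1)) true * pairWord false := by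
    have : paperfold (2 + 1) = false := paperfold_odd 1
    rw [blockWord, this]
    rfl
  rw [← hb] at htop
  exact sub_one_notMem_towerIdeal htop h6

end Engel

/-- Over an arbitrary field `F` there exists a nil `F`-algebra `R`
whose adjoint group `R°` is not an Engel group. -/
theorem exists_nil_algebra_adjoint_not_engel (F : Type) [Field F] :
    Nonempty (NilNotEngelAlgebra F) := by
  have hq : ∀ a : nilAlgebra F, ∃ b : nilAlgebra F, circ a b = 0 ∧ circ b a = 0 := by
    rintro ⟨a, ha⟩
    obtain ⟨b, hb, h1, h2⟩ :=
      exists_quasiInverse (nilAlgebra F) ha (isNilpotent_of_mem_nilAlgebra ha)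
    refine ⟨⟨b, hb⟩, ?_, ?_⟩
    · have := one_add_coe_circ (nilAlgebra F) ⟨a, ha⟩ ⟨b, hb⟩
      rwa [h1, add_eq_left, ZeroMemClass.coe_eq_zero] at this
    · have := one_add_coe_circ (nilAlgebra F) ⟨b, hb⟩ ⟨a, ha⟩
      rwa [h2, add_eq_left, ZeroMemClass.coe_eq_zero] at this
  choose qinv h h' using hq
  have hmem : ∀ a, mono F (FreeMonoid.of a) ∈ augmentation F := fun a =>
    mono_mem_supported (S := {w : Word | 1 ≤ w.length}) (by simp)
  have hmap : ∀ {f}, f ∈ augmentation F → toQuot F f ∈ nilAlgebra F := fun {f} hf => ⟨f, hf, rfl⟩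
  let x : nilAlgebra F := ⟨_, hmap (hmem 0)⟩
  let y : nilAlgebra F := ⟨_, hmap (add_mem (add_mem (hmem 1) (hmem 2))
    (mul_mem (hmem 1) (hmem 2)))⟩
  refine ⟨{
    carrier := nilAlgebra F
    nil := ?_
    qinv := qinv
    circ_qinv := h
    qinv_circ := h'
    x := x
    y := y
    not_engel := engelChain_ne_zero qinv h h' x y rfl ?_ }⟩
  · intro a
    obtain ⟨n, hn⟩ := isNilpotent_of_mem_nilAlgebra a.2
    refine ⟨n, ?_⟩
    have h := coe_npow' (nilAlgebra F) a n
    rw [pow_succ, hn, zero_mul] at h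
    exact Subtype.ext h
  · change (1 : TowerQuot F) + toQuot F _ = _
    rw [← map_one (toQuot F), ← map_add]
    congr 1
    noncomm_ring

end Paper
end

section
/- There exists a prime p and a nil 𝔽_p-algebra R generated by two elements (equivalently, a finitely generated two-sided brace, i.e., a finitely generated Jacobson radical ring) such that the adjoint group R° of R is a torsion group but is not an Engel group. -/
namespace Paper

/-- A counterexample witness for Statement 11: a nil `𝔽_p`-algebra `R` generated (as a
nonunital `𝔽_p`-algebra) by two elements — equivalently a finitely generated two-sided
brace / Jacobson radical ring — whose adjoint group `R°` is a torsion group but not an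
Engel group. -/
structure TorsionNotEngelWitness (p : ℕ) [Fact p.Prime] : Type 1 where
  carrier : Type
  [ring : NonUnitalRing carrier]
  [mod : Module (ZMod p) carrier]
  [smulComm : SMulCommClass (ZMod p) carrier carrier]
  [tower : IsScalarTower (ZMod p) carrier carrier]
  gen₁ : carrier
  gen₂ : carrier
  generates : NonUnitalAlgebra.adjoin (ZMod p) {gen₁, gen₂} = ⊤
  nil : ∀ x : carrier, ∃ n : ℕ, npow' x n = 0
  qinv : carrier → carrier
  circ_qinv : ∀ a : carrier, circ a (qinv a) = 0
  qinv_circ : ∀ a : carrier, circ (qinv a) a = 0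
  torsion : ∀ a : carrier, ∃ n : ℕ, 0 < n ∧ circPow a n = 0
  x : carrier
  y : carrier
  not_engel : ∀ n : ℕ, engelChain qinv x y (n + 1) ≠ 0

end Paper

namespace WordAlgebra

open MonoidAlgebra hiding of
open FreeMonoid hiding lift
open scoped Polynomial

variable {k : Type*} [Field k]

/-- The free algebra on two letters, with words as basis. -/
abbrev WordAlg (k : Type*) [Field k] := MonoidAlgebra k (FreeMonoid Bool)

lemma coeff_single_cons_mul_cons (x y : Bool) (u v : FreeMonoid Bool) (g : WordAlg k) :
    (single (of y * u) 1 * g).coeff (of x * v) =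
      if y = x then (single u 1 * g).coeff v else 0 := by
  split_ifs with h
  · subst h
    rw [← one_mul (1 : k), ← single_mul_single, mul_assoc, coeff_single_mul_mul]
    simp
  · apply coeff_single_mul_of_forall_mul_ne
    intro d hd
    have := congrArg (fun l => (FreeMonoid.toList l).head?) hd
    simp at this
    exact h this

lemma coeff_single_cons_mul_one (y : Bool) (u : FreeMonoid Bool) (g : WordAlg k) :
    (single (of y * u) 1 * g).coeff 1 = 0 := by
  apply coeff_single_mul_of_forall_mul_ne
  intro d hd
  have := congrArg FreeMonoid.length hd
  simp at this

lemma eq_sum_single_cons (f : WordAlg k) (hf : f.coeff 1 = 0) (Y : Finset (FreeMonoid Bool))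
    (hY : ∀ (x : Bool) u, f.coeff (of x * u) ≠ 0 → u ∈ Y) :
    f = ∑ u ∈ Y, ∑ c : Bool, f.coeff (of c * u) • single (of c * u) (1 : k) := by
  classical
  ext w
  rw [coeff_sum, Finsupp.finsetSum_apply]
  simp only [coeff_sum, Finsupp.finsetSum_apply, coeff_smul_apply, coeff_single,
    Finsupp.single_apply]
  cases w using FreeMonoid.casesOn with
  | one =>
    rw [hf, Finset.sum_eq_zero]
    intro u _
    refine Finset.sum_eq_zero fun c _ => ?_
    rw [if_neg]
    · simp
    · intro h
      have := congrArg FreeMonoid.length h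
      simp at this
  | of_mul x v =>
    have key : ∀ u c, (of c * u = of x * v) ↔ (c = x ∧ u = v) := by
      intro u c
      refine ⟨fun h => ?_, fun h => by rw [h.1, h.2]⟩
      have := congrArg FreeMonoid.toList h
      simpa using this
    simp only [key]
    by_cases hv : v ∈ Y
    · rw [Finset.sum_eq_single_of_mem v hv, Finset.sum_eq_single_of_mem x (Finset.mem_univ _)]
      · simp
      · intro c _ hc
        simp [hc]
      · intro u _ hu
        simp [hu]
    · have : f.coeff (of x * v) = 0 := by
        by_contra h
        exact hv (hY _ _ h)
      rw [this, Finset.sum_eq_zero]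
      intro u hu
      have : u ≠ v := fun h => hv (h ▸ hu)
      simp [this]

lemma coeff_mul_cons (f g : WordAlg k) (hf : f.coeff 1 = 0) (Y : Finset (FreeMonoid Bool))
    (hY : ∀ (x : Bool) u, f.coeff (of x * u) ≠ 0 → u ∈ Y) (x : Bool) (v : FreeMonoid Bool) :
    (f * g).coeff (of x * v) =
      ∑ u ∈ Y, f.coeff (of x * u) * (single u 1 * g).coeff v := by
  conv_lhs => rw [eq_sum_single_cons f hf Y hY, Finset.sum_mul]
  simp only [Finset.sum_mul, coeff_sum, Finsupp.finsetSum_apply, smul_mul_assoc, coeff_smul_apply,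
    coeff_single_cons_mul_cons]
  refine Finset.sum_congr rfl fun u _ => ?_
  rw [Finset.sum_eq_single_of_mem x (Finset.mem_univ _)]
  · simp
  · intro c _ hc
    simp [hc]

/-- Words of length less than `d`. -/
abbrev ShortWord (d : ℕ) := {u : FreeMonoid Bool // u.length < d}

noncomputable instance (d : ℕ) : Fintype (ShortWord d) :=
  (List.finite_length_lt Bool d).fintype

instance (d : ℕ) : DecidableEq (ShortWord d) := fun u v =>
  decidable_of_iff (toList u.1 = toList v.1) (by
    rw [toList.injective.eq_iff, Subtype.ext_iff])

/-- One step of the automaton recognising the powers of `f`: a state records the part of a factor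
of `f` still to be completed, and the formal variable counts completed factors. -/
noncomputable def step (f : WordAlg k) (d : ℕ) (x : Bool) :
    Module.End k[X] (ShortWord d → k[X]) :=
  LinearMap.pi fun w => match w with
    | ⟨[], _⟩ => ∑ u : ShortWord d,
        (Polynomial.X * Polynomial.C (f.coeff (of x * u.1))) •
          (LinearMap.proj u : (ShortWord d → k[X]) →ₗ[k[X]] k[X])
    | ⟨y :: u, h⟩ => if y = x then
        LinearMap.proj (⟨u, (Nat.lt_succ_self _).trans h⟩ : ShortWord d) else 0

lemma step_one (f : WordAlg k) (d : ℕ) (x : Bool) (s : ShortWord d → k[X]) (h) :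
    step f d x s ⟨1, h⟩ =
      ∑ u : ShortWord d, Polynomial.X * Polynomial.C (f.coeff (of x * u.1)) * s u := by
  have : step f d x s ⟨1, h⟩ = (∑ u : ShortWord d,
        (Polynomial.X * Polynomial.C (f.coeff (of x * u.1))) •
          (LinearMap.proj u : (ShortWord d → k[X]) →ₗ[k[X]] k[X])) s := rfl
  rw [this]
  simp

lemma step_cons (f : WordAlg k) (d : ℕ) (x y : Bool) (u : FreeMonoid Bool)
    (s : ShortWord d → k[X]) (h) (h') :
    step f d x s ⟨of y * u, h⟩ = if y = x then s ⟨u, h'⟩ else 0 := by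
  have : step f d x s ⟨of y * u, h⟩ = (if y = x then
        (LinearMap.proj (⟨u, h'⟩ : ShortWord d) : (ShortWord d → k[X]) →ₗ[k[X]] k[X]) else 0) s :=
    rfl
  rw [this]
  split_ifs <;> simp

/-- The representation of the free algebra by the automaton recognising the powers of `f`. -/
noncomputable def recognizer (f : WordAlg k) (d : ℕ) :
    WordAlg k →ₐ[k] Module.End k[X] (ShortWord d → k[X]) :=
  MonoidAlgebra.lift k _ _ (FreeMonoid.lift (step f d))

lemma coeff_recognizer_single (f : WordAlg k) (hf : f.coeff 1 = 0) (d : ℕ)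
    (hd : ∀ u, f.coeff u ≠ 0 → u.length ≤ d) (h0 : 0 < d) (v : FreeMonoid Bool) :
    ∀ (N : ℕ) (u : ShortWord d),
      (recognizer f d (single v 1) (Pi.single ⟨1, h0⟩ 1) u).coeff N =
        (single u.1 1 * f ^ N).coeff v := by
  classical
  induction v using FreeMonoid.inductionOn' with
  | one =>
    rintro N ⟨u, hu⟩
    have h1 : recognizer f d (single 1 1) = 1 := by
      rw [← one_def, map_one]
    rw [h1, Module.End.one_apply]
    cases u using FreeMonoid.casesOn with
    | one =>
      have : ∀ N, (f ^ (N + 1)).coeff 1 = 0 := by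
        intro N
        rw [pow_succ', eq_sum_single_cons f hf
          (f.coeff.support.image fun w => ofList (toList w).tail)]
        · simp only [Finset.sum_mul, coeff_sum, Finsupp.finsetSum_apply, smul_mul_assoc,
            coeff_smul_apply, coeff_single_cons_mul_one, smul_zero, Finset.sum_const_zero]
        · intro x u h
          rw [Finset.mem_image]
          exact ⟨of x * u, by simpa using h, by simp⟩
      cases N with
      | zero => simp [← one_def]
      | succ N => simp [← one_def, this, Polynomial.coeff_one]
    | of_mul y u =>
      rw [coeff_single_cons_mul_one, Pi.single_eq_of_ne]
      · simp
      · intro h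
        have := congrArg (fun w => w.1.length) h
        simp at this
  | of_mul x v ih =>
    rintro N ⟨u, hu⟩
    have h1 : recognizer f d (single (of x * v) 1) =
        step f d x * recognizer f d (single v 1) := by
      rw [← one_mul (1 : k), ← single_mul_single, map_mul]
      simp [recognizer]
    rw [h1, Module.End.mul_apply]
    cases u using FreeMonoid.casesOn with
    | one =>
      rw [step_one]
      simp only [mul_assoc, ← Finset.mul_sum]
      cases N with
      | zero =>
        have : (1 : WordAlg k).coeff (of x * v) = 0 := by
          rw [one_def, coeff_single, Finsupp.single_apply, if_neg]
          intro h
          have := congrArg FreeMonoid.length h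
          rw [length_one, length_mul, length_of] at this
          omega
        simp [← one_def, this]
      | succ N =>
        rw [Polynomial.coeff_X_mul, Polynomial.finsetSum_coeff, ← one_def, one_mul, pow_succ',
          coeff_mul_cons f _ hf
            ((Finset.univ : Finset (ShortWord d)).map ⟨_, Subtype.val_injective⟩)]
        · rw [Finset.sum_map]
          refine Finset.sum_congr rfl fun u _ => ?_
          rw [Polynomial.coeff_C_mul, ih]
          rfl
        · intro y w h
          simp only [Finset.mem_map, Finset.mem_univ, true_and]
          have := hd _ h
          rw [FreeMonoid.length_mul, FreeMonoid.length_of] at this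
          exact ⟨⟨w, by omega⟩, rfl⟩
    | of_mul y u =>
      have hu' : u.length < d := by
        rw [FreeMonoid.length_mul] at hu
        omega
      rw [step_cons f d x y u _ hu hu', coeff_single_cons_mul_cons]
      split_ifs
      · exact ih N ⟨u, hu'⟩
      · simp

/-- The bilinear pairing on the free algebra for which the words are orthonormal. -/
noncomputable def pair : WordAlg k →ₗ[k] WordAlg k →ₗ[k] k :=
  (Finsupp.linearCombination k fun w : FreeMonoid Bool =>
    (Finsupp.lapply w ∘ₗ (coeffLinearEquiv k).toLinearMap : WordAlg k →ₗ[k] k)) ∘ₗ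
      (coeffLinearEquiv k).toLinearMap

lemma pair_single (w : FreeMonoid Bool) (c : k) (a : WordAlg k) :
    pair (single w c) a = c * a.coeff w := by
  simp [pair]

lemma pair_eq_sum (η a : WordAlg k) :
    pair η a = ∑ w ∈ η.coeff.support, η.coeff w * a.coeff w := by
  simp [pair, Finsupp.linearCombination_apply, Finsupp.sum]

lemma pair_pow_eq_coeff_recognizer (f : WordAlg k) (hf : f.coeff 1 = 0) (d : ℕ)
    (hd : ∀ u, f.coeff u ≠ 0 → u.length ≤ d) (h0 : 0 < d) (N : ℕ) (η : WordAlg k) :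
    pair η (f ^ N) = (recognizer f d η (Pi.single ⟨1, h0⟩ 1) ⟨1, h0⟩).coeff N := by
  induction η using MonoidAlgebra.induction_linear with
  | zero => simp
  | add η θ h₁ h₂ => simp [h₁, h₂]
  | single w c =>
    have h : (single w c : WordAlg k) = c • single w 1 := by simp
    rw [pair_single, h, map_smul, LinearMap.smul_apply, Pi.smul_apply, Polynomial.coeff_smul,
      coeff_recognizer_single f hf d hd h0, ← one_def, one_mul, smul_eq_mul]

/-- The standard polynomial `∑ sgn(σ) η_{σ 0} η_{σ 1} ⋯`. -/
def stdPoly {S : Type*} [Ring S] {m : ℕ} (η : Fin m → S) : S :=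
  ∑ σ : Equiv.Perm (Fin m), Equiv.Perm.sign σ • (List.ofFn fun i => η (σ i)).prod

lemma map_stdPoly {S T : Type*} [Ring S] [Ring T] (φ : S →+* T) {m : ℕ} (η : Fin m → S) :
    φ (stdPoly η) = stdPoly fun i => φ (η i) := by
  simp only [stdPoly, map_sum]
  refine Finset.sum_congr rfl fun σ _ => ?_
  rw [Units.smul_def, map_zsmul, map_list_prod, List.map_ofFn]
  rfl

lemma stdPoly_end_eq_zero {K : Type*} [CommRing K] [IsDomain K] {Y : Type*} [Fintype Y] {m : ℕ}
    (hm : Fintype.card Y * Fintype.card Y < m) (η : Fin m → Module.End K (Y → K)) :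
    stdPoly η = 0 := by
  classical
  have h : stdPoly η = MultilinearMap.alternatization
      (MultilinearMap.mkPiAlgebraFin K m (Module.End K (Y → K))) η := by
    rw [MultilinearMap.alternatization_apply]
    rfl
  rw [h]
  apply AlternatingMap.map_linearDependent
  intro hli
  have := hli.fintype_card_le_finrank
  rw [Fintype.card_fin, Module.finrank_linearMap, Module.finrank_fintype_fun_eq_card] at this
  omega

/-- The paperfolding sequence. -/
def fold (n : ℕ) : Bool := decide (ordCompl[2] n % 4 = 1)

lemma fold_two_pow_mul (v c : ℕ) : fold (2 ^ v * c) = fold c := by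
  have : ordCompl[2] (2 ^ v * c) = ordCompl[2] c := by
    rw [Nat.ordCompl_mul]
    simp [Nat.Prime.factorization_pow Nat.prime_two]
  rw [fold, fold, this]

lemma fold_of_odd {c : ℕ} (hc : c % 2 = 1) : fold c = decide (c % 4 = 1) := by
  have : ¬ 2 ∣ c := by omega
  rw [fold, Nat.factorization_eq_zero_of_not_dvd this]
  simp

lemma fold_add_two_pow_mul_of_not_dvd {n j : ℕ} (hj : ¬ 2 ^ n ∣ j) (t : ℕ) :
    fold (j + 2 ^ (n + 1) * t) = fold j := by
  have hj0 : j ≠ 0 := fun h => hj (h ▸ dvd_zero _)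
  obtain ⟨v, c, hc, rfl⟩ := Nat.exists_eq_two_pow_mul_odd hj0
  have hv : v < n := by
    by_contra! h
    exact hj ((pow_dvd_pow 2 h).mul_right c)
  obtain ⟨u, hu⟩ : ∃ u, n + 1 = v + (2 + u) := ⟨n - v - 1, by omega⟩
  have hc2 : c % 2 = 1 := Nat.odd_iff.1 hc
  have e : 2 ^ v * c + 2 ^ (v + (2 + u)) * t = 2 ^ v * (c + 4 * (2 ^ u * t)) := by ring
  rw [hu, e, fold_two_pow_mul, fold_two_pow_mul, fold_of_odd hc2, fold_of_odd (by omega),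
    Nat.add_mul_mod_self_left]

lemma fold_add_two_pow_mul {n j : ℕ} (hj : 0 < j) (hjn : j < 2 ^ n) (t : ℕ) :
    fold (j + 2 ^ (n + 1) * t) = fold j :=
  fold_add_two_pow_mul_of_not_dvd (Nat.not_dvd_of_pos_of_lt hj hjn) t

lemma fold_three_mul (n : ℕ) : fold (2 ^ n * 3) = false := by
  rw [fold_two_pow_mul, fold_of_odd (by norm_num)]
  rfl

lemma fold_two_pow (n : ℕ) : fold (2 ^ n) = true := by
  rw [← mul_one (2 ^ n), fold_two_pow_mul, fold_of_odd (by norm_num)]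
  rfl

lemma exists_add_mod_eq (S N ρ : ℕ) (hρ : ρ < N) : ∃ o < N, (S + o) % N = ρ := by
  refine ⟨(ρ + (N - S % N)) % N, Nat.mod_lt _ (by omega), ?_⟩
  have := Nat.mod_lt S (by omega : 0 < N)
  have h : S + (ρ + (N - S % N)) = ρ + N * (S / N + 1) := by
    rw [mul_add]
    have := Nat.div_add_mod S N
    omega
  rw [Nat.add_mod_mod, h, Nat.add_mul_mod_self_left, Nat.mod_eq_of_lt hρ]

/-- Distinct windows of suitable length of the paperfolding sequence differ. -/
lemma exists_fold_ne (e s i j : ℕ) (hij : i < j) (hj : j < 2 ^ e) :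
    ∃ o < 2 ^ (e + 2) + 1,
      fold (s + (2 ^ (e + 2) + 1) * i + o) ≠ fold (s + (2 ^ (e + 2) + 1) * j + o) := by
  obtain ⟨v, w, hw, hvw⟩ := Nat.exists_eq_two_pow_mul_odd (n := j - i) (by omega)
  set r := 2 ^ (e + 2) + 1 with hr
  have hv : v < e := by
    by_contra! h
    have h1 : 2 ^ e ≤ 2 ^ v := Nat.pow_le_pow_right (by norm_num) h
    have h2 : 2 ^ v * 1 ≤ 2 ^ v * w := Nat.mul_le_mul_left _ hw.pos
    omega
  have hrodd : Odd r := by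
    rw [hr, pow_succ, mul_comm]
    exact odd_two_mul_add_one _
  set q := r * w with hq
  have hqodd : q % 2 = 1 := Nat.odd_iff.1 (hrodd.mul hw)
  have hmod : 2 ^ v * 8 ≤ 2 ^ (e + 2) := by
    have : 2 ^ v * 8 = 2 ^ (v + 3) := by ring
    rw [this]
    exact Nat.pow_le_pow_right (by norm_num) (by omega)
  have hpos : 0 < 2 ^ v := by positivity
  obtain ⟨c₀, hc₀, hc₀'⟩ : ∃ c₀ < 8,
      (q % 4 = 1 ∧ c₀ % 4 = 1 ∧ (c₀ + q) % 8 = 6) ∨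
        (q % 4 = 3 ∧ c₀ % 4 = 3 ∧ (c₀ + q) % 8 = 2) := by
    rcases (by omega : q % 4 = 1 ∨ q % 4 = 3) with h | h
    · exact ⟨(14 - q % 8) % 8, by omega, by omega⟩
    · exact ⟨(10 - q % 8) % 8, by omega, by omega⟩
  obtain ⟨o, ho, hoe⟩ := exists_add_mod_eq (s + r * i) (2 ^ v * 8) (2 ^ v * c₀)
    ((Nat.mul_lt_mul_left hpos).2 hc₀)
  refine ⟨o, by omega, ?_⟩
  obtain ⟨c, hc, hT⟩ : ∃ c, c % 8 = c₀ ∧ s + r * i + o = 2 ^ v * c := by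
    refine ⟨c₀ + 8 * ((s + r * i + o) / (2 ^ v * 8)), by omega, ?_⟩
    conv_lhs => rw [← Nat.div_add_mod (s + r * i + o) (2 ^ v * 8), hoe]
    ring
  have hT' : s + r * j + o = 2 ^ v * (c + q) := by
    have : j = i + 2 ^ v * w := by omega
    rw [this, mul_add (2 ^ v), ← hT, hq]
    ring
  have hcq : c + q = 2 ^ 1 * ((c + q) / 2) := by omega
  rw [hT, hT', fold_two_pow_mul, fold_two_pow_mul, fold_of_odd (by omega), hcq, fold_two_pow_mul,
    fold_of_odd (by omega)]
  rcases hc₀' with h | h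
  · have h1 : c % 4 = 1 := by omega
    have h2 : (c + q) / 2 % 4 = 3 := by omega
    rw [h1, h2]
    decide
  · have h1 : c % 4 = 3 := by omega
    have h2 : (c + q) / 2 % 4 = 1 := by omega
    rw [h1, h2]
    decide

/-- `seqProd B s l` is the product `B s * B (s + 1) * ⋯ * B (s + l - 1)`. -/
def seqProd {S : Type*} [Monoid S] (B : ℕ → S) (s : ℕ) : ℕ → S
  | 0 => 1
  | l + 1 => seqProd B s l * B (s + l)

lemma seqProd_add {S : Type*} [Monoid S] (B : ℕ → S) (s l l' : ℕ) :
    seqProd B s (l + l') = seqProd B s l * seqProd B (s + l) l' := by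
  induction l' with
  | zero => simp [seqProd]
  | succ l' ih => rw [← add_assoc, seqProd, seqProd, ih, mul_assoc, add_assoc]

lemma seqProd_one {S : Type*} [Monoid S] (B : ℕ → S) (s : ℕ) : seqProd B s 1 = B s := by
  simp [seqProd]

lemma map_seqProd {S T : Type*} [Monoid S] [Monoid T] (φ : S →* T) (B : ℕ → S) (s l : ℕ) :
    φ (seqProd B s l) = seqProd (fun i => φ (B i)) s l := by
  induction l with
  | zero => simp [seqProd]
  | succ l ih => rw [seqProd, seqProd, map_mul, ih]

lemma seqProd_mem {S : Type*} [Monoid S] {P : Submonoid S} {B : ℕ → S} (hB : ∀ i, B i ∈ P)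
    (s l : ℕ) : seqProd B s l ∈ P := by
  induction l with
  | zero => exact P.one_mem
  | succ l ih => exact P.mul_mem ih (hB _)

lemma seqProd_congr {S : Type*} [Monoid S] {B B' : ℕ → S} {s s' l : ℕ}
    (h : ∀ i < l, B (s + i) = B' (s' + i)) : seqProd B s l = seqProd B' s' l := by
  induction l with
  | zero => rfl
  | succ l ih => rw [seqProd, seqProd, ih fun i hi => h i (by omega), h l (by omega)]

lemma prod_ofFn_seqProd {S : Type*} [Monoid S] (B : ℕ → S) (s r m : ℕ) :
    (List.ofFn fun i : Fin m => seqProd B (s + r * i) r).prod = seqProd B s (r * m) := by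
  induction m with
  | zero => simp [seqProd]
  | succ m ih =>
    rw [List.ofFn_succ', List.concat_eq_append, List.prod_append, List.prod_singleton, mul_add,
      mul_one, seqProd_add]
    simp only [Fin.val_castSucc, Fin.val_last, ih]

lemma seqProd_seqProd {S : Type*} [Monoid S] (B : ℕ → S) (s r l : ℕ) :
    seqProd B (r * s) (r * l) = seqProd (fun t => seqProd B (r * t) r) s l := by
  induction l with
  | zero => rfl
  | succ l ih => rw [mul_add, mul_one, seqProd_add, ih, seqProd, ← mul_add]

lemma coeff_mul_mul_of_length {f : WordAlg k} {u : FreeMonoid Bool}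
    (hf : ∀ w, f.coeff w ≠ 0 → w.length = u.length) (g : WordAlg k) (v : FreeMonoid Bool) :
    (f * g).coeff (u * v) = f.coeff u * g.coeff v := by
  conv_lhs => rw [← sum_coeff_single f, Finsupp.sum, Finset.sum_mul]
  rw [MonoidAlgebra.coeff_sum, Finsupp.finsetSum_apply, Finset.sum_eq_single u]
  · exact coeff_single_mul_mul ..
  · intro w hw hwu
    apply coeff_single_mul_of_forall_mul_ne
    intro d hd
    exact hwu (List.append_inj_left hd (hf w (by simpa using hw)))
  · intro hu
    rw [coeff_single_mul_mul]
    simp only [Finsupp.mem_support_iff, not_not] at hu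
    simp [hu]

/-- The elements all of whose words have degree `q`. -/
def Homog {N : Type*} [CommMonoid N] (δ : FreeMonoid Bool →* N) (f : WordAlg k) (q : N) : Prop :=
  ∀ u, f.coeff u ≠ 0 → δ u = q

section Homog

variable {N : Type*} [CommMonoid N] {δ : FreeMonoid Bool →* N} {f g : WordAlg k} {q r : N}

lemma exists_of_coeff_mul_ne_zero {w : FreeMonoid Bool} (h : (f * g).coeff w ≠ 0) :
    ∃ u v, f.coeff u ≠ 0 ∧ g.coeff v ≠ 0 ∧ u * v = w := by
  classical
  have := support_coeff_mul_subset f g (Finsupp.mem_support_iff.2 h)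
  rw [Finset.mem_mul] at this
  obtain ⟨u, hu, v, hv, rfl⟩ := this
  exact ⟨u, v, Finsupp.mem_support_iff.1 hu, Finsupp.mem_support_iff.1 hv, rfl⟩

lemma Homog.mul (hf : Homog δ f q) (hg : Homog δ g r) : Homog δ (f * g) (q * r) := by
  intro w hw
  obtain ⟨u, v, hu, hv, rfl⟩ := exists_of_coeff_mul_ne_zero hw
  rw [map_mul, hf u hu, hg v hv]

lemma Homog.single (w : FreeMonoid Bool) (c : k) : Homog δ (single w c) (δ w) := by
  classical
  intro u hu
  rw [coeff_single, Finsupp.single_apply] at hu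
  split_ifs at hu with h
  · rw [h]
  · exact absurd rfl hu

lemma Homog.one : Homog δ (1 : WordAlg k) 1 := by
  rw [one_def, ← map_one δ]
  exact Homog.single _ _

lemma Homog.sum {ι : Type*} (s : Finset ι) (F : ι → WordAlg k) (hF : ∀ i ∈ s, Homog δ (F i) q) :
    Homog δ (∑ i ∈ s, F i) q := by
  intro u hu
  rw [MonoidAlgebra.coeff_sum, Finsupp.finsetSum_apply] at hu
  obtain ⟨i, hi, h⟩ := Finset.exists_ne_zero_of_sum_ne_zero hu
  exact hF i hi u h

lemma Homog.sign_smul (hf : Homog δ f q) (ε : ℤˣ) : Homog δ (ε • f) q := by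
  intro u hu
  apply hf
  rcases Int.units_eq_one_or ε with rfl | rfl
  · simpa using hu
  · simpa using hu

lemma Homog.ofFn {m : ℕ} {F : Fin m → WordAlg k} {Q : Fin m → N} (h : ∀ i, Homog δ (F i) (Q i)) :
    Homog δ (List.ofFn F).prod (∏ i, Q i) := by
  induction m with
  | zero => simpa using Homog.one
  | succ m ih =>
    rw [List.ofFn_succ, List.prod_cons, Fin.prod_univ_succ]
    exact (h 0).mul (ih fun i => h _)

lemma Homog.stdPoly {m : ℕ} {F : Fin m → WordAlg k} {Q : Fin m → N}
    (h : ∀ i, Homog δ (F i) (Q i)) : Homog δ (stdPoly F) (∏ i, Q i) := by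
  refine Homog.sum _ _ fun σ _ => Homog.sign_smul ?_ _
  rw [← Equiv.prod_comp σ Q]
  exact Homog.ofFn fun i => h (σ i)

lemma Homog.seqProd {F : ℕ → WordAlg k} {Q : ℕ → N} (h : ∀ i, Homog δ (F i) (Q i)) (s l : ℕ) :
    Homog δ (seqProd F s l) (seqProd Q s l) := by
  induction l with
  | zero => exact Homog.one
  | succ l ih => exact ih.mul (h _)

end Homog

/-- Length of words as a homomorphism. -/
def lengthHom : FreeMonoid Bool →* Multiplicative ℕ where
  toFun u := Multiplicative.ofAdd u.length
  map_one' := rfl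
  map_mul' u v := by rw [length_mul, ofAdd_add]

lemma coeff_prod_ofFn {m : ℕ} {F : Fin m → WordAlg k} {W : Fin m → FreeMonoid Bool}
    (h : ∀ i, Homog lengthHom (F i) (lengthHom (W i))) :
    (List.ofFn F).prod.coeff (List.ofFn W).prod = ∏ i, (F i).coeff (W i) := by
  induction m with
  | zero => simp [one_def]
  | succ m ih =>
    rw [List.ofFn_succ, List.ofFn_succ, List.prod_cons, List.prod_cons, Fin.prod_univ_succ,
      coeff_mul_mul_of_length (h 0), ih fun i => h _]

lemma coeff_seqProd {F : ℕ → WordAlg k} {W : ℕ → FreeMonoid Bool} {s s' : ℕ}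
    (h : ∀ i, Homog lengthHom (F (s + i)) (lengthHom (W (s' + i)))) (l : ℕ) :
    (seqProd F s l).coeff (seqProd W s' l) =
      ∏ i ∈ Finset.range l, (F (s + i)).coeff (W (s' + i)) := by
  induction l with
  | zero => simp [seqProd, one_def]
  | succ l ih =>
    rw [seqProd, seqProd, coeff_mul_mul_of_length, ih, Finset.prod_range_succ]
    have h1 : Homog lengthHom (seqProd F s l) (lengthHom (seqProd W s' l)) := by
      rw [map_seqProd]
      have h2 := Homog.seqProd (k := k) (δ := lengthHom) (F := fun i => F (s + i)) h 0 l
      rw [seqProd_congr (B' := F) (s' := s) (by simp)] at h2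
      rwa [seqProd_congr (B' := fun i => lengthHom (W i)) (s' := s') (by simp)] at h2
    exact h1

lemma coeff_stdPoly {m : ℕ} {F : Fin m → WordAlg k} {W : Fin m → FreeMonoid Bool}
    (h : ∀ i j, Homog lengthHom (F i) (lengthHom (W j)))
    (hne : ∀ i j, i ≠ j → (F i).coeff (W j) = 0) :
    (stdPoly F).coeff (List.ofFn W).prod = ∏ i, (F i).coeff (W i) := by
  rw [stdPoly, MonoidAlgebra.coeff_sum, Finsupp.finsetSum_apply, Finset.sum_eq_single 1]
  · simp [coeff_prod_ofFn fun i => h i i]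
  · intro σ _ hσ
    obtain ⟨i, hi⟩ : ∃ i, σ i ≠ i := by
      by_contra! hh
      exact hσ (Equiv.ext hh)
    have : (List.ofFn fun i => F (σ i)).prod.coeff (List.ofFn W).prod = 0 := by
      rw [coeff_prod_ofFn fun i => h _ i]
      exact Finset.prod_eq_zero (Finset.mem_univ i) (hne _ _ hi)
    rcases Int.units_eq_one_or (Equiv.Perm.sign σ) with hs | hs
    · simpa [hs] using this
    · simpa [hs] using this
  · simp

/-- The substitution `true ↦ yx`, `false ↦ yyx`, where `x` is `true` and `y` is `false`. -/
def psi : FreeMonoid Bool →* FreeMonoid Bool :=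
  FreeMonoid.lift fun c => if c then of false * of true else of false * (of false * of true)

/-- The bidegree recording the lengths of a word and of its image under `psi`. -/
def wt : FreeMonoid Bool →* Multiplicative ℕ × Multiplicative ℕ :=
  lengthHom.prod (lengthHom.comp psi)

lemma Homog.lengthHom_of_wt {f : WordAlg k} {u : FreeMonoid Bool} (h : Homog wt f (wt u)) :
    Homog lengthHom f (lengthHom u) :=
  fun w hw => congrArg Prod.fst (h w hw)

lemma Homog.psi_of_wt {f : WordAlg k} {u : FreeMonoid Bool} (h : Homog wt f (wt u)) :
    ∀ w, f.coeff w ≠ 0 → (psi w).length = (psi u).length :=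
  fun w hw => congrArg Prod.snd (h w hw)

/-- Factors of the paperfolding word. -/
def paperWord : ℕ → ℕ → FreeMonoid Bool := seqProd fun i => of (fold i)

lemma length_paperWord (s l : ℕ) : (paperWord s l).length = l := by
  induction l with
  | zero => rfl
  | succ l ih => rw [paperWord, seqProd, length_mul, length_of, ← paperWord, ih]

lemma paperWord_add (s l l' : ℕ) :
    paperWord s (l + l') = paperWord s l * paperWord (s + l) l' := seqProd_add ..

lemma paperWord_block (n t : ℕ) :
    paperWord (2 ^ n * t) (2 ^ n) = of (fold t) * paperWord (2 ^ n * t + 1) (2 ^ n - 1) := by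
  have h : 2 ^ n = 1 + (2 ^ n - 1) := by have := Nat.one_le_two_pow (n := n); omega
  conv_lhs => rw [h, paperWord_add, ← h]
  rw [paperWord, seqProd_one, fold_two_pow_mul]

lemma seqProd_paperWord (n s l : ℕ) :
    seqProd (fun t => paperWord (2 ^ n * t) (2 ^ n)) s l = paperWord (2 ^ n * s) (2 ^ n * l) :=
  (seqProd_seqProd _ _ _ _).symm

/-- `f` is homogeneous of the same bidegree as `w`, and `w` occurs in `f`. -/
structure Adapted (f : WordAlg k) (w : FreeMonoid Bool) : Prop where
  homog : Homog wt f (wt w)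
  coeff_ne : f.coeff w ≠ 0

lemma Adapted.mul {f g : WordAlg k} {u v : FreeMonoid Bool} (hf : Adapted f u)
    (hg : Adapted g v) : Adapted (f * g) (u * v) where
  homog := by
    rw [map_mul]
    exact hf.homog.mul hg.homog
  coeff_ne := by
    rw [coeff_mul_mul_of_length hf.homog.lengthHom_of_wt]
    exact mul_ne_zero hf.coeff_ne hg.coeff_ne

lemma Adapted.single (w : FreeMonoid Bool) : Adapted (single w (1 : k)) w where
  homog := Homog.single _ _
  coeff_ne := by simp

lemma Adapted.one : Adapted (1 : WordAlg k) 1 := Adapted.single 1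

lemma Adapted.seqProd {F : ℕ → WordAlg k} {W : ℕ → FreeMonoid Bool}
    (h : ∀ i, Adapted (F i) (W i)) (s l : ℕ) : Adapted (seqProd F s l) (seqProd W s l) := by
  induction l with
  | zero => exact Adapted.one
  | succ l ih => exact ih.mul (h _)

lemma Adapted.stdPoly {m : ℕ} {F : Fin m → WordAlg k} {W : Fin m → FreeMonoid Bool}
    (h : ∀ i, Adapted (F i) (W i)) (hlen : ∀ i j, (W i).length = (W j).length)
    (hne : ∀ i j, i ≠ j → (F i).coeff (W j) = 0) : Adapted (stdPoly F) (List.ofFn W).prod where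
  homog := by
    rw [map_list_prod, List.map_ofFn, List.prod_ofFn]
    exact Homog.stdPoly fun i => (h i).homog
  coeff_ne := by
    rw [coeff_stdPoly _ hne]
    · exact Finset.prod_ne_zero_iff.2 fun i _ => (h i).coeff_ne
    · intro i j
      have : lengthHom (W j) = lengthHom (W i) := hlen j i
      rw [this]
      exact (h i).homog.lengthHom_of_wt

variable (k) in
/-- A family of elements adapted to the factors of length `2 ^ n - 1` of the paperfolding word
that start just after the multiples of `2 ^ n`. -/
structure Level where
  /-- The exponent of the block length. -/
  n : ℕ
  /-- The elements of the family. -/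
  Δ : ℕ → WordAlg k
  adapted : ∀ t, Adapted (Δ t) (paperWord (2 ^ n * t + 1) (2 ^ n - 1))

namespace Level

/-- The elements of a level preceded by the connecting letter. -/
noncomputable def block (L : Level k) (t : ℕ) : WordAlg k := single (of (fold t)) 1 * L.Δ t

lemma adapted_block (L : Level k) (t : ℕ) :
    Adapted (L.block t) (paperWord (2 ^ L.n * t) (2 ^ L.n)) := by
  rw [paperWord_block]
  exact (Adapted.single _).mul (L.adapted t)

lemma coeff_block_eq_zero (L : Level k) {t t' : ℕ} (h : fold t ≠ fold t') :
    (L.block t).coeff (paperWord (2 ^ L.n * t') (2 ^ L.n)) = 0 := by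
  rw [paperWord_block, block, ← mul_one (of (fold t)), coeff_single_cons_mul_cons, if_neg h]

/-- The length of the windows used for `m` arguments. -/
def windowLength (m : ℕ) : ℕ := 2 ^ (m + 2) + 1

/-- The number of foldings added by a step with `m` arguments. -/
def stepSize (m : ℕ) : ℕ := windowLength m * m + 1

lemma le_two_pow_stepSize (m : ℕ) : windowLength m * m + 1 ≤ 2 ^ stepSize m := by
  have := (Nat.lt_two_pow_self : stepSize m < 2 ^ stepSize m)
  rw [stepSize] at *
  omega

/-- The arguments of the standard polynomial. -/
noncomputable def window (L : Level k) (m s : ℕ) (i : Fin m) : WordAlg k :=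
  seqProd L.block (s + windowLength m * i) (windowLength m)

lemma adapted_stdPoly_window (L : Level k) (m s : ℕ) :
    Adapted (stdPoly (L.window m s))
      (paperWord (2 ^ L.n * s) (2 ^ L.n * (windowLength m * m))) := by
  rw [← seqProd_paperWord, ← prod_ofFn_seqProd]
  apply Adapted.stdPoly
  · intro i
    exact Adapted.seqProd (fun t => L.adapted_block t) _ _
  · intro i j
    rw [seqProd_paperWord, seqProd_paperWord, length_paperWord, length_paperWord]
  · intro i j hij
    rw [window, coeff_seqProd]
    · obtain ⟨o, ho, hoe⟩ : ∃ o < windowLength m, fold (s + windowLength m * i + o) ≠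
          fold (s + windowLength m * j + o) := by
        have hm : m < 2 ^ m := Nat.lt_two_pow_self
        rcases lt_or_gt_of_ne (Fin.val_ne_of_ne hij) with h | h
        · exact exists_fold_ne m s i j h (j.2.trans hm)
        · obtain ⟨o, ho, hoe⟩ := exists_fold_ne m s j i h (i.2.trans hm)
          exact ⟨o, ho, hoe.symm⟩
      exact Finset.prod_eq_zero (Finset.mem_range.2 ho) (L.coeff_block_eq_zero hoe)
    · intro l
      have h : ∀ t t', lengthHom (paperWord (2 ^ L.n * t) (2 ^ L.n)) =
          lengthHom (paperWord (2 ^ L.n * t') (2 ^ L.n)) := fun t t' =>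
        congrArg Multiplicative.ofAdd ((length_paperWord _ _).trans (length_paperWord _ _).symm)
      rw [h _ (s + windowLength m * i + l)]
      exact (L.adapted_block _).homog.lengthHom_of_wt

/-- The next level, whose elements are killed by small representations. -/
noncomputable def next (L : Level k) (m : ℕ) : Level k where
  n := L.n + stepSize m
  Δ t := L.Δ (2 ^ stepSize m * t) * stdPoly (L.window m (2 ^ stepSize m * t + 1)) *
    seqProd L.block (2 ^ stepSize m * t + 1 + windowLength m * m)
      (2 ^ stepSize m - 1 - windowLength m * m)
  adapted t := by
    have h1 := le_two_pow_stepSize m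
    have h2 := Nat.one_le_two_pow (n := L.n)
    have e : paperWord (2 ^ (L.n + stepSize m) * t + 1) (2 ^ (L.n + stepSize m) - 1) =
        paperWord (2 ^ L.n * (2 ^ stepSize m * t) + 1) (2 ^ L.n - 1) *
          paperWord (2 ^ L.n * (2 ^ stepSize m * t + 1)) (2 ^ L.n * (windowLength m * m)) *
          seqProd (fun t => paperWord (2 ^ L.n * t) (2 ^ L.n))
            (2 ^ stepSize m * t + 1 + windowLength m * m)
            (2 ^ stepSize m - 1 - windowLength m * m) := by
      obtain ⟨z, hz⟩ := Nat.exists_eq_add_of_le h1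
      obtain ⟨y, hy⟩ := Nat.exists_eq_add_of_le h2
      have e1 : 2 ^ stepSize m - 1 - windowLength m * m = z := by omega
      have e2 : 2 ^ L.n - 1 = y := by omega
      have e3 : 2 ^ (L.n + stepSize m) - 1 =
          y + 2 ^ L.n * (windowLength m * m) + 2 ^ L.n * z := by
        rw [pow_add]
        conv_lhs => rw [hz]
        rw [mul_add, mul_add]
        omega
      rw [seqProd_paperWord, e1, e2, e3, paperWord_add, paperWord_add]
      congr 2
      · congr 1; ring
      · congr 1; rw [pow_add]; rw [hy]; ring
      · rw [pow_add]; rw [hy]; ring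
    rw [e]
    exact ((L.adapted _).mul (L.adapted_stdPoly_window m _)).mul
      (Adapted.seqProd (fun t => L.adapted_block t) _ _)

lemma map_next_eq_zero (L : Level k) {m : ℕ} {K : Type*} [CommRing K] [IsDomain K] {Y : Type*}
    [Fintype Y] (φ : WordAlg k →+* Module.End K (Y → K))
    (hm : Fintype.card Y * Fintype.card Y < m) (t : ℕ) : φ ((L.next m).Δ t) = 0 := by
  rw [next, map_mul, map_mul, map_stdPoly, stdPoly_end_eq_zero hm, mul_zero, zero_mul]

/-- The algebra generated by the elements of a level preceded by a letter. -/
noncomputable def alg (L : Level k) : Subalgebra k (WordAlg k) :=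
  Algebra.adjoin k {η | ∃ c t, η = single (of c) 1 * L.Δ t}

lemma single_mul_mem_alg (L : Level k) (c : Bool) (t : ℕ) :
    single (of c) 1 * L.Δ t ∈ L.alg := Algebra.subset_adjoin ⟨c, t, rfl⟩

lemma seqProd_block_mem_alg (L : Level k) (s l : ℕ) : seqProd L.block s l ∈ L.alg :=
  seqProd_mem (P := L.alg.toSubmonoid) (fun i => L.single_mul_mem_alg _ i) s l

lemma alg_next_le (L : Level k) (m : ℕ) : (L.next m).alg ≤ L.alg := by
  refine Algebra.adjoin_le ?_
  rintro _ ⟨c, t, rfl⟩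
  rw [next, ← mul_assoc, ← mul_assoc]
  refine mul_mem (mul_mem (L.single_mul_mem_alg _ _) ?_) (L.seqProd_block_mem_alg _ _)
  refine sum_mem fun σ _ => ?_
  rw [Units.smul_def]
  refine zsmul_mem (list_prod_mem ?_) _
  intro η hη
  obtain ⟨i, rfl⟩ := (List.mem_ofFn' _ _).1 hη
  exact L.seqProd_block_mem_alg _ _

variable (k) in
/-- A sequence of levels killed by larger and larger representations. -/
noncomputable def seq : ℕ → Level k
  | 0 =>
    { n := 0
      Δ := fun _ => 1
      adapted := fun _ => by simpa [paperWord, seqProd] using Adapted.one }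
  | m + 1 => (seq m).next m

lemma n_seq_lt (m : ℕ) : (seq k m).n < (seq k (m + 1)).n := by
  change _ < (seq k m).n + stepSize m
  rw [stepSize]
  omega

lemma alg_seq_antitone : Antitone fun m => (seq k m).alg :=
  antitone_nat_of_succ_le fun m => alg_next_le (seq k m) m

end Level

/-- Deletion of an initial letter. -/
noncomputable def leftDelete (c : Bool) : WordAlg k →ₗ[k] WordAlg k :=
  (coeffLinearEquiv k).symm.toLinearMap ∘ₗ
    Finsupp.lcomapDomain (fun u => of c * u) (mul_right_injective (of c)) ∘ₗ
      (coeffLinearEquiv k).toLinearMap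

/-- Deletion of a final letter. -/
noncomputable def rightDelete (c : Bool) : WordAlg k →ₗ[k] WordAlg k :=
  (coeffLinearEquiv k).symm.toLinearMap ∘ₗ
    Finsupp.lcomapDomain (fun u => u * of c) (mul_left_injective (of c)) ∘ₗ
      (coeffLinearEquiv k).toLinearMap

@[simp] lemma coeff_leftDelete (c : Bool) (η : WordAlg k) (u : FreeMonoid Bool) :
    (leftDelete c η).coeff u = η.coeff (of c * u) := rfl

@[simp] lemma coeff_rightDelete (c : Bool) (η : WordAlg k) (u : FreeMonoid Bool) :
    (rightDelete c η).coeff u = η.coeff (u * of c) := rfl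

lemma eq_one_or_exists_mul_of (u : FreeMonoid Bool) : u = 1 ∨ ∃ v c, u = v * of c := by
  rcases List.eq_nil_or_concat (toList u) with h | ⟨v, c, h⟩
  · exact Or.inl h
  · exact Or.inr ⟨ofList v, c, by rw [List.concat_eq_append] at h; exact h⟩

lemma single_eq_smul (w : FreeMonoid Bool) (r : k) :
    (single w r : WordAlg k) = r • single w 1 := by simp

lemma coeff_single_of_length_lt {v w : FreeMonoid Bool} (h : v.length < w.length) (r : k) :
    (single w r).coeff v = 0 := by
  classical
  rw [coeff_single, Finsupp.single_apply, if_neg]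
  rintro rfl
  exact h.false

lemma leftDelete_one (c : Bool) : leftDelete c (1 : WordAlg k) = 0 := by
  classical
  ext u
  rw [coeff_leftDelete, one_def, coeff_single, Finsupp.single_apply, if_neg]
  · rfl
  · intro h
    have := congrArg FreeMonoid.length h
    rw [length_one, length_mul, length_of] at this
    omega

lemma rightDelete_one (c : Bool) : rightDelete c (1 : WordAlg k) = 0 := by
  classical
  ext u
  rw [coeff_rightDelete, one_def, coeff_single, Finsupp.single_apply, if_neg]
  · rfl
  · intro h
    have := congrArg FreeMonoid.length h
    rw [length_one, length_mul, length_of] at this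
    omega

lemma leftDelete_single_cons_mul (c c' : Bool) (w : FreeMonoid Bool) (θ : WordAlg k) :
    leftDelete c (single (of c' * w) 1 * θ) = if c' = c then single w 1 * θ else 0 := by
  ext u
  rw [coeff_leftDelete, coeff_single_cons_mul_cons]
  split_ifs <;> rfl

lemma rightDelete_mul_single (c c' : Bool) (w : FreeMonoid Bool) (η : WordAlg k) :
    rightDelete c (η * single (w * of c') 1) = if c' = c then η * single w 1 else 0 := by
  ext u
  have h : single (w * of c') (1 : k) = single w 1 * single (of c') 1 := by
    rw [single_mul_single, one_mul]
  rw [coeff_rightDelete, h, ← mul_assoc]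
  split_ifs with hc
  · rw [hc, coeff_mul_single_mul, mul_one]
  · apply coeff_mul_single_of_forall_mul_ne
    intro d hd
    have := congrArg (fun l => (FreeMonoid.toList l).getLast?) hd
    simp at this
    exact hc this

lemma leftDelete_mul (c : Bool) (η θ : WordAlg k) :
    leftDelete c (η * θ) = leftDelete c η * θ + η.coeff 1 • leftDelete c θ := by
  induction η using MonoidAlgebra.induction_linear with
  | zero => simp
  | add η η' h h' =>
    rw [add_mul, map_add, h, h', map_add, coeff_add, Finsupp.add_apply, add_mul, add_smul]
    abel
  | single w r =>
    rw [single_eq_smul, smul_mul_assoc, map_smul, map_smul, smul_mul_assoc, coeff_smul_apply,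
      smul_assoc, ← smul_add]
    congr 1
    cases w with
    | one => rw [← one_def, one_mul, leftDelete_one, one_def]; simp
    | of_mul c' w =>
      have h := leftDelete_single_cons_mul c c' w (1 : WordAlg k)
      rw [mul_one, mul_one] at h
      rw [coeff_single_of_length_lt (by simp), h, leftDelete_single_cons_mul]
      split_ifs <;> simp

lemma rightDelete_mul (c : Bool) (η θ : WordAlg k) :
    rightDelete c (η * θ) = η * rightDelete c θ + θ.coeff 1 • rightDelete c η := by
  induction θ using MonoidAlgebra.induction_linear with
  | zero => simp
  | add θ θ' h h' =>
    rw [mul_add, map_add, h, h', map_add, coeff_add, Finsupp.add_apply, mul_add, add_smul]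
    abel
  | single w r =>
    rw [single_eq_smul, mul_smul_comm, map_smul, map_smul, mul_smul_comm, coeff_smul_apply,
      smul_assoc, ← smul_add]
    congr 1
    rcases eq_one_or_exists_mul_of w with rfl | ⟨w, c', rfl⟩
    · rw [← one_def, mul_one, rightDelete_one, one_def]; simp
    · have h := rightDelete_mul_single c c' w (1 : WordAlg k)
      rw [one_mul, one_mul] at h
      rw [coeff_single_of_length_lt (by simp), h, rightDelete_mul_single]
      split_ifs <;> simp

lemma pair_leftDelete (c : Bool) (η a : WordAlg k) :
    pair (leftDelete c η) a = pair η (single (of c) 1 * a) := by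
  induction η using MonoidAlgebra.induction_linear with
  | zero => simp
  | add η η' h h' => simp [h, h']
  | single w r =>
    rw [single_eq_smul, map_smul, map_smul, map_smul, LinearMap.smul_apply, LinearMap.smul_apply]
    congr 1
    cases w with
    | one =>
      have h := coeff_single_cons_mul_one c 1 a
      rw [mul_one] at h
      rw [pair_single, h, ← one_def, leftDelete_one]
      simp
    | of_mul c' w =>
      have h := leftDelete_single_cons_mul c c' w (1 : WordAlg k)
      have h' := coeff_single_cons_mul_cons c' c 1 w a
      rw [mul_one, mul_one] at h
      rw [mul_one, ← one_def, one_mul] at h'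
      rw [h, pair_single, h']
      simp only [eq_comm (a := c)]
      split_ifs
      · rw [pair_single]
      · simp

lemma pair_rightDelete (c : Bool) (η a : WordAlg k) :
    pair (rightDelete c η) a = pair η (a * single (of c) 1) := by
  induction η using MonoidAlgebra.induction_linear with
  | zero => simp
  | add η η' h h' => simp [h, h']
  | single w r =>
    rw [single_eq_smul, map_smul, map_smul, map_smul, LinearMap.smul_apply, LinearMap.smul_apply]
    congr 1
    rcases eq_one_or_exists_mul_of w with rfl | ⟨w, c', rfl⟩
    · rw [pair_single, ← one_def, rightDelete_one, coeff_mul_single_of_forall_mul_ne]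
      · simp
      · intro d h
        have := congrArg FreeMonoid.length h
        rw [length_one, length_mul, length_of] at this
        omega
    · have h := rightDelete_mul_single c c' w (1 : WordAlg k)
      have h' := congrArg (fun b => b.coeff w) (rightDelete_mul_single c' c 1 a)
      rw [one_mul, one_mul] at h
      rw [one_mul, coeff_rightDelete] at h'
      rw [h, pair_single, h', ← one_def, mul_one]
      simp only [eq_comm (a := c)]
      split_ifs
      · rw [pair_single]
      · simp

lemma exists_pair_mul_left {V : Submodule k (WordAlg k)}
    (hV : ∀ c, ∀ η ∈ V, leftDelete c η ∈ V) (b : WordAlg k) :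
    ∀ η ∈ V, ∃ θ ∈ V, ∀ a, pair η (b * a) = pair θ a := by
  induction b using MonoidAlgebra.induction_linear with
  | zero => exact fun η _ => ⟨0, V.zero_mem, by simp⟩
  | add b b' h h' =>
    intro η hη
    obtain ⟨θ, hθ, e⟩ := h η hη
    obtain ⟨θ', hθ', e'⟩ := h' η hη
    exact ⟨θ + θ', V.add_mem hθ hθ', fun a => by rw [add_mul, map_add, e, e', map_add]; rfl⟩
  | single w r =>
    intro η hη
    suffices h : ∃ θ ∈ V, ∀ a, pair η (single w 1 * a) = pair θ a by
      obtain ⟨θ, hθ, e⟩ := h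
      refine ⟨r • θ, V.smul_mem r hθ, fun a => ?_⟩
      rw [single_eq_smul, smul_mul_assoc, map_smul, e, map_smul, LinearMap.smul_apply]
    induction w using FreeMonoid.inductionOn' generalizing η with
    | one => exact ⟨η, hη, fun a => by rw [← one_def, one_mul]⟩
    | of_mul c w ih =>
      obtain ⟨θ, hθ, e⟩ := ih _ (hV c η hη)
      refine ⟨θ, hθ, fun a => ?_⟩
      rw [← e, pair_leftDelete, ← mul_assoc, single_mul_single, one_mul]

lemma exists_pair_mul_right {V : Submodule k (WordAlg k)}
    (hV : ∀ c, ∀ η ∈ V, rightDelete c η ∈ V) (b : WordAlg k) :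
    ∀ η ∈ V, ∃ θ ∈ V, ∀ a, pair η (a * b) = pair θ a := by
  induction b using MonoidAlgebra.induction_linear with
  | zero => exact fun η _ => ⟨0, V.zero_mem, by simp⟩
  | add b b' h h' =>
    intro η hη
    obtain ⟨θ, hθ, e⟩ := h η hη
    obtain ⟨θ', hθ', e'⟩ := h' η hη
    exact ⟨θ + θ', V.add_mem hθ hθ', fun a => by rw [mul_add, map_add, e, e', map_add]; rfl⟩
  | single w r =>
    intro η hη
    suffices h : ∃ θ ∈ V, ∀ a, pair η (a * single w 1) = pair θ a by
      obtain ⟨θ, hθ, e⟩ := h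
      refine ⟨r • θ, V.smul_mem r hθ, fun a => ?_⟩
      rw [single_eq_smul, mul_smul_comm, map_smul, e, map_smul, LinearMap.smul_apply]
    induction w using FreeMonoid.inductionOn' generalizing η with
    | one => exact ⟨η, hη, fun a => by rw [← one_def, mul_one]⟩
    | of_mul c w ih =>
      obtain ⟨θ, hθ, e⟩ := ih _ hη
      refine ⟨rightDelete c θ, hV c θ hθ, fun a => ?_⟩
      rw [pair_rightDelete, ← e, mul_assoc, single_mul_single, one_mul]

variable (k) in
/-- The span of the words of length at most `L`. -/
def shortWords (L : ℕ) : Submodule k (WordAlg k) where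
  carrier := {η | ∀ u, η.coeff u ≠ 0 → u.length ≤ L}
  zero_mem' := fun u hu => absurd rfl hu
  add_mem' := fun {η θ} hη hθ u hu => by
    by_cases h : η.coeff u = 0
    · refine hθ u fun h' => hu ?_
      rw [coeff_add, Finsupp.add_apply, h, h', add_zero]
    · exact hη u h
  smul_mem' := fun c η hη u hu => hη u fun h => hu (by rw [coeff_smul_apply, h, smul_zero])

lemma leftDelete_mem_shortWords {L : ℕ} (c : Bool) {η : WordAlg k} (hη : η ∈ shortWords k L) :
    leftDelete c η ∈ shortWords k L := fun u hu => by
  have := hη _ hu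
  rw [length_mul] at this
  omega

lemma rightDelete_mem_shortWords {L : ℕ} (c : Bool) {η : WordAlg k} (hη : η ∈ shortWords k L) :
    rightDelete c η ∈ shortWords k L := fun u hu => by
  have := hη _ hu
  rw [length_mul] at this
  omega

lemma one_mem_shortWords (L : ℕ) : (1 : WordAlg k) ∈ shortWords k L := by
  intro u hu
  by_contra! h
  apply hu
  classical
  rw [one_def, coeff_single, Finsupp.single_apply, if_neg]
  rintro rfl
  simp at h

lemma mul_mem_shortWords {L L' : ℕ} {η θ : WordAlg k} (hη : η ∈ shortWords k L)
    (hθ : θ ∈ shortWords k L') : η * θ ∈ shortWords k (L + L') := by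
  intro w hw
  obtain ⟨u, v, hu, hv, rfl⟩ := exists_of_coeff_mul_ne_zero hw
  rw [length_mul]
  exact add_le_add (hη u hu) (hθ v hv)

lemma length_ge_of_coeff_pow_ne_zero {f : WordAlg k} (hf : f.coeff 1 = 0) {N : ℕ} :
    ∀ {u}, (f ^ N).coeff u ≠ 0 → N ≤ u.length := by
  induction N with
  | zero => simp
  | succ N ih =>
    intro w hw
    rw [pow_succ] at hw
    obtain ⟨u, v, hu, hv, rfl⟩ := exists_of_coeff_mul_ne_zero hw
    have h1 := ih hu
    have h2 : v.length ≠ 0 := fun h => hv (by rw [length_eq_zero.1 h, hf])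
    rw [length_mul]
    omega

section Adjoin

variable {𝒢 : Set (WordAlg k)} {L : ℕ}

/-- The products of an element of the algebra generated by `𝒢` with short words on both sides. -/
noncomputable def wings (𝒢 : Set (WordAlg k)) (L : ℕ) : Submodule k (WordAlg k) :=
  shortWords k L * Subalgebra.toSubmodule (Algebra.adjoin k 𝒢) * shortWords k L

lemma mul_mul_mem_wings {η G θ : WordAlg k} (hη : η ∈ shortWords k L)
    (hG : G ∈ Algebra.adjoin k 𝒢) (hθ : θ ∈ shortWords k L) : η * G * θ ∈ wings 𝒢 L :=
  Submodule.mul_mem_mul (Submodule.mul_mem_mul hη hG) hθ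

lemma leftDelete_mem_mul (h𝒢 : 𝒢 ⊆ shortWords k L)
    {G : WordAlg k} (hG : G ∈ Algebra.adjoin k 𝒢) (c : Bool) :
    leftDelete c G ∈ shortWords k L * Subalgebra.toSubmodule (Algebra.adjoin k 𝒢) := by
  induction hG using Algebra.adjoin_induction with
  | mem g hg =>
    rw [← mul_one (leftDelete c g)]
    exact Submodule.mul_mem_mul (leftDelete_mem_shortWords c (h𝒢 hg))
      (one_mem (Algebra.adjoin k 𝒢))
  | algebraMap r =>
    rw [Algebra.algebraMap_eq_smul_one, map_smul, leftDelete_one, smul_zero]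
    exact zero_mem _
  | add x y _ _ hx hy =>
    rw [map_add]
    exact add_mem hx hy
  | mul x y _ hy hx' hy' =>
    rw [leftDelete_mul]
    refine add_mem ?_ (Submodule.smul_mem _ _ hy')
    have := Submodule.mul_mem_mul hx' (show y ∈ Subalgebra.toSubmodule (Algebra.adjoin k 𝒢) from hy)
    rwa [mul_assoc, Subalgebra.isIdempotentElem_toSubmodule] at this

lemma rightDelete_mem_mul (h𝒢 : 𝒢 ⊆ shortWords k L)
    {G : WordAlg k} (hG : G ∈ Algebra.adjoin k 𝒢) (c : Bool) :
    rightDelete c G ∈ Subalgebra.toSubmodule (Algebra.adjoin k 𝒢) * shortWords k L := by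
  induction hG using Algebra.adjoin_induction with
  | mem g hg =>
    rw [← one_mul (rightDelete c g)]
    exact Submodule.mul_mem_mul (one_mem (Algebra.adjoin k 𝒢))
      (rightDelete_mem_shortWords c (h𝒢 hg))
  | algebraMap r =>
    rw [Algebra.algebraMap_eq_smul_one, map_smul, rightDelete_one, smul_zero]
    exact zero_mem _
  | add x y _ _ hx hy =>
    rw [map_add]
    exact add_mem hx hy
  | mul x y hx _ hx' hy' =>
    rw [rightDelete_mul]
    refine add_mem ?_ (Submodule.smul_mem _ _ hx')
    have := Submodule.mul_mem_mul (show x ∈ Subalgebra.toSubmodule (Algebra.adjoin k 𝒢) from hx) hy'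
    rwa [← mul_assoc, Subalgebra.isIdempotentElem_toSubmodule] at this

lemma leftDelete_mem_wings (h𝒢 : 𝒢 ⊆ shortWords k L) (c : Bool) :
    ∀ η ∈ wings 𝒢 L, leftDelete c η ∈ wings 𝒢 L := by
  intro η hη
  rw [wings, mul_assoc] at hη
  refine Submodule.mul_induction_on hη (fun v hv x hx => ?_) fun x y hx hy => ?_
  · refine Submodule.mul_induction_on hx (fun G hG w hw => ?_) fun x y hx hy => ?_
    · rw [leftDelete_mul, leftDelete_mul]
      refine add_mem ?_ (Submodule.smul_mem _ _ (add_mem ?_ (Submodule.smul_mem _ _ ?_)))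
      · rw [← mul_assoc]
        exact mul_mul_mem_wings (leftDelete_mem_shortWords c hv) hG hw
      · exact Submodule.mul_mem_mul (leftDelete_mem_mul h𝒢 hG c) hw
      · rw [← one_mul (leftDelete c w), ← one_mul (1 : WordAlg k)]
        exact mul_mul_mem_wings (one_mem_shortWords L) (one_mem _) (leftDelete_mem_shortWords c hw)
    · rw [mul_add, map_add]
      exact add_mem hx hy
  · rw [map_add]
    exact add_mem hx hy

lemma rightDelete_mem_wings (h𝒢 : 𝒢 ⊆ shortWords k L) (c : Bool) :
    ∀ η ∈ wings 𝒢 L, rightDelete c η ∈ wings 𝒢 L := by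
  intro η hη
  refine Submodule.mul_induction_on hη (fun x hx w hw => ?_) fun x y hx hy => ?_
  · refine Submodule.mul_induction_on hx (fun v hv G hG => ?_) fun x y hx hy => ?_
    · rw [rightDelete_mul, rightDelete_mul]
      refine add_mem ?_ (Submodule.smul_mem _ _ (add_mem ?_ (Submodule.smul_mem _ _ ?_)))
      · exact mul_mul_mem_wings hv hG (rightDelete_mem_shortWords c hw)
      · rw [wings, mul_assoc]
        exact Submodule.mul_mem_mul hv (rightDelete_mem_mul h𝒢 hG c)
      · rw [← mul_one (rightDelete c v), ← mul_one (rightDelete c v * 1)]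
        exact mul_mul_mem_wings (rightDelete_mem_shortWords c hv) (one_mem _)
          (one_mem_shortWords L)
    · rw [add_mul, map_add]
      exact add_mem hx hy
  · rw [map_add]
    exact add_mem hx hy

lemma pair_eq_zero_of_length {η a : WordAlg k} {L : ℕ} (hη : η ∈ shortWords k L)
    (ha : ∀ u, a.coeff u ≠ 0 → L < u.length) : pair η a = 0 := by
  rw [pair_eq_sum, Finset.sum_eq_zero]
  intro u hu
  by_cases h : a.coeff u = 0
  · rw [h, mul_zero]
  · have h1 := hη u (Finsupp.mem_support_iff.1 hu)
    have h2 := ha u h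
    omega

lemma pair_pow_eq_zero_of_mem_wings {f : WordAlg k} (hf : f.coeff 1 = 0) {d : ℕ}
    (hd : ∀ u, f.coeff u ≠ 0 → u.length ≤ d) (h0 : 0 < d) (h : ∀ g ∈ 𝒢, recognizer f d g = 0)
    {N : ℕ} (hN : L + L < N) {η : WordAlg k} (hη : η ∈ wings 𝒢 L) : pair η (f ^ N) = 0 := by
  have hadj : ∀ G ∈ Algebra.adjoin k 𝒢, ∃ r : k,
      recognizer f d G = algebraMap k _ r := by
    intro G hG
    induction hG using Algebra.adjoin_induction with
    | mem g hg => exact ⟨0, by rw [h g hg, map_zero]⟩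
    | algebraMap r => exact ⟨r, AlgHom.commutes _ r⟩
    | add x y _ _ hx hy =>
      obtain ⟨r, hr⟩ := hx
      obtain ⟨s, hs⟩ := hy
      exact ⟨r + s, by rw [map_add, map_add, hr, hs]⟩
    | mul x y _ _ hx hy =>
      obtain ⟨r, hr⟩ := hx
      obtain ⟨s, hs⟩ := hy
      exact ⟨r * s, by rw [map_mul, map_mul, hr, hs]⟩
  refine Submodule.mul_induction_on hη (fun x hx w hw => ?_) fun x y hx hy => ?_
  · refine Submodule.mul_induction_on hx (fun v hv G hG => ?_) fun x y hx hy => ?_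
    · obtain ⟨r, hr⟩ := hadj G hG
      have e : v * G * w = v * (G - algebraMap k _ r) * w + r • (v * w) := by
        rw [mul_sub, sub_mul, Algebra.algebraMap_eq_smul_one, mul_smul_comm, smul_mul_assoc,
          mul_one, sub_add_cancel]
      have e0 : recognizer f d (v * (G - algebraMap k _ r) * w) = 0 := by
        rw [map_mul, map_mul, map_sub, hr, AlgHom.commutes, sub_self, mul_zero, zero_mul]
      rw [e, map_add, LinearMap.add_apply, pair_pow_eq_coeff_recognizer f hf d hd h0, e0,
        map_smul, LinearMap.smul_apply, pair_eq_zero_of_length (mul_mem_shortWords hv hw)]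
      · simp
      · exact fun u hu => hN.trans_le (length_ge_of_coeff_pow_ne_zero hf hu)
    · rw [add_mul, map_add, LinearMap.add_apply, hx, hy, add_zero]
  · rw [map_add, LinearMap.add_apply, hx, hy, add_zero]

/-- Elements generated by short elements invisible to the recognizer of `f` are orthogonal to the
ideal generated by a high power of `f`. -/
lemma pair_mul_pow_mul_eq_zero (h𝒢 : 𝒢 ⊆ shortWords k L)
    {f : WordAlg k} (hf : f.coeff 1 = 0) {d : ℕ}
    (hd : ∀ u, f.coeff u ≠ 0 → u.length ≤ d) (h0 : 0 < d) (h : ∀ g ∈ 𝒢, recognizer f d g = 0)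
    {N : ℕ} (hN : L + L < N) {η : WordAlg k} (hη : η ∈ Algebra.adjoin k 𝒢) (b c : WordAlg k) :
    pair η (b * f ^ N * c) = 0 := by
  have hη' : η ∈ wings 𝒢 L := by
    rw [← one_mul η, ← mul_one (1 * η)]
    exact mul_mul_mem_wings (one_mem_shortWords L) hη (one_mem_shortWords L)
  obtain ⟨θ, hθ, e⟩ := exists_pair_mul_left (leftDelete_mem_wings h𝒢) b η hη'
  obtain ⟨ζ, hζ, e'⟩ := exists_pair_mul_right (rightDelete_mem_wings h𝒢) c θ hθ
  rw [mul_assoc, e, e']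
  exact pair_pow_eq_zero_of_mem_wings hf hd h0 h hN hζ

end Adjoin

lemma psi_of (c : Bool) :
    psi (of c) = if c then of false * of true else of false * (of false * of true) := rfl

lemma psi_injective : Function.Injective psi := by
  intro u
  induction u using FreeMonoid.inductionOn' with
  | one =>
    intro v h
    cases v with
    | one => rfl
    | of_mul c v =>
      have := congrArg FreeMonoid.length h
      rw [map_one, length_one, map_mul, psi_of, length_mul] at this
      cases c <;> simp at this <;> omega
  | of_mul c u ih =>
    intro v h
    cases v with
    | one =>
      have := congrArg FreeMonoid.length h
      rw [map_one, length_one, map_mul, psi_of, length_mul] at this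
      cases c <;> simp at this
    | of_mul c' v =>
      rw [map_mul, map_mul, psi_of, psi_of] at h
      have h' := congrArg FreeMonoid.toList h
      cases c <;> cases c' <;> simp at h'
      · rw [ih h']
      · rw [ih h']

lemma length_psi_le (u : FreeMonoid Bool) : (psi u).length ≤ 3 * u.length := by
  induction u using FreeMonoid.inductionOn' with
  | one => simp
  | of_mul c u ih =>
    rw [map_mul, length_mul, length_mul, psi_of]
    cases c <;> simp <;> omega

variable (k) in
/-- The endomorphism of the free algebra extending `psi`. -/
noncomputable def psiAlg : WordAlg k →ₐ[k] WordAlg k := mapDomainAlgHom k k psi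

lemma coeff_psiAlg (f : WordAlg k) (u : FreeMonoid Bool) :
    (psiAlg k f).coeff (psi u) = f.coeff u :=
  Finsupp.mapDomain_apply psi_injective f.coeff u

lemma exists_of_coeff_psiAlg_ne_zero {f : WordAlg k} {w : FreeMonoid Bool}
    (h : (psiAlg k f).coeff w ≠ 0) : ∃ u, f.coeff u ≠ 0 ∧ psi u = w := by
  classical
  obtain ⟨u, hu, e⟩ := Finset.mem_image.1
    (Finsupp.mapDomain_support (f := psi) (s := f.coeff) (Finsupp.mem_support_iff.2 h))
  exact ⟨u, Finsupp.mem_support_iff.1 hu, e⟩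

variable (k) in
/-- The functionals defining the algebra. -/
noncomputable def xi (s : ℕ) : WordAlg k := psiAlg k (single (of true) 1 * (Level.seq k s).Δ 0)

variable (k) in
/-- The generators of the algebras containing all but finitely many of the functionals. -/
def gens (s : ℕ) : Set (WordAlg k) :=
  psiAlg k '' {η | ∃ c t, η = single (of c) 1 * (Level.seq k s).Δ t}

lemma xi_mem_adjoin {s s' : ℕ} (h : s ≤ s') : xi k s' ∈ Algebra.adjoin k (gens k s) := by
  rw [gens, ← AlgHom.map_adjoin]
  exact ⟨_, Level.alg_seq_antitone h (Level.single_mul_mem_alg _ true 0), rfl⟩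

lemma exists_shortWords (η : WordAlg k) : ∃ L, η ∈ shortWords k L :=
  ⟨η.coeff.support.sup FreeMonoid.length, fun _ hu => Finset.le_sup (Finsupp.mem_support_iff.2 hu)⟩

lemma gens_subset_shortWords (s : ℕ) :
    gens k s ⊆ shortWords k (3 * 2 ^ (Level.seq k s).n) := by
  rintro _ ⟨_, ⟨c, t, rfl⟩, rfl⟩ w hw
  obtain ⟨u, hu, rfl⟩ := exists_of_coeff_psiAlg_ne_zero hw
  refine (length_psi_le u).trans (Nat.mul_le_mul_left 3 ?_)
  have h := ((Adapted.single (of c)).mul ((Level.seq k s).adapted t)).homog.lengthHom_of_wt u hu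
  have h' : u.length = (of c * paperWord (2 ^ (Level.seq k s).n * t + 1)
      (2 ^ (Level.seq k s).n - 1)).length := h
  have := Nat.one_le_two_pow (n := (Level.seq k s).n)
  rw [h', length_mul, length_of, length_paperWord]
  omega

lemma recognizer_eq_zero_of_mem_gens {f : WordAlg k} {d s : ℕ}
    (hs : Fintype.card (ShortWord d) * Fintype.card (ShortWord d) < s) :
    ∀ g ∈ gens k (s + 1), recognizer f d g = 0 := by
  rintro _ ⟨_, ⟨c, t, rfl⟩, rfl⟩
  have h := Level.map_next_eq_zero (Level.seq k s)
    ((recognizer f d).comp (psiAlg k)).toRingHom hs t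
  have h' : recognizer f d (psiAlg k ((Level.seq k (s + 1)).Δ t)) = 0 := h
  rw [map_mul, map_mul, h', mul_zero]

lemma exists_pair_xi_eq_zero {f : WordAlg k} (hf : f.coeff 1 = 0) :
    ∃ N, ∀ s b c, pair (xi k s) (b * f ^ N * c) = 0 := by
  obtain ⟨d, hd⟩ := exists_shortWords f
  set e := d + 1
  set s₀ := Fintype.card (ShortWord e) * Fintype.card (ShortWord e) + 1
  choose L hL using fun s => exists_shortWords (xi k s)
  set N₁ := 3 * 2 ^ (Level.seq k (s₀ + 1)).n with hN₁
  set N₂ := (Finset.range (s₀ + 1)).sup L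
  refine ⟨N₁ + N₁ + N₂ + 1, fun s b c => ?_⟩
  by_cases hs : s < s₀ + 1
  · refine pair_eq_zero_of_length (hL s) fun w hw => ?_
    obtain ⟨w', w₃, hw', h3, rfl⟩ := exists_of_coeff_mul_ne_zero hw
    obtain ⟨w₁, w₂, h1, h2, rfl⟩ := exists_of_coeff_mul_ne_zero hw'
    have h4 := length_ge_of_coeff_pow_ne_zero hf h2
    have h5 : L s ≤ N₂ := Finset.le_sup (Finset.mem_range.2 hs)
    rw [length_mul, length_mul]
    omega
  · exact pair_mul_pow_mul_eq_zero (gens_subset_shortWords (s₀ + 1)) hf (d := e)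
      (fun u hu => (hd u hu).trans (Nat.le_succ d)) (Nat.succ_pos d)
      (recognizer_eq_zero_of_mem_gens (Nat.lt_succ_self _)) (by omega)
      (xi_mem_adjoin (not_lt.1 hs)) b c

variable (k) in
/-- The elements all of whose left multiples are orthogonal to the functionals. -/
noncomputable def annihilated : Submodule (WordAlg k) (WordAlg k) where
  carrier := {a | ∀ s b, pair (xi k s) (b * a) = 0}
  zero_mem' := by simp
  add_mem' := fun {a a'} h h' s b => by rw [mul_add, map_add, h, h', add_zero]
  smul_mem' := fun c a h s b => by rw [smul_eq_mul, ← mul_assoc, h]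

variable (k) in
/-- The representation of the free algebra on the quotient by `annihilated`. -/
noncomputable def rho : WordAlg k →ₐ[k] Module.End k (WordAlg k ⧸ annihilated k) :=
  Algebra.lsmul k k (WordAlg k ⧸ annihilated k)

lemma rho_apply_mk (a c : WordAlg k) :
    rho k a (Submodule.Quotient.mk c) = Submodule.Quotient.mk (a * c) := by
  rw [rho, Algebra.lsmul_coe]
  exact (Submodule.Quotient.mk_smul (annihilated k) a c).symm

lemma mk_annihilated_eq_zero_iff {a : WordAlg k} :
    (Submodule.Quotient.mk a : WordAlg k ⧸ annihilated k) = 0 ↔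
      ∀ s b, pair (xi k s) (b * a) = 0 :=
  Submodule.Quotient.mk_eq_zero _

lemma rho_eq_zero_iff {a : WordAlg k} :
    rho k a = 0 ↔ ∀ s b c, pair (xi k s) (b * a * c) = 0 := by
  constructor
  · intro h s b c
    have h1 := rho_apply_mk a c
    rw [h, LinearMap.zero_apply] at h1
    rw [mul_assoc]
    exact mk_annihilated_eq_zero_iff.1 h1.symm s b
  · intro h
    refine LinearMap.ext fun c => ?_
    obtain ⟨c, rfl⟩ := Submodule.Quotient.mk_surjective _ c
    rw [rho_apply_mk, LinearMap.zero_apply, mk_annihilated_eq_zero_iff]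
    intro s b
    rw [← mul_assoc, h]

lemma exists_rho_pow_eq_zero {f : WordAlg k} (hf : f.coeff 1 = 0) : ∃ N, rho k f ^ N = 0 := by
  obtain ⟨N, hN⟩ := exists_pair_xi_eq_zero hf
  exact ⟨N, by rw [← map_pow, rho_eq_zero_iff]; exact hN⟩

lemma toList_psi_of_mul (c : Bool) (u : FreeMonoid Bool) :
    toList (psi (of c * u)) =
      if c then false :: true :: toList (psi u) else false :: false :: true :: toList (psi u) := by
  rw [map_mul, psi_of]
  cases c <;> simp

lemma psi_avoids_true_true (u : FreeMonoid Bool) :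
    ¬ [true, true] <:+: true :: toList (psi u) := by
  induction u using FreeMonoid.inductionOn' with
  | one => decide
  | of_mul c u ih =>
    rw [toList_psi_of_mul]
    cases c <;> simpa [List.infix_cons_iff, List.cons_prefix_cons] using ih

lemma psi_avoids_false_false_false (u : FreeMonoid Bool) :
    ¬ [false, false, false] <:+: toList (psi u) := by
  induction u using FreeMonoid.inductionOn' with
  | one => decide
  | of_mul c u ih =>
    rw [toList_psi_of_mul]
    cases c <;> simpa [List.infix_cons_iff, List.cons_prefix_cons] using ih

lemma rho_single_eq_zero {v : FreeMonoid Bool} (hv : ∀ u, ¬ toList v <:+: toList (psi u)) :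
    rho k (single v 1) = 0 := by
  rw [rho_eq_zero_iff]
  intro s b c
  rw [pair_eq_sum]
  refine Finset.sum_eq_zero fun w hw => mul_eq_zero_of_right _ ?_
  by_contra h
  obtain ⟨u, -, rfl⟩ := exists_of_coeff_psiAlg_ne_zero (Finsupp.mem_support_iff.1 hw)
  obtain ⟨w', w₃, hw', -, e⟩ := exists_of_coeff_mul_ne_zero h
  obtain ⟨w₁, w₂, -, h2, rfl⟩ := exists_of_coeff_mul_ne_zero hw'
  obtain rfl : v = w₂ := by
    by_contra h'
    exact h2 (by rw [coeff_single, Finsupp.single_eq_of_ne (Ne.symm h')])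
  exact hv u ⟨toList w₁, toList w₃, by rw [← e, toList_mul, toList_mul]⟩

variable (k) in
/-- The image of a letter in the representation. -/
noncomputable def letter (c : Bool) : Module.End k (WordAlg k ⧸ annihilated k) :=
  rho k (single (of c) 1)

lemma letter_true_sq : letter k true ^ 2 = 0 := by
  rw [letter, ← map_pow, single_pow, one_pow]
  refine rho_single_eq_zero fun u h => psi_avoids_true_true u ?_
  exact h.trans (List.suffix_cons _ _).isInfix

lemma letter_false_cube : letter k false ^ 3 = 0 := by
  rw [letter, ← map_pow, single_pow, one_pow]
  exact rho_single_eq_zero psi_avoids_false_false_false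

/-- `u` is the only longest word of `f`. -/
def Leading (f : WordAlg k) (u : FreeMonoid Bool) : Prop :=
  ∃ c ≠ 0, ∃ L, L + 1 = u.length ∧ f - single u c ∈ shortWords k L

lemma shortWords_mono {L L' : ℕ} (h : L ≤ L') : shortWords k L ≤ shortWords k L' :=
  fun _ hη u hu => (hη u hu).trans h

lemma single_mem_shortWords {L : ℕ} {u : FreeMonoid Bool} (h : u.length ≤ L) (c : k) :
    single u c ∈ shortWords k L := by
  intro v hv
  obtain rfl : u = v := by
    by_contra h'
    exact hv (by rw [coeff_single, Finsupp.single_eq_of_ne (Ne.symm h')])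
  exact h

lemma Leading.mul {f g : WordAlg k} {u v : FreeMonoid Bool} (hf : Leading f u)
    (hg : Leading g v) : Leading (f * g) (u * v) := by
  obtain ⟨c, hc, L, hL, hf⟩ := hf
  obtain ⟨d, hd, M, hM, hg⟩ := hg
  refine ⟨c * d, mul_ne_zero hc hd, L + M + 1, by rw [length_mul]; omega, ?_⟩
  have e : f * g - single (u * v) (c * d) =
      single u c * (g - single v d) + (f - single u c) * (g - single v d + single v d) := by
    rw [← single_mul_single]
    noncomm_ring
  rw [e]
  refine add_mem ?_ ?_
  · exact shortWords_mono (by omega) (mul_mem_shortWords (single_mem_shortWords le_rfl c) hg)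
  · exact shortWords_mono (by omega) (mul_mem_shortWords hf (add_mem
      (shortWords_mono (Nat.le_succ M) hg) (single_mem_shortWords hM.ge d)))

lemma Leading.single_add {u : FreeMonoid Bool} {L : ℕ} (hL : L + 1 = u.length) {c : k}
    (hc : c ≠ 0) {r : WordAlg k} (hr : r ∈ shortWords k L) : Leading (single u c + r) u :=
  ⟨c, hc, L, hL, by rwa [add_sub_cancel_left]⟩

lemma paperWord_succ (n : ℕ) :
    paperWord 1 (2 ^ (n + 1) - 1) =
      paperWord 1 (2 ^ n - 1) * of true * paperWord (2 ^ n + 1) (2 ^ n - 1) := by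
  have h1 := Nat.one_le_two_pow (n := n)
  have h2 : 2 ^ (n + 1) - 1 = (2 ^ n - 1) + 1 + (2 ^ n - 1) := by rw [pow_succ]; omega
  have h3 : 1 + (2 ^ n - 1) = 2 ^ n := by omega
  have h4 : 1 + (2 ^ n - 1 + 1) = 2 ^ n + 1 := by omega
  rw [h2, paperWord_add, paperWord_add, h3, h4]
  congr 2
  rw [paperWord, seqProd_one, fold_two_pow]

lemma paperWord_succ' (n : ℕ) :
    paperWord (2 ^ (n + 1) + 1) (2 ^ (n + 1) - 1) =
      paperWord 1 (2 ^ n - 1) * of false * paperWord (2 ^ n + 1) (2 ^ n - 1) := by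
  have h1 := Nat.one_le_two_pow (n := n)
  have h0 : 2 ^ (n + 1) = 2 ^ n + 2 ^ n := by rw [pow_succ]; omega
  have h2 : 2 ^ (n + 1) - 1 = (2 ^ n - 1) + 1 + (2 ^ n - 1) := by omega
  have h3 : 2 ^ (n + 1) + 1 + (2 ^ n - 1) = 2 ^ n * 3 := by omega
  rw [h2, paperWord_add, paperWord_add, h3]
  congr 1
  · congr 1
    · refine seqProd_congr fun i hi => congrArg of ?_
      have := fold_add_two_pow_mul (n := n) (j := 1 + i) (by omega) (by omega) 1
      rw [← this]
      congr 1
      ring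
    · rw [paperWord, seqProd_one, fold_three_mul]
  · refine seqProd_congr fun i hi => congrArg of ?_
    have hd : ¬ 2 ^ n ∣ 2 ^ n + 1 + i := by
      rw [add_assoc, Nat.dvd_add_right (dvd_refl _)]
      exact Nat.not_dvd_of_pos_of_lt (by omega) (by omega)
    have := fold_add_two_pow_mul_of_not_dvd hd 1
    rw [← this]
    congr 1
    omega

variable (k) in
/-- Lifts to the free algebra of the iterated conjugates of `1 + Y` and of their inverses. -/
noncomputable def conjLift : ℕ → WordAlg k × WordAlg k
  | 0 => (1 + single (of true) 1, 1 - single (of true) 1)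
  | n + 1 => ((conjLift n).1 * (1 + single (of false) 1) * (conjLift n).2,
      (conjLift n).1 * (1 - single (of false) 1 + single (of false) 1 ^ 2) * (conjLift n).2)

lemma leading_conjLift (n : ℕ) :
    Leading (conjLift k n).1 (of true * psi (paperWord 1 (2 ^ n - 1))) ∧
      Leading (conjLift k n).2 (of true * psi (paperWord (2 ^ n + 1) (2 ^ n - 1))) := by
  induction n with
  | zero =>
    have e : psi (paperWord 1 (2 ^ 0 - 1)) = 1 := map_one psi
    have e' : psi (paperWord (2 ^ 0 + 1) (2 ^ 0 - 1)) = 1 := map_one psi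
    rw [e, e', mul_one, conjLift]
    constructor
    · rw [add_comm]
      exact Leading.single_add (L := 0) rfl one_ne_zero (one_mem_shortWords 0)
    · rw [sub_eq_neg_add, ← single_neg]
      exact Leading.single_add (L := 0) rfl (neg_ne_zero.2 one_ne_zero) (one_mem_shortWords 0)
  | succ n ih =>
    rw [paperWord_succ, paperWord_succ', conjLift, map_mul, map_mul, map_mul, map_mul, psi_of,
      psi_of]
    have h1 : Leading (1 + single (of false) 1 : WordAlg k) (of false) := by
      rw [add_comm]
      exact Leading.single_add (L := 0) rfl one_ne_zero (one_mem_shortWords 0)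
    have h2 : Leading (1 - single (of false) 1 + single (of false) 1 ^ 2 : WordAlg k)
        (of false * of false) := by
      rw [add_comm, sq, single_mul_single, one_mul]
      exact Leading.single_add (L := 1) rfl one_ne_zero
        (sub_mem (one_mem_shortWords 1) (single_mem_shortWords le_rfl 1))
    have h3 := (ih.1.mul h1).mul ih.2
    have h4 := (ih.1.mul h2).mul ih.2
    simp only [mul_assoc] at h3 h4
    simpa [mul_assoc] using And.intro h3 h4

lemma rho_conjLift_ne {s : ℕ} (hs : 0 < (Level.seq k s).n) :
    rho k (conjLift k (Level.seq k s).n).1 ≠ rho k (1 + single (of false) 1) := by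
  intro h
  set n := (Level.seq k s).n with hn
  rw [← sub_eq_zero, ← map_sub, rho_eq_zero_iff] at h
  have h1 := h s (single (of false) 1) 1
  obtain ⟨⟨c, hc, L, hL, hr⟩, -⟩ := leading_conjLift (k := k) n
  set D := paperWord 1 (2 ^ n - 1) with hD
  have hD1 : 1 ≤ (psi D).length := by
    obtain ⟨m, hm⟩ := Nat.exists_eq_succ_of_ne_zero hs.ne'
    rw [hD, hm, paperWord_succ, map_mul, map_mul, length_mul, length_mul, psi_of]
    simp
    omega
  rw [length_mul, length_of] at hL
  have hA : Adapted (single (of true) 1 * (Level.seq k s).Δ 0) (of true * D) := by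
    have := (Adapted.single (k := k) (of true)).mul ((Level.seq k s).adapted 0)
    rwa [mul_zero, zero_add] at this
  have hpsi : psi (of true * D) = of false * (of true * psi D) := by
    rw [map_mul, psi_of, if_pos rfl, mul_assoc]
  set r := (conjLift k n).1 - single (of true * psi D) c - (1 + single (of false) 1) with hr'
  have hrm : r ∈ shortWords k L := by
    refine sub_mem hr (add_mem (one_mem_shortWords _) (single_mem_shortWords ?_ 1))
    rw [length_of]
    omega
  have e : single (of false) 1 * ((conjLift k n).1 - (1 + single (of false) 1)) * 1 =
      single (psi (of true * D)) c + single (of false) 1 * r := by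
    rw [hpsi, ← one_mul c, ← single_mul_single, hr']
    noncomm_ring
  have hz : pair (xi k s) (single (of false) 1 * r) = 0 := by
    rw [pair_eq_sum]
    refine Finset.sum_eq_zero fun w hw => mul_eq_zero_of_right _ ?_
    by_contra h'
    obtain ⟨u, hu, rfl⟩ := exists_of_coeff_psiAlg_ne_zero (Finsupp.mem_support_iff.1 hw)
    have h2 := hA.homog.psi_of_wt u hu
    have h3 := mul_mem_shortWords (single_mem_shortWords (k := k) (length_of false).le 1) hrm _ h'
    rw [h2, hpsi, length_mul, length_mul, length_of, length_of] at h3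
    omega
  rw [e, map_add, hz, add_zero] at h1
  have h4 : pair (xi k s) (single (psi (of true * D)) c) =
      c * (single (of true) 1 * (Level.seq k s).Δ 0).coeff (of true * D) := by
    rw [xi, ← coeff_psiAlg, pair_eq_sum, coeff_single, Finset.sum_eq_single (psi (of true * D))]
    · rw [Finsupp.single_eq_same, mul_comm]
    · intro w _ hw
      rw [Finsupp.single_eq_of_ne hw, mul_zero]
    · intro hw
      rw [Finsupp.notMem_support_iff.1 hw, zero_mul]
  rw [h4] at h1
  exact mul_ne_zero hc hA.coeff_ne h1

lemma exists_rho_conjLift_ne (m : ℕ) :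
    ∃ n ≥ m, rho k (conjLift k n).1 ≠ rho k (1 + single (of false) 1) := by
  have h : ∀ s, s ≤ (Level.seq k s).n := by
    intro s
    induction s with
    | zero => exact Nat.zero_le _
    | succ s ih => exact ih.trans_lt (Level.n_seq_lt s)
  exact ⟨_, (Nat.le_succ m).trans (h (m + 1)), rho_conjLift_ne ((Nat.succ_pos m).trans_le (h _))⟩

open Paper

section Adjoint

variable {k E : Type*} [CommRing k] [Ring E] [Algebra k E] {A : NonUnitalSubalgebra k E}

lemma one_add_coe_circ (a b : A) : (1 : E) + (circ a b : A) = (1 + a) * (1 + b) := by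
  simp only [circ, NonUnitalSubalgebra.coe_add, NonUnitalSubalgebra.coe_mul]
  noncomm_ring

lemma one_add_coe_injective {a b : A} (h : (1 : E) + a = 1 + b) : a = b :=
  Subtype.ext (add_left_cancel h)

lemma one_add_coe_circPow (a : A) (n : ℕ) : (1 : E) + (circPow a n : A) = (1 + a) ^ n := by
  induction n with
  | zero => simp [circPow]
  | succ n ih => rw [circPow, one_add_coe_circ, ih, pow_succ]

lemma coe_npow' (a : A) (n : ℕ) : ((npow' a n : A) : E) = (a : E) ^ (n + 1) := by
  induction n with
  | zero => simp [npow']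
  | succ n ih => rw [npow', NonUnitalSubalgebra.coe_mul, ih, pow_succ _ (n + 1)]

lemma one_add_pow_prime_pow_eq_one {p : ℕ} [Fact p.Prime] [CharP E p] {a : E}
    (ha : IsNilpotent a) : ∃ n, 0 < n ∧ (1 + a) ^ n = 1 := by
  obtain ⟨N, hN⟩ := ha
  have hp := (Fact.out : p.Prime)
  refine ⟨p ^ N, pow_pos hp.pos N, ?_⟩
  rw [add_pow_char_pow_of_commute _ _ (Commute.one_left a), one_pow,
    pow_eq_zero_of_le (Nat.lt_pow_self hp.one_lt).le hN, add_zero]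

/-- The unit `1 + a` attached to a quasi-regular element `a`. -/
def adjointUnit {q : A → A} (hq : ∀ a, circ a (q a) = 0) (hq' : ∀ a, circ (q a) a = 0) (a : A) :
    Eˣ where
  val := 1 + a
  inv := 1 + q a
  val_inv := by rw [← one_add_coe_circ, hq, NonUnitalSubalgebra.coe_zero, add_zero]
  inv_val := by rw [← one_add_coe_circ, hq', NonUnitalSubalgebra.coe_zero, add_zero]

variable {q : A → A} (hq : ∀ a, circ a (q a) = 0) (hq' : ∀ a, circ (q a) a = 0)

lemma adjointUnit_circ (a b : A) :
    adjointUnit hq hq' (circ a b) = adjointUnit hq hq' a * adjointUnit hq hq' b :=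
  Units.ext (one_add_coe_circ a b)

lemma adjointUnit_apply (a : A) : adjointUnit hq hq' (q a) = (adjointUnit hq hq' a)⁻¹ :=
  Units.ext rfl

/-- The iterated conjugates of `h`, starting with `g`, each conjugating `h` by the previous one. -/
def iterConj {G : Type*} [Group G] (g h : G) : ℕ → G
  | 0 => g
  | n + 1 => iterConj g h n * h * (iterConj g h n)⁻¹

lemma iterConj_eq_of_le {G : Type*} [Group G] {g h : G} {m n : ℕ} (hm : iterConj g h m = h)
    (hmn : m ≤ n) : iterConj g h n = h := by
  induction n, hmn using Nat.le_induction with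
  | base => exact hm
  | succ n _ ih => rw [iterConj, ih, mul_inv_cancel_right]

lemma adjointUnit_engelChain (x y : A) (n : ℕ) :
    adjointUnit hq hq' (engelChain q x y (n + 1)) =
      iterConj (adjointUnit hq hq' x) (adjointUnit hq hq' y) (n + 1) *
        (adjointUnit hq hq' y)⁻¹ := by
  have step : ∀ n, adjointUnit hq hq' (engelChain q x y (n + 1)) =
      adjointUnit hq hq' (engelChain q x y n) * adjointUnit hq hq' y *
        (adjointUnit hq hq' (engelChain q x y n))⁻¹ * (adjointUnit hq hq' y)⁻¹ := fun n => by
    rw [engelChain, adjointUnit_circ, adjointUnit_circ, adjointUnit_circ, adjointUnit_apply,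
      adjointUnit_apply]
  induction n with
  | zero => rw [step, engelChain, iterConj, iterConj]
  | succ n ih =>
    rw [step, ih, iterConj.eq_2 _ _ (n + 1)]
    group

lemma iterConj_eq_of_engelChain_eq_zero {x y : A} {n : ℕ} (h : engelChain q x y (n + 1) = 0) :
    iterConj (adjointUnit hq hq' x) (adjointUnit hq hq' y) (n + 1) = adjointUnit hq hq' y := by
  rw [← mul_inv_eq_one, ← adjointUnit_engelChain, h]
  exact Units.ext (by simp [adjointUnit])

end Adjoint

lemma val_iterConj {g h : (Module.End k (WordAlg k ⧸ annihilated k))ˣ}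
    (hg : (g : Module.End k (WordAlg k ⧸ annihilated k)) = 1 + letter k true)
    (hh : (h : Module.End k (WordAlg k ⧸ annihilated k)) = 1 + letter k false) (n : ℕ) :
    rho k (conjLift k n).1 = (iterConj g h n : (Module.End k (WordAlg k ⧸ annihilated k))ˣ) ∧
      rho k (conjLift k n).2 =
        ((iterConj g h n)⁻¹ : (Module.End k (WordAlg k ⧸ annihilated k))ˣ) := by
  have hg' : ((g⁻¹ : (Module.End k (WordAlg k ⧸ annihilated k))ˣ) :
      Module.End k (WordAlg k ⧸ annihilated k)) = 1 - letter k true := by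
    rw [Units.inv_eq_of_mul_eq_one_right]
    have e : (1 + letter k true) * (1 - letter k true) = 1 - letter k true ^ 2 := by
      simp only [add_mul, mul_sub, mul_one, one_mul, sq]
      abel
    rw [hg, e, letter_true_sq, sub_zero]
  have hh' : ((h⁻¹ : (Module.End k (WordAlg k ⧸ annihilated k))ˣ) :
      Module.End k (WordAlg k ⧸ annihilated k)) = 1 - letter k false + letter k false ^ 2 := by
    rw [Units.inv_eq_of_mul_eq_one_right]
    have e : (1 + letter k false) * (1 - letter k false + letter k false ^ 2) =
        1 + letter k false ^ 3 := by
      simp only [add_mul, mul_add, mul_sub, mul_one, one_mul, pow_succ, pow_zero, mul_assoc]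
      abel
    rw [hh, e, letter_false_cube, add_zero]
  induction n with
  | zero =>
    rw [conjLift, map_add, map_sub, map_one, iterConj, hg, hg']
    exact ⟨rfl, rfl⟩
  | succ n ih =>
    have e : (iterConj g h n * h * (iterConj g h n)⁻¹)⁻¹ =
      iterConj g h n * h⁻¹ * (iterConj g h n)⁻¹ := by group
    rw [conjLift, iterConj, e]
    simp only [map_mul, map_add, map_sub, map_one, map_pow, Units.val_mul, ih, hh, hh']
    exact ⟨rfl, rfl⟩

variable (k) in
/-- The algebra generated by the images of the two letters. -/
noncomputable def letterAlg : NonUnitalSubalgebra k (Module.End k (WordAlg k ⧸ annihilated k)) :=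
  NonUnitalAlgebra.adjoin k {letter k true, letter k false}

lemma letter_mem_letterAlg (c : Bool) : letter k c ∈ letterAlg k :=
  NonUnitalAlgebra.subset_adjoin k (by cases c <;> simp)

lemma isNilpotent_of_mem_letterAlg {a : Module.End k (WordAlg k ⧸ annihilated k)}
    (ha : a ∈ letterAlg k) : IsNilpotent a := by
  obtain ⟨f, hf, rfl⟩ : ∃ f : WordAlg k, f.coeff 1 = 0 ∧ rho k f = a := by
    have hc : ∀ c, ∃ f : WordAlg k, f.coeff 1 = 0 ∧ rho k f = letter k c := fun c =>
      ⟨single (of c) 1, by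
        rw [coeff_single, Finsupp.single_eq_of_ne]
        exact fun h => by simpa using congrArg FreeMonoid.length h, rfl⟩
    induction ha using NonUnitalAlgebra.adjoin_induction with
    | mem a ha => rcases ha with rfl | rfl <;> exact hc _
    | add a b _ _ ha hb =>
      obtain ⟨f, hf, rfl⟩ := ha
      obtain ⟨g, hg, rfl⟩ := hb
      exact ⟨f + g, by rw [coeff_add, Finsupp.add_apply, hf, hg, add_zero], map_add ..⟩
    | zero => exact ⟨0, rfl, map_zero _⟩
    | mul a b _ _ ha hb =>
      obtain ⟨f, hf, rfl⟩ := ha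
      obtain ⟨g, hg, rfl⟩ := hb
      refine ⟨f * g, ?_, map_mul ..⟩
      by_contra h
      obtain ⟨u, v, hu, hv, e⟩ := exists_of_coeff_mul_ne_zero h
      have := congrArg FreeMonoid.length e
      rw [length_mul, length_one] at this
      rw [FreeMonoid.length_eq_zero.1 (Nat.eq_zero_of_add_eq_zero_right this)] at hu
      exact hu hf
    | smul r a _ ha =>
      obtain ⟨f, hf, rfl⟩ := ha
      exact ⟨r • f, by rw [coeff_smul_apply, hf, smul_zero], map_smul ..⟩
  exact exists_rho_pow_eq_zero hf

/-- The two generators of `letterAlg`. -/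
noncomputable def gen (k : Type*) [Field k] (c : Bool) : letterAlg k :=
  ⟨letter k c, letter_mem_letterAlg c⟩

lemma adjoin_gen : NonUnitalAlgebra.adjoin k {gen k true, gen k false} = ⊤ := by
  refine eq_top_iff.2 fun a _ => ?_
  have h : (NonUnitalAlgebra.adjoin k {gen k true, gen k false}).map
      (NonUnitalSubalgebraClass.subtype (letterAlg k)) = letterAlg k := by
    rw [NonUnitalAlgHom.map_adjoin, Set.image_pair]
    rfl
  obtain ⟨b, hb, e⟩ := NonUnitalSubalgebra.mem_map.1 (h.ge a.2)
  rwa [← (Subtype.ext e : b = a)]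

lemma exists_circPow_eq_zero {p : ℕ} [Fact p.Prime] [CharP k p] (a : letterAlg k) :
    ∃ n, 0 < n ∧ circPow a n = 0 := by
  obtain ⟨_, -, hne⟩ := exists_rho_conjLift_ne (k := k) 0
  have : Nontrivial (Module.End k (WordAlg k ⧸ annihilated k)) := ⟨_, _, hne⟩
  have : CharP (Module.End k (WordAlg k ⧸ annihilated k)) p :=
    charP_of_injective_algebraMap (algebraMap k _).injective p
  obtain ⟨n, hn, h⟩ := one_add_pow_prime_pow_eq_one (p := p) (isNilpotent_of_mem_letterAlg a.2)
  refine ⟨n, hn, one_add_coe_injective ?_⟩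
  rw [one_add_coe_circPow, h, NonUnitalSubalgebra.coe_zero, add_zero]

lemma exists_quasiInverse {p : ℕ} [Fact p.Prime] [CharP k p] (a : letterAlg k) :
    ∃ b, circ a b = 0 ∧ circ b a = 0 := by
  obtain ⟨n, hn, h⟩ := exists_circPow_eq_zero (p := p) a
  obtain ⟨m, rfl⟩ := Nat.exists_eq_succ_of_ne_zero hn.ne'
  refine ⟨circPow a m, ?_, h⟩
  rw [← h]
  apply one_add_coe_injective
  rw [one_add_coe_circ, one_add_coe_circPow, one_add_coe_circPow, pow_succ']

lemma engelChain_gen_ne_zero {q : letterAlg k → letterAlg k} (hq : ∀ a, circ a (q a) = 0)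
    (hq' : ∀ a, circ (q a) a = 0) (n : ℕ) :
    engelChain q (gen k true) (gen k false) (n + 1) ≠ 0 := by
  intro h
  obtain ⟨m, hm, hne⟩ := exists_rho_conjLift_ne (k := k) (n + 1)
  have h1 := iterConj_eq_of_le (iterConj_eq_of_engelChain_eq_zero hq hq' h) hm
  apply hne
  rw [(val_iterConj (g := adjointUnit hq hq' (gen k true))
    (h := adjointUnit hq hq' (gen k false)) rfl rfl m).1, h1, map_add, map_one]
  rfl

end WordAlgebra

namespace Paper

/-- There is a prime `p` and a nil `𝔽_p`-algebra generated by two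
elements (equivalently, a finitely generated two-sided brace, i.e. a finitely
generated Jacobson radical ring) whose adjoint (multiplicative) group is a torsion
group but not an Engel group. -/
theorem exists_fg_radical_ring_torsion_not_engel :
    ∃ (p : ℕ) (hp : Fact p.Prime), Nonempty (@TorsionNotEngelWitness p hp) := by
  have : Fact (Nat.Prime 3) := ⟨Nat.prime_three⟩
  choose q hq hq' using WordAlgebra.exists_quasiInverse (k := ZMod 3) (p := 3)
  exact ⟨3, this, ⟨{
    carrier := WordAlgebra.letterAlg (ZMod 3)
    gen₁ := WordAlgebra.gen (ZMod 3) true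
    gen₂ := WordAlgebra.gen (ZMod 3) false
    generates := WordAlgebra.adjoin_gen
    nil := fun a => by
      obtain ⟨n, hn⟩ := WordAlgebra.isNilpotent_of_mem_letterAlg a.2
      exact ⟨n, Subtype.ext ((WordAlgebra.coe_npow' a n).trans (pow_eq_zero_of_le n.le_succ hn))⟩
    qinv := q
    circ_qinv := hq
    qinv_circ := hq'
    torsion := WordAlgebra.exists_circPow_eq_zero (p := 3)
    x := WordAlgebra.gen (ZMod 3) true
    y := WordAlgebra.gen (ZMod 3) false
    not_engel := WordAlgebra.engelChain_gen_ne_zero hq hq' }⟩⟩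

end Paper
end

section
/- Let F be a field and n a natural number. Let R be an associative F-algebra without identity generated by two elements a, b satisfying a² = 0 and bⁿ = 0. Let S be the F-linear subspace of R spanned by the elements a·bⁱ for 0 < i < n. If for every k every k×k matrix with entries in S is nilpotent, then R is a Jacobson radical ring; that is, every element of R is quasi-regular, equivalently the operation x∘y = x·y + x + y makes R into a group with identity 0. -/
namespace Paper

section Linearization

variable {F A : Type*} [Field F] [Ring A] [Algebra F A]

/-- A submodule `W` of an algebra is matrix-radical if `1 - M` is a unit for every square
matrix `M` with entries in `W`. -/
def MatrixRadical (W : Submodule F A) : Prop :=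
  ∀ (ι : Type) [Fintype ι] [DecidableEq ι] (M : Matrix ι ι A),
    (∀ i j, M i j ∈ W) → IsUnit (1 - M)

/-- If the block matrix with lower right corner `1` is a unit, then so is its Schur
complement. -/
theorem isUnit_sub_mul_of_isUnit_fromBlocks {ι κ : Type*} [Fintype ι] [DecidableEq ι]
    [Fintype κ] [DecidableEq κ] (X : Matrix ι ι A) (Y : Matrix ι κ A) (Z : Matrix κ ι A)
    (h : IsUnit (Matrix.fromBlocks X Y Z 1)) : IsUnit (X - Y * Z) := by
  obtain ⟨N, hN, hN'⟩ := isUnit_iff_exists.mp h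
  rw [← Matrix.fromBlocks_toBlocks N, Matrix.fromBlocks_multiply, ← Matrix.fromBlocks_one,
    Matrix.fromBlocks_inj] at hN hN'
  obtain ⟨h₁, -, h₂, -⟩ := hN
  obtain ⟨h₃, h₄, -, -⟩ := hN'
  rw [Matrix.one_mul] at h₂
  rw [Matrix.mul_one] at h₄
  refine isUnit_iff_exists.mpr ⟨N.toBlocks₁₁, ?_, ?_⟩
  · rw [Matrix.sub_mul, Matrix.mul_assoc, eq_neg_of_add_eq_zero_left h₂, Matrix.mul_neg,
      sub_neg_eq_add, h₁]
  · rw [Matrix.mul_sub, ← Matrix.mul_assoc, eq_neg_of_add_eq_zero_left h₄, Matrix.neg_mul,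
      sub_neg_eq_add, h₃]

theorem MatrixRadical.sup_mul_span_pair {W : Submodule F A} (hW : MatrixRadical W) {a b : A}
    (ha : a ∈ W) (hb : b ∈ W) : MatrixRadical (W ⊔ W * Submodule.span F {a, b}) := by
  intro ι _ _ M hM
  have key : ∀ i j, ∃ x y z : A, x ∈ W ∧ y ∈ W ∧ z ∈ W ∧ M i j = x + (y * a + z * b) := by
    intro i j
    obtain ⟨x, hx, u, hu, hxu⟩ := Submodule.mem_sup.mp (hM i j)
    rw [Submodule.span_insert, Submodule.mul_sup, Submodule.mem_sup] at hu
    obtain ⟨v, hv, w, hw, rfl⟩ := hu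
    obtain ⟨y, hy, rfl⟩ := Submodule.mem_mul_span_singleton.mp hv
    obtain ⟨z, hz, rfl⟩ := Submodule.mem_mul_span_singleton.mp hw
    exact ⟨x, y, z, hx, hy, hz, hxu.symm⟩
  choose x y z hx hy hz hM using key
  let Y : Matrix ι (ι ⊕ ι) A := Matrix.fromCols (Matrix.of y) (Matrix.of z)
  let Z : Matrix (ι ⊕ ι) ι A := Matrix.fromRows (Matrix.scalar ι a) (Matrix.scalar ι b)
  have hMeq : 1 - M = (1 - Matrix.of x) - Y * Z := by
    ext i j
    simp [Y, Z, hM, Matrix.fromCols_mul_fromRows, sub_sub]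
  rw [hMeq]
  apply isUnit_sub_mul_of_isUnit_fromBlocks
  have hblock : Matrix.fromBlocks (1 - Matrix.of x) Y Z 1 =
      1 - Matrix.fromBlocks (Matrix.of x) (-Y) (-Z) 0 := by
    rw [← Matrix.fromBlocks_one (l := ι) (m := ι ⊕ ι),
      sub_eq_add_neg (Matrix.fromBlocks 1 0 0 1), Matrix.fromBlocks_neg, Matrix.fromBlocks_add]
    simp [sub_eq_add_neg]
  rw [hblock]
  refine hW _ _ ?_
  rintro (i | i) (j | j)
  · exact hx i j
  · rcases j with j | j
    · exact W.neg_mem (hy i j)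
    · exact W.neg_mem (hz i j)
  · have hscalar : ∀ c ∈ W, ∀ i, -(Matrix.scalar ι c i j) ∈ W := by
      intro c hc i
      by_cases hij : i = j <;> simp [hij, hc]
    rcases i with i | i
    · exact hscalar a ha i
    · exact hscalar b hb i
  · exact W.zero_mem

theorem MatrixRadical.span_mul_pow {a b : A} (h : MatrixRadical (Submodule.span F {a, b}))
    (d : ℕ) :
    MatrixRadical (Submodule.span F {a, b} * (1 ⊔ Submodule.span F {a, b}) ^ d) := by
  induction d with
  | zero => simpa using h
  | succ d ih =>
    have hle : Submodule.span F {a, b} ≤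
        Submodule.span F {a, b} * (1 ⊔ Submodule.span F {a, b}) ^ d := by
      conv_lhs => rw [← mul_one (Submodule.span F {a, b})]
      exact mul_le_mul_right (one_le_pow₀ le_sup_left) _
    have := ih.sup_mul_span_pair (hle (Submodule.subset_span (Set.mem_insert a _)))
      (hle (Submodule.subset_span (Set.mem_insert_of_mem a rfl)))
    rwa [pow_succ, ← mul_assoc, Submodule.mul_sup, mul_one]

theorem commute_map_algebraMap_scalar {ι : Type*} [Fintype ι] [DecidableEq ι]
    (P : Matrix ι ι F) (x : A) :
    Commute ((algebraMap F A).mapMatrix P) (Matrix.scalar ι x) := by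
  ext i j
  simp [Algebra.commutes]

/-- Linear matrices in `a` and `b` are quasi-regular when `a ^ 2 = 0`, `b ^ n = 0` and all
matrices over the span of the `a * b ^ i`, `0 < i < n`, are nilpotent. -/
theorem matrixRadical_span_pair {a b : A} {n : ℕ} (ha : a * a = 0) (hb : b ^ n = 0)
    (S : Submodule F A) (hS : ∀ i, 0 < i → i < n → a * b ^ i ∈ S)
    (hnil : ∀ (ι : Type) [Fintype ι] [DecidableEq ι] (M : Matrix ι ι A),
      (∀ i j, M i j ∈ S) → IsNilpotent M) :
    MatrixRadical (Submodule.span F {a, b}) := by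
  intro ι _ _ M hM
  simp only [Submodule.mem_span_pair] at hM
  choose p q hpq using hM
  set φ := (algebraMap F A).mapMatrix (m := ι)
  set α : Matrix ι ι A := Matrix.scalar ι a
  set β : Matrix ι ι A := Matrix.scalar ι b
  set P := φ (Matrix.of p)
  set Q := φ (Matrix.of q)
  have hMeq : M = P * α + Q * β := by
    ext i j
    simp [P, Q, φ, α, β, ← hpq, Algebra.smul_def]
  have hPα : Commute P α := commute_map_algebraMap_scalar _ _
  have hQα : Commute Q α := commute_map_algebraMap_scalar _ _
  have hQβ : Commute Q β := commute_map_algebraMap_scalar _ _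
  have hαα : α * α = 0 := by rw [← map_mul, ha, map_zero]
  have hαPα : ∀ X, P * α * (P * α * X) = 0 := by
    intro X
    rw [← mul_assoc, hPα.symm.mul_mul_mul_comm, hαα, mul_zero, zero_mul]
  have hQβn : (Q * β) ^ n = 0 := by
    rw [hQβ.mul_pow, ← map_pow (Matrix.scalar ι), hb, map_zero, mul_zero]
  set G := ∑ i ∈ Finset.range n, (Q * β) ^ i
  have hG : G * (1 - Q * β) = 1 := by rw [geom_sum_mul_neg, hQβn, sub_zero]
  have hT : IsNilpotent (P * α * (G - 1)) := by
    apply hnil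
    have hterm : ∀ i, P * α * (Q * β) ^ i =
        φ (Matrix.of p * Matrix.of q ^ i) * Matrix.scalar ι (a * b ^ i) := by
      intro i
      rw [hQβ.mul_pow, mul_assoc, ← mul_assoc α, ← (hQα.pow_left i).eq, map_mul, map_mul,
        map_pow, map_pow]
      simp only [mul_assoc, P, Q, α, β]
    intro j k
    rcases n with _ | n
    · have : Subsingleton A := subsingleton_of_zero_eq_one (by simpa using hb.symm)
      convert S.zero_mem
    · simp only [G, Finset.sum_range_succ', pow_zero, add_sub_cancel_right, Finset.mul_sum]
      rw [Matrix.sum_apply]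
      refine S.sum_mem fun i hi => ?_
      rw [hterm]
      have := S.smul_mem ((Matrix.of p * Matrix.of q ^ (i + 1)) j k)
        (hS (i + 1) i.succ_pos (by simpa using hi))
      simpa only [φ, Matrix.scalar_apply, Matrix.mul_diagonal, RingHom.mapMatrix_apply,
        Matrix.map_apply, Algebra.smul_def] using this
  have hu₁ : IsUnit (1 - Q * β) := IsNilpotent.isUnit_one_sub ⟨n, hQβn⟩
  have hu₂ : IsUnit (1 + P * α) :=
    IsNilpotent.isUnit_one_add ⟨2, by simpa [pow_two] using hαPα 1⟩
  have hu₃ := hT.isUnit_one_sub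
  have hfac : (1 + P * α) * (1 - M) = (1 - P * α * (G - 1)) * (1 - Q * β) := by
    have h₁ := hαPα 1
    rw [mul_one] at h₁
    calc (1 + P * α) * (1 - M)
        = (1 + P * α) * (1 - Q * β) - P * α - P * α * (P * α) := by rw [hMeq]; noncomm_ring
      _ = (1 + P * α) * (1 - Q * β) - P * α * (G * (1 - Q * β)) := by
        rw [h₁, hG, mul_one, sub_zero]
      _ = _ := by noncomm_ring
  exact (IsUnit.mul_left_iff hu₂).mp (hfac ▸ hu₃.mul hu₁)

end Linearization

section Unitization

variable {F R : Type*} [Field F] [NonUnitalRing R] [Module F R] [SMulCommClass F R R]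
  [IsScalarTower F R R]

theorem inr_npow' (x : R) (m : ℕ) :
    ((npow' x m : R) : Unitization F R) = (x : Unitization F R) ^ (m + 1) := by
  induction m with
  | zero => simp [npow']
  | succ m ih => rw [npow', Unitization.inr_mul, ih, pow_succ _ (m + 1)]

theorem map_inr_npow' {ι : Type*} [Fintype ι] [DecidableEq ι] (M : Matrix ι ι R) (m : ℕ) :
    (npow' M m).map (Unitization.inr : R → Unitization F R) =
      M.map (Unitization.inr : R → Unitization F R) ^ (m + 1) := by
  induction m with
  | zero => simp [npow']
  | succ m ih =>
    rw [npow', pow_succ _ (m + 1), ← ih]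
    exact Matrix.map_mul (f := Unitization.inrNonUnitalAlgHom F R)

theorem isNilpotent_of_mem_map_inr (S : Submodule F R)
    (hmat : ∀ k : ℕ, ∀ M : Matrix (Fin k) (Fin k) R,
      (∀ i j, M i j ∈ S) → ∃ m : ℕ, npow' M m = 0)
    {ι : Type*} [Fintype ι] [DecidableEq ι] (M : Matrix ι ι (Unitization F R))
    (hM : ∀ i j, M i j ∈ S.map (Unitization.inrHom F F R)) : IsNilpotent M := by
  choose N hN hNM using hM
  let e := Fintype.equivFin ι
  obtain ⟨m, hm⟩ := hmat _ ((Matrix.of N).submatrix e.symm e.symm) fun i j => hN _ _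
  have hm' := map_inr_npow' (F := F) ((Matrix.of N).submatrix e.symm e.symm) m
  have hre : ((Matrix.of N).submatrix e.symm e.symm).map (Unitization.inr : R → Unitization F R)
      = Matrix.reindexAlgEquiv F (Unitization F R) e M := by
    ext1 i j
    exact hNM _ _
  rw [hm, hre, Matrix.map_zero _ (Unitization.inr_zero F), ← map_pow] at hm'
  exact ⟨m + 1, (map_eq_zero_iff _ (AlgEquiv.injective _)).mp hm'.symm⟩

/-- Every element of a non-unital subalgebra generated by `a` and `b` is a combination of
nonempty words of bounded length. -/
theorem exists_inr_mem_span_mul_pow {a b x : R} (hx : x ∈ NonUnitalAlgebra.adjoin F {a, b}) :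
    ∃ d : ℕ, (x : Unitization F R) ∈
      Submodule.span F {(a : Unitization F R), (b : Unitization F R)} *
        (1 ⊔ Submodule.span F {(a : Unitization F R), (b : Unitization F R)}) ^ d := by
  set L := Submodule.span F {(a : Unitization F R), (b : Unitization F R)}
  have hmono : Monotone fun d : ℕ => L * (1 ⊔ L) ^ d := fun d e hde =>
    mul_le_mul_right (pow_le_pow_right₀ le_sup_left hde) _
  induction hx using NonUnitalAlgebra.adjoin_induction with
  | mem x hx =>
    refine ⟨0, ?_⟩
    rw [pow_zero, mul_one]
    apply Submodule.subset_span
    rcases hx with rfl | rfl <;> simp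
  | zero => exact ⟨0, by simp⟩
  | add x y _ _ hx hy =>
    obtain ⟨d, hd⟩ := hx
    obtain ⟨e, he⟩ := hy
    refine ⟨max d e, ?_⟩
    rw [Unitization.inr_add]
    exact add_mem (hmono (le_max_left d e) hd) (hmono (le_max_right d e) he)
  | mul x y _ _ hx hy =>
    obtain ⟨d, hd⟩ := hx
    obtain ⟨e, he⟩ := hy
    refine ⟨d + 1 + e, ?_⟩
    rw [Unitization.inr_mul, pow_add, pow_succ, mul_assoc (_ ^ d)]
    have := Submodule.mul_mem_mul hd he
    rw [mul_assoc] at this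
    have hle : (1 ⊔ L) ^ d * (L * (1 ⊔ L) ^ e) ≤ (1 ⊔ L) ^ d * ((1 ⊔ L) * (1 ⊔ L) ^ e) := by
      gcongr
      exact le_sup_right
    exact mul_le_mul_right hle L this
  | smul r x _ hx =>
    obtain ⟨d, hd⟩ := hx
    exact ⟨d, by rw [Unitization.inr_smul]; exact Submodule.smul_mem _ r hd⟩

end Unitization

/-- Let `F` be a field, `n` a natural number, and `R` an associative
`F`-algebra without identity generated by elements `a, b` with `a² = 0` and `bⁿ = 0`.
Let `S` be the `F`-linear span of the elements `a·bⁱ` for `0 < i < n`.  If every square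
matrix (of any size) with entries in `S` is nilpotent, then `R` is a Jacobson radical
ring: every element is quasi-regular, i.e. `x ∘ y = x·y + x + y` makes `R` a group
with identity `0`. -/
theorem radical_of_matrices_nilpotent
    (F : Type) [Field F] (R : Type) [NonUnitalRing R] [Module F R]
    [SMulCommClass F R R] [IsScalarTower F R R]
    (n : ℕ) (hn : 0 < n) (a b : R)
    (hgen : NonUnitalAlgebra.adjoin F {a, b} = ⊤)
    (ha : a * a = 0) (hb : npow' b (n - 1) = 0)
    (S : Submodule F R)
    (hS : S = Submodule.span F {x : R | ∃ i : ℕ, 0 < i ∧ i < n ∧ x = a * npow' b (i - 1)})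
    (hmat : ∀ k : ℕ, ∀ M : Matrix (Fin k) (Fin k) R,
      (∀ i j, M i j ∈ S) → ∃ m : ℕ, npow' M m = 0) :
    ∀ x : R, ∃ z : R, circ x z = 0 ∧ circ z x = 0 := by
  subst hS
  intro x
  have hb' : (b : Unitization F R) ^ n = 0 := by
    rw [← Nat.sub_add_cancel hn, ← inr_npow', hb, Unitization.inr_zero]
  have ha' : (a : Unitization F R) * a = 0 := by
    rw [← Unitization.inr_mul, ha, Unitization.inr_zero]
  have hlin : MatrixRadical (Submodule.span F {(a : Unitization F R), (b : Unitization F R)}) := by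
    refine matrixRadical_span_pair ha' hb' _ (fun i hi hin => ?_)
      fun ι _ _ M hM => isNilpotent_of_mem_map_inr _ hmat M hM
    refine ⟨a * npow' b (i - 1), Submodule.subset_span ⟨i, hi, hin, rfl⟩, ?_⟩
    rw [Unitization.inrHom_apply, Unitization.inr_mul, inr_npow', Nat.sub_add_cancel hi]
  obtain ⟨d, hd⟩ := exists_inr_mem_span_mul_pow (F := F) (a := a) (b := b) (x := x)
    (hgen ▸ NonUnitalAlgebra.mem_top)
  have hunit := hlin.span_mul_pow d Unit (Matrix.of fun _ _ => -(x : Unitization F R))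
    fun _ _ => Submodule.neg_mem _ hd
  have hx : IsUnit (1 + (x : Unitization F R)) := by
    have := hunit.map (Matrix.uniqueAlgEquiv (R := F) (m := Unit) (A := Unitization F R))
    simpa using this
  obtain ⟨z, hz, hz'⟩ :=
    isQuasiregular_iff.mp ((isQuasiregular_iff_isUnit' F).mpr hx)
  refine ⟨z, ?_, ?_⟩
  · rw [circ, ← hz]; abel
  · rw [circ, ← hz']; abel

end Paper
end
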